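/- Let H be a C^k (k ≥ 2) Tonelli Hamiltonian on T*𝕋ⁿ with Hamiltonian flow (φ^H_t). Then H has no conjugate points if and only if there exists a continuous map F : ℝⁿ × ℝⁿ → ℝⁿ such that: (i) F(x+m, c) = F(x, c) for all m ∈ ℤⁿ; (ii) for every c ∈ ℝⁿ, the map x ↦ F(x,c) is Lipschitz and there exists a C¹ ℤⁿ-periodic function u_c : ℝⁿ → ℝ with F(x,c) = c + ∇u_c(x) for all x (so each graph 𝒯_c = {(x, F(x,c))} is a Lipschitz Lagrangian graph of cohomology class c); (iii) each graph 𝒯_c is invariant under (φ^H_t); (iv) for every x ∈ ℝⁿ, the map c ↦ F(x,c) is a homeomorphism of ℝⁿ onto ℝⁿ; in particular the graphs 𝒯_c, c ∈ ℝⁿ, partition ℝⁿ × ℝⁿ, yielding a continuous foliation of T*𝕋ⁿ by Lipschitz, Lagrangian, flow-invariant graphs. -/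

import Mathlib

open MeasureTheory Filter
open scoped NNReal

noncomputable section

abbrev E (n : ℕ) : Type := Fin n → ℝ

/-- The vector of `ℝⁿ` whose coordinates are the integers `m i`. -/
def intVec {n : ℕ} (m : Fin n → ℤ) : E n := fun i => (m i : ℝ)

/-- A Tonelli Hamiltonian on `T*𝕋ⁿ`, identified with a `ℤⁿ`-periodic (in `x`) function
on `ℝⁿ × ℝⁿ` which is `Cᵏ`, uniformly superlinear in `p` and with positive definite
fiberwise Hessian. -/
structure IsTonelliHamiltonian (n : ℕ) (k : ℕ∞) (H : E n × E n → ℝ) : Prop where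
  smooth : ContDiff ℝ k H
  periodic : ∀ (x p : E n) (m : Fin n → ℤ), H (x + intVec m, p) = H (x, p)
  superlinear : ∀ C : ℝ, ∃ R : ℝ, ∀ (x p : E n), R ≤ ‖p‖ → C * ‖p‖ ≤ H (x, p)
  posdef : ∀ (x p w : E n), w ≠ 0 →
    0 < fderiv ℝ (fun p' => fderiv ℝ (fun p'' => H (x, p'')) p' w) p w

/-- The gradient of `H` in the fiber direction, `∂H/∂p (x, p)`, as a vector of `ℝⁿ`. -/
def gradP (n : ℕ) (H : E n × E n → ℝ) (x p : E n) : E n :=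
  fun i => fderiv ℝ (fun p' => H (x, p')) p (Pi.single i 1)

/-- The gradient of `H` in the base direction, `∂H/∂x (x, p)`, as a vector of `ℝⁿ`. -/
def gradX (n : ℕ) (H : E n × E n → ℝ) (x p : E n) : E n :=
  fun i => fderiv ℝ (fun x' => H (x', p)) x (Pi.single i 1)

/-- The Hamiltonian vector field `X_H (x, p) = (∂H/∂p, -∂H/∂x)`. -/
def hamVF (n : ℕ) (H : E n × E n → ℝ) (z : E n × E n) : E n × E n :=
  (gradP n H z.1 z.2, -gradX n H z.1 z.2)

/-- `φ` is the complete Hamiltonian flow of `H` on `ℝⁿ × ℝⁿ`. -/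
def IsHamFlow (n : ℕ) (H : E n × E n → ℝ) (φ : ℝ → E n × E n → E n × E n) : Prop :=
  (∀ z : E n × E n, φ 0 z = z) ∧
  ∀ (z : E n × E n) (t : ℝ), HasDerivAt (fun s => φ s z) (hamVF n H (φ t z)) t

/-- The flow `φ` has no conjugate points: for `t ≠ 0` the image of the vertical
subspace `{0} × ℝⁿ` under `Dφ_t(z)` meets `{0} × ℝⁿ` only in `0`. -/
def NoConjugatePoints (n : ℕ) (φ : ℝ → E n × E n → E n × E n) : Prop :=
  ∀ (z : E n × E n) (t : ℝ), t ≠ 0 → ∀ w : E n,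
    (fderiv ℝ (φ t) z (0, w)).1 = 0 → w = 0

/-- The gradient of a function `u : ℝⁿ → ℝ`, as a vector of `ℝⁿ`. -/
def gradF (n : ℕ) (u : E n → ℝ) (x : E n) : E n :=
  fun i => fderiv ℝ u x (Pi.single i 1)

/-- The euclidean pairing of two vectors of `ℝⁿ`. -/
def dotP (n : ℕ) (a b : E n) : ℝ := ∑ i, a i * b i

/-- The standard symplectic form `ω₀((a,b),(a',b')) = ⟨b, a'⟩ − ⟨a, b'⟩` on `ℝⁿ × ℝⁿ`. -/
def omega0 (n : ℕ) (w w' : E n × E n) : ℝ := dotP n w.2 w'.1 - dotP n w.1 w'.2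

/-- The Jacobian matrix of a map `ψ : ℝⁿ → ℝⁿ` at `x`. -/
def jacobian (n : ℕ) (ψ : E n → E n) (x : E n) : Matrix (Fin n) (Fin n) ℝ :=
  Matrix.of fun i j => fderiv ℝ (fun y => ψ y i) x (Pi.single j 1)

/-- `R = O(Iˢ)` near the zero section: on some neighborhood `{‖I‖ ≤ ε}` of `𝕋ⁿ × {0}`,
all mixed partial derivatives `∂_θ^a ∂_I^b R` with `b < s` are bounded by
`C_{a,b} ‖I‖^{s-b}`. -/
def BigOI (n : ℕ) (s : ℕ) (R : E n × E n → E n) : Prop :=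
  ∃ ε : ℝ, 0 < ε ∧ ∀ a b : ℕ, b < s → ∃ C : ℝ, ∀ θ I : E n, ‖I‖ ≤ ε →
    ‖iteratedFDeriv ℝ a (fun θ' => iteratedFDeriv ℝ b (fun I' => R (θ', I')) I) θ‖
      ≤ C * ‖I‖ ^ (s - b)

/-- A strongly Diophantine vector of `ℝⁿ`. -/
def StronglyDiophantine (n : ℕ) (ω : E n) : Prop :=
  ∃ γ : ℝ, 0 < γ ∧ ∃ τ : ℝ, ∀ k : Fin n → ℤ, k ≠ 0 → ∀ l : ℤ,
    γ / ‖intVec k‖ ^ τ ≤ |dotP n (intVec k) ω + (l : ℝ)|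

/-- The `Cᵏ` norm of a map `ℝⁿ → ℝⁿ` (the supremum of the norms of all its iterated
derivatives of order `≤ k`; a genuine supremum for periodic smooth maps). -/
noncomputable def CkNorm (n k : ℕ) (f : E n → E n) : ℝ :=
  ⨆ p : E n × Fin (k + 1), ‖iteratedFDeriv ℝ (p.2 : ℕ) f p.1‖

section FoliationByGraphs

open scoped Topology

/-! ### The euclidean pairing -/

/-- The euclidean pairing as a continuous bilinear map. -/
def dotB (n : ℕ) : E n →L[ℝ] E n →L[ℝ] ℝ :=
  LinearMap.toContinuousLinearMap
    ((LinearMap.toContinuousLinearMap (𝕜 := ℝ) (E := E n) (F' := ℝ)).toLinearMap ∘ₗ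
      (dotProductBilin ℝ ℝ : (Fin n → ℝ) →ₗ[ℝ] (Fin n → ℝ) →ₗ[ℝ] ℝ))

lemma dotB_apply (n : ℕ) (a b : E n) : dotB n a b = dotP n a b := rfl

lemma dotP_add_left (n : ℕ) (a b c : E n) : dotP n (a + b) c = dotP n a c + dotP n b c := by
  simp [← dotB_apply]

lemma dotP_add_right (n : ℕ) (a b c : E n) : dotP n a (b + c) = dotP n a b + dotP n a c := by
  simp [← dotB_apply]

lemma dotP_sub_left (n : ℕ) (a b c : E n) : dotP n (a - b) c = dotP n a c - dotP n b c := by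
  simp [← dotB_apply]

lemma dotP_sub_right (n : ℕ) (a b c : E n) : dotP n a (b - c) = dotP n a b - dotP n a c := by
  simp [← dotB_apply]

lemma dotP_neg_left (n : ℕ) (a c : E n) : dotP n (-a) c = -dotP n a c := by
  simp [← dotB_apply]

lemma dotP_neg_right (n : ℕ) (a c : E n) : dotP n a (-c) = -dotP n a c := by
  simp [← dotB_apply]

lemma dotP_smul_left (n : ℕ) (r : ℝ) (a c : E n) : dotP n (r • a) c = r * dotP n a c := by
  simp [← dotB_apply]

lemma dotP_smul_right (n : ℕ) (r : ℝ) (a c : E n) : dotP n a (r • c) = r * dotP n a c := by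
  simp [← dotB_apply]

@[simp] lemma dotP_zero_left (n : ℕ) (c : E n) : dotP n 0 c = 0 := by
  simp [← dotB_apply]

@[simp] lemma dotP_zero_right (n : ℕ) (c : E n) : dotP n c 0 = 0 := by
  simp [← dotB_apply]

lemma dotP_comm (n : ℕ) (a b : E n) : dotP n a b = dotP n b a := by
  simp [dotP, mul_comm]

lemma dotP_single (n : ℕ) (a : E n) (i : Fin n) (r : ℝ) :
    dotP n a (Pi.single i r) = a i * r := by
  simp [dotP, Pi.single_apply]

lemma abs_dotP_le (n : ℕ) (a b : E n) : |dotP n a b| ≤ n * ‖a‖ * ‖b‖ := by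
  unfold dotP
  refine (Finset.abs_sum_le_sum_abs _ _).trans ?_
  calc ∑ i, |a i * b i| ≤ ∑ _i : Fin n, ‖a‖ * ‖b‖ := by
        refine Finset.sum_le_sum fun i _ => ?_
        rw [abs_mul]
        exact mul_le_mul (norm_le_pi_norm a i) (norm_le_pi_norm b i) (abs_nonneg _) (norm_nonneg _)
    _ = n * ‖a‖ * ‖b‖ := by simp [mul_assoc]

lemma dotP_left_injective {n : ℕ} {a b : E n} (h : ∀ v, dotP n a v = dotP n b v) : a = b := by
  funext i
  simpa [dotP_single] using h (Pi.single i 1)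

/-- Some signed basis vector detects the sup norm of `a`. -/
lemma exists_norm_eq_dotP {n : ℕ} (hn : 1 ≤ n) (a : E n) :
    ∃ e : E n, ‖e‖ = 1 ∧ dotP n a e = ‖a‖ := by
  have : Nonempty (Fin n) := ⟨⟨0, hn⟩⟩
  obtain ⟨i, hi⟩ := Finite.exists_max (fun i => ‖a i‖)
  have hnorm : ‖a‖ = ‖a i‖ :=
    le_antisymm ((pi_norm_le_iff_of_nonneg (norm_nonneg _)).2 hi) (norm_le_pi_norm a i)
  rcases le_total 0 (a i) with h | h
  · refine ⟨Pi.single i 1, by rw [Pi.norm_single, norm_one], ?_⟩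
    rw [dotP_single, hnorm, Real.norm_of_nonneg h, mul_one]
  · refine ⟨Pi.single i (-1), by rw [Pi.norm_single, norm_neg, norm_one], ?_⟩
    rw [dotP_single, hnorm, Real.norm_of_nonpos h]
    ring

lemma hasDerivAt_dotP {n : ℕ} {f g : ℝ → E n} {f' g' : E n} {t : ℝ}
    (hf : HasDerivAt f f' t) (hg : HasDerivAt g g' t) :
    HasDerivAt (fun s => dotP n (f s) (g s)) (dotP n (f t) g' + dotP n f' (g t)) t := by
  have h := ((dotB n).hasFDerivAt.comp_hasDerivAt t hf).clm_apply hg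
  rw [add_comm]
  exact h

lemma continuous_dotP {n : ℕ} {α : Type*} [TopologicalSpace α] {f g : α → E n}
    (hf : Continuous f) (hg : Continuous g) : Continuous fun s => dotP n (f s) (g s) := by
  unfold dotP
  fun_prop

lemma clm_eq_dotP {n : ℕ} (L : E n →L[ℝ] ℝ) (v : E n) :
    L v = dotP n (fun i => L (Pi.single i 1)) v := by
  conv_lhs => rw [← Finset.univ_sum_single v]
  rw [map_sum]
  refine Finset.sum_congr rfl fun i _ => ?_
  have : (Pi.single i (v i) : E n) = v i • Pi.single i 1 := by
    rw [← Pi.single_smul]; simp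
  rw [this, map_smul, smul_eq_mul, mul_comm]

lemma fderiv_eq_dotP_gradF {n : ℕ} (u : E n → ℝ) (x v : E n) :
    fderiv ℝ u x v = dotP n (gradF n u x) v :=
  clm_eq_dotP _ _

/-! ### Tonelli Hamiltonians with their flow -/

/-- A `C²` Tonelli Hamiltonian together with its complete flow. -/
structure TonelliFlow (n : ℕ) (H : E n × E n → ℝ) (φ : ℝ → E n × E n → E n × E n) : Prop where
  smooth : ContDiff ℝ 2 H
  periodic : ∀ (x p : E n) (m : Fin n → ℤ), H (x + intVec m, p) = H (x, p)
  superlinear : ∀ C : ℝ, ∃ R : ℝ, ∀ (x p : E n), R ≤ ‖p‖ → C * ‖p‖ ≤ H (x, p)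
  posdef : ∀ (x p w : E n), w ≠ 0 →
    0 < fderiv ℝ (fun p' => fderiv ℝ (fun p'' => H (x, p'')) p' w) p w
  flow : IsHamFlow n H φ
  flow_smooth : ∀ t : ℝ, ContDiff ℝ 1 (φ t)

/-- The Lagrangian `⟨p, ∂H/∂p⟩ - H` in Hamiltonian coordinates. -/
def lagr (n : ℕ) (H : E n × E n → ℝ) (z : E n × E n) : ℝ :=
  dotP n z.2 (gradP n H z.1 z.2) - H z

namespace TonelliFlow

variable {n : ℕ} {H : E n × E n → ℝ} {φ : ℝ → E n × E n → E n × E n}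

lemma fderiv_p (h : TonelliFlow n H φ) (x p w : E n) :
    fderiv ℝ (fun p' => H (x, p')) p w = fderiv ℝ H (x, p) (0, w) := by
  have h1 : HasFDerivAt H (fderiv ℝ H (x, p)) (x, p) :=
    (h.smooth.differentiable (by norm_num) _).hasFDerivAt
  have h2 : HasFDerivAt (fun p' => H (x, p')) _ p := h1.comp p (hasFDerivAt_prodMk_right x p)
  rw [h2.fderiv]
  simp

lemma fderiv_x (h : TonelliFlow n H φ) (x p w : E n) :
    fderiv ℝ (fun x' => H (x', p)) x w = fderiv ℝ H (x, p) (w, 0) := by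
  have h1 : HasFDerivAt H (fderiv ℝ H (x, p)) (x, p) :=
    (h.smooth.differentiable (by norm_num) _).hasFDerivAt
  have h2 : HasFDerivAt (fun x' => H (x', p)) _ x := h1.comp x (hasFDerivAt_prodMk_left x p)
  rw [h2.fderiv]
  simp

lemma fderiv_apply (h : TonelliFlow n H φ) (z ζ : E n × E n) :
    fderiv ℝ H z ζ = dotP n (gradX n H z.1 z.2) ζ.1 + dotP n (gradP n H z.1 z.2) ζ.2 := by
  obtain ⟨x, p⟩ := z
  have : ζ = (ζ.1, 0) + (0, ζ.2) := by simp
  conv_lhs => rw [this]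
  rw [map_add, ← h.fderiv_p, ← h.fderiv_x]
  exact congrArg₂ _ (clm_eq_dotP _ _) (clm_eq_dotP _ _)

lemma contDiff_gradP (h : TonelliFlow n H φ) :
    ContDiff ℝ 1 fun z : E n × E n => gradP n H z.1 z.2 := by
  rw [contDiff_pi]
  intro i
  simp only [gradP, h.fderiv_p]
  have : ContDiff ℝ 1 (fderiv ℝ H) := h.smooth.fderiv_right (by norm_num)
  exact this.clm_apply contDiff_const

lemma contDiff_gradX (h : TonelliFlow n H φ) :
    ContDiff ℝ 1 fun z : E n × E n => gradX n H z.1 z.2 := by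
  rw [contDiff_pi]
  intro i
  simp only [gradX, h.fderiv_x]
  have : ContDiff ℝ 1 (fderiv ℝ H) := h.smooth.fderiv_right (by norm_num)
  exact this.clm_apply contDiff_const

lemma contDiff_hamVF (h : TonelliFlow n H φ) : ContDiff ℝ 1 (hamVF n H) :=
  h.contDiff_gradP.prodMk h.contDiff_gradX.neg

lemma contDiff_lagr (h : TonelliFlow n H φ) : ContDiff ℝ 1 (lagr n H) := by
  refine ContDiff.sub ?_ (h.smooth.of_le (by norm_num))
  exact (dotB n).isBoundedBilinearMap.contDiff.comp (contDiff_snd.prodMk h.contDiff_gradP)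

lemma omega0_hamVF (h : TonelliFlow n H φ) (z ζ : E n × E n) :
    omega0 n (hamVF n H z) ζ = -fderiv ℝ H z ζ := by
  rw [h.fderiv_apply]
  simp only [omega0, hamVF, dotP_neg_left]
  ring

lemma omega0_fderiv_hamVF (h : TonelliFlow n H φ) (z ζ ζ' : E n × E n) :
    omega0 n (fderiv ℝ (hamVF n H) z ζ) ζ' = -fderiv ℝ (fderiv ℝ H) z ζ ζ' := by
  have hX : HasFDerivAt (hamVF n H) (fderiv ℝ (hamVF n H) z) z :=
    (h.contDiff_hamVF.differentiable (by norm_num) _).hasFDerivAt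
  have hH : ContDiff ℝ 1 (fderiv ℝ H) := h.smooth.fderiv_right (by norm_num)
  have h2 := (hH.differentiable (by norm_num) z).hasFDerivAt
  -- differentiate the identity `ω(X, ζ') = -dH ζ'` in the direction `ζ`
  let c : ℝ → E n × E n := fun s => z + s • ζ
  have hc : HasDerivAt c ζ 0 := by
    simpa [c] using! ((hasDerivAt_id (0 : ℝ)).smul_const ζ).const_add z
  have hc0 : c 0 = z := by simp [c]
  have hXc : HasDerivAt (fun s => hamVF n H (c s)) (fderiv ℝ (hamVF n H) z ζ) 0 := by
    rw [← hc0] at hX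
    have := hX.comp_hasDerivAt 0 hc
    rw [hc0] at this
    exact this
  have hDc : HasDerivAt (fun s => fderiv ℝ H (c s)) (fderiv ℝ (fderiv ℝ H) z ζ) 0 := by
    rw [← hc0] at h2
    have := h2.comp_hasDerivAt 0 hc
    rw [hc0] at this
    exact this
  have e1 : HasDerivAt (fun s => omega0 n (hamVF n H (c s)) ζ')
      (omega0 n (fderiv ℝ (hamVF n H) z ζ) ζ') 0 := by
    have a1 := hasDerivAt_dotP hXc.snd (hasDerivAt_const (0 : ℝ) ζ'.1)
    have a2 := hasDerivAt_dotP hXc.fst (hasDerivAt_const (0 : ℝ) ζ'.2)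
    have := a1.sub a2
    simp only [dotP_zero_right, zero_add] at this
    exact this
  have e2 : HasDerivAt (fun s => -fderiv ℝ H (c s) ζ') (-fderiv ℝ (fderiv ℝ H) z ζ ζ') 0 := by
    have := (hDc.clm_apply (hasDerivAt_const (0 : ℝ) ζ')).neg
    simp only [map_zero, add_zero] at this
    exact this
  simp only [h.omega0_hamVF] at e1
  exact e1.unique e2

lemma omega0_antisymm (n : ℕ) (w w' : E n × E n) : omega0 n w w' = -omega0 n w' w := by
  simp only [omega0]
  rw [dotP_comm n w.2, dotP_comm n w.1]
  ring

lemma omega0_fderiv_hamVF_add (h : TonelliFlow n H φ) (z ζ ζ' : E n × E n) :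
    omega0 n (fderiv ℝ (hamVF n H) z ζ) ζ' + omega0 n ζ (fderiv ℝ (hamVF n H) z ζ') = 0 := by
  rw [omega0_antisymm n ζ, h.omega0_fderiv_hamVF, h.omega0_fderiv_hamVF]
  have hs : IsSymmSndFDerivAt ℝ H z :=
    (h.smooth.contDiffAt).isSymmSndFDerivAt (by simp)
  rw [hs.eq ζ ζ']
  ring

/-! ### Energy conservation and compactness -/

lemma energy (h : TonelliFlow n H φ) (t : ℝ) (z : E n × E n) : H (φ t z) = H z := by
  have hd : ∀ s, HasDerivAt (fun s => H (φ s z)) 0 s := by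
    intro s
    have h1 : HasFDerivAt H (fderiv ℝ H (φ s z)) (φ s z) :=
      (h.smooth.differentiable (by norm_num) _).hasFDerivAt
    have h2 := h1.comp_hasDerivAt s (h.flow.2 z s)
    rw [h.fderiv_apply] at h2
    simp only [hamVF, dotP_neg_right] at h2
    rw [dotP_comm n (gradX n H _ _), add_neg_cancel] at h2
    exact h2
  have := is_const_of_deriv_eq_zero (fun s => (hd s).differentiableAt) (fun s => (hd s).deriv) t 0
  simpa [h.flow.1 z] using this

lemma norm_snd_le (h : TonelliFlow n H φ) (E₀ : ℝ) :
    ∃ R : ℝ, 0 < R ∧ ∀ z : E n × E n, H z ≤ E₀ → ‖z.2‖ ≤ R := by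
  obtain ⟨R, hR⟩ := h.superlinear 1
  refine ⟨max (max R E₀) 1, by positivity, fun z hz => ?_⟩
  by_contra! hlt
  have h1 := hR z.1 z.2 ((le_max_left _ _).trans ((le_max_left _ _).trans hlt.le))
  have h2 : E₀ < ‖z.2‖ := lt_of_le_of_lt ((le_max_right _ _).trans (le_max_left _ _)) hlt
  rw [one_mul] at h1
  exact absurd hz (not_le.2 (h2.trans_le h1))

end TonelliFlow

/-- A continuous function, periodic in its first variable, is bounded over compact sets of the
second one. -/
lemma exists_bound_of_periodic {n : ℕ} {Y F : Type*} [TopologicalSpace Y]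
    [SeminormedAddCommGroup F] {g : E n → Y → F} {K : Set Y} (hK : IsCompact K)
    (hg : ContinuousOn (Function.uncurry g) (Set.univ ×ˢ K))
    (hper : ∀ x (m : Fin n → ℤ), ∀ y ∈ K, g (x + intVec m) y = g x y) :
    ∃ C : ℝ, 0 < C ∧ ∀ x, ∀ y ∈ K, ‖g x y‖ ≤ C := by
  have hQ : IsCompact ((Set.Icc (0 : E n) 1) ×ˢ K) := isCompact_Icc.prod hK
  obtain ⟨C, hC⟩ := hQ.exists_bound_of_continuousOn
    (hg.mono (Set.prod_mono (Set.subset_univ _) le_rfl))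
  refine ⟨max C 1, by positivity, fun x y hy => ?_⟩
  have hx : x = (fun i => Int.fract (x i)) + intVec fun i => ⌊x i⌋ := by
    funext i
    simp [intVec, Int.fract_add_floor]
  rw [hx, hper _ _ y hy]
  refine (hC ((fun i => Int.fract (x i)), y) ⟨⟨fun i => ?_, fun i => ?_⟩, hy⟩).trans
    (le_max_left _ _)
  · exact Int.fract_nonneg _
  · exact (Int.fract_lt_one _).le

lemma intVec_add {n : ℕ} (m m' : Fin n → ℤ) : intVec (m + m') = intVec m + intVec m' := by
  funext i; simp [intVec]

@[simp] lemma intVec_zero {n : ℕ} : intVec (0 : Fin n → ℤ) = 0 := by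
  funext i; simp [intVec]

lemma intVec_smul {n : ℕ} (N : ℕ) (m : Fin n → ℤ) : intVec (N • m) = N • intVec m := by
  funext i; simp [intVec]

namespace TonelliFlow

variable {n : ℕ} {H : E n × E n → ℝ} {φ : ℝ → E n × E n → E n × E n}

lemma gradP_add_intVec (h : TonelliFlow n H φ) (x p : E n) (m : Fin n → ℤ) :
    gradP n H (x + intVec m) p = gradP n H x p := by
  funext i
  simp only [gradP, h.periodic]

lemma gradX_add_intVec (h : TonelliFlow n H φ) (x p : E n) (m : Fin n → ℤ) :
    gradX n H (x + intVec m) p = gradX n H x p := by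
  funext i
  simp only [gradX]
  have : (fun x' => H (x', p)) = fun x' => (fun y => H (y, p)) (x' + intVec m) := by
    funext x'; simp [h.periodic]
  conv_rhs => rw [this]
  rw [fderiv_comp_add_right (f := fun y => H (y, p))]

lemma hamVF_add_intVec (h : TonelliFlow n H φ) (x p : E n) (m : Fin n → ℤ) :
    hamVF n H (x + intVec m, p) = hamVF n H (x, p) := by
  simp only [hamVF, h.gradP_add_intVec, h.gradX_add_intVec]

lemma lagr_add_intVec (h : TonelliFlow n H φ) (x p : E n) (m : Fin n → ℤ) :
    lagr n H (x + intVec m, p) = lagr n H (x, p) := by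
  simp only [lagr, h.gradP_add_intVec, h.periodic]

/-- Periodic continuous functions on phase space are bounded on strips `‖p‖ ≤ R`. -/
lemma exists_bound_strip {F : Type*} [SeminormedAddCommGroup F] {g : E n × E n → F}
    (hg : Continuous g) (hper : ∀ x p (m : Fin n → ℤ), g (x + intVec m, p) = g (x, p)) (R : ℝ) :
    ∃ C : ℝ, 0 < C ∧ ∀ z : E n × E n, ‖z.2‖ ≤ R → ‖g z‖ ≤ C := by
  obtain ⟨C, hC0, hC⟩ := exists_bound_of_periodic (g := fun x p => g (x, p))
    (isCompact_closedBall (0 : E n) R) (by exact hg.continuousOn) (fun x m y _ => hper x y m)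
  exact ⟨C, hC0, fun z hz => hC z.1 z.2 (by simpa using hz)⟩

lemma convex_strip (R : ℝ) : Convex ℝ {z : E n × E n | ‖z.2‖ ≤ R} := by
  have : {z : E n × E n | ‖z.2‖ ≤ R} =
      (LinearMap.snd ℝ (E n) (E n)) ⁻¹' (Metric.closedBall 0 R) := by
    ext z; simp
  rw [this]
  exact (convex_closedBall _ _).linear_preimage _

/-- `C¹` periodic functions on phase space are Lipschitz on strips `‖p‖ ≤ R`. -/
lemma exists_lipschitz_strip {F : Type*} [NormedAddCommGroup F] [NormedSpace ℝ F]
    {g : E n × E n → F} (hg : ContDiff ℝ 1 g)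
    (hper : ∀ x p (m : Fin n → ℤ), g (x + intVec m, p) = g (x, p)) (R : ℝ) :
    ∃ K : ℝ≥0, LipschitzOnWith K g {z | ‖z.2‖ ≤ R} ∧
      ∀ z : E n × E n, ‖z.2‖ ≤ R → ‖fderiv ℝ g z‖ ≤ K := by
  obtain ⟨C, hC0, hC⟩ := exists_bound_strip (hg.continuous_fderiv (by norm_num)) (fun x p m => by
    have : g = fun z => g (z + (intVec m, 0)) := by
      funext z
      have e : z + (intVec m, 0) = (z.1 + intVec m, z.2) := by ext1 <;> simp
      rw [e, hper z.1 z.2 m]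
    conv_rhs => rw [this]
    rw [fderiv_comp_add_right]; simp) R
  lift C to ℝ≥0 using hC0.le
  refine ⟨C, ?_, hC⟩
  refine (convex_strip R).lipschitzOnWith_of_nnnorm_fderiv_le
    (fun z _ => hg.differentiable (by norm_num) z) fun z hz => ?_
  exact hC z hz

/-- Integral curves of the Hamiltonian vector field. -/
def IsSol (n : ℕ) (H : E n × E n → ℝ) (γ : ℝ → E n × E n) : Prop :=
  ∀ s, HasDerivAt γ (hamVF n H (γ s)) s

lemma isSol_flow (h : TonelliFlow n H φ) (z : E n × E n) : IsSol n H fun s => φ s z :=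
  h.flow.2 z

lemma IsSol.comp_add {γ : ℝ → E n × E n} (hγ : IsSol n H γ) (t : ℝ) :
    IsSol n H fun s => γ (s + t) :=
  fun s => (hγ (s + t)).comp_add_const s t

lemma dist_sol_le {K : ℝ≥0} {S : Set (E n × E n)} (hK : LipschitzOnWith K (hamVF n H) S)
    {γ γ' : ℝ → E n × E n} (hγ : IsSol n H γ) (hγ' : IsSol n H γ')
    (hS : ∀ t, γ t ∈ S) (hS' : ∀ t, γ' t ∈ S) (t : ℝ) :
    dist (γ t) (γ' t) ≤ Real.exp (K * |t|) * dist (γ 0) (γ' 0) := by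
  rcases le_total 0 t with ht | ht
  · have := dist_le_of_trajectories_ODE_of_mem (v := fun _ => hamVF n H) (s := fun _ => S)
      (a := 0) (b := t) (δ := dist (γ 0) (γ' 0)) (f := γ) (g := γ') (fun _ _ => hK)
      (fun s _ => (hγ s).continuousAt.continuousWithinAt) (fun s _ => (hγ s).hasDerivWithinAt)
      (fun s _ => hS s) (fun s _ => (hγ' s).continuousAt.continuousWithinAt)
      (fun s _ => (hγ' s).hasDerivWithinAt) (fun s _ => hS' s) le_rfl t ⟨ht, le_rfl⟩
    rw [sub_zero, mul_comm] at this
    rwa [abs_of_nonneg ht]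
  · have hneg : ∀ {γ : ℝ → E n × E n}, IsSol n H γ → ∀ s,
        HasDerivAt (fun s => γ (-s)) (-hamVF n H (γ (-s))) s := by
      intro γ hγ s
      simpa using! (hγ (-s)).scomp s (hasDerivAt_neg s)
    have := dist_le_of_trajectories_ODE_of_mem (v := fun _ z => -hamVF n H z) (s := fun _ => S)
      (a := 0) (b := -t) (δ := dist (γ 0) (γ' 0)) (f := fun s => γ (-s)) (g := fun s => γ' (-s))
      (fun _ _ => hK.neg)
      (fun s _ => (hneg hγ s).continuousAt.continuousWithinAt)
      (fun s _ => (hneg hγ s).hasDerivWithinAt)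
      (fun s _ => hS _) (fun s _ => (hneg hγ' s).continuousAt.continuousWithinAt)
      (fun s _ => (hneg hγ' s).hasDerivWithinAt) (fun s _ => hS' _) (by simp) (-t)
      ⟨by linarith, le_rfl⟩
    rw [sub_zero, mul_comm, neg_neg] at this
    rwa [abs_of_nonpos ht]

/-- On energy sublevels the flow expands distances at a bounded exponential rate, and moves
points with bounded speed. -/
lemma exists_flow_bounds (h : TonelliFlow n H φ) (E₀ : ℝ) :
    ∃ (R : ℝ) (K : ℝ≥0) , 0 < R ∧ (∀ z : E n × E n, H z ≤ E₀ → ‖z.2‖ ≤ R) ∧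
      LipschitzOnWith K (hamVF n H) {z | ‖z.2‖ ≤ R} ∧
      (∀ z, ‖z.2‖ ≤ R → ‖fderiv ℝ (hamVF n H) z‖ ≤ K) ∧
      (∀ z, ‖z.2‖ ≤ R → ‖hamVF n H z‖ ≤ K) ∧
      (∀ z z', H z ≤ E₀ → H z' ≤ E₀ → ∀ t,
        dist (φ t z) (φ t z') ≤ Real.exp (K * |t|) * dist z z') ∧
      (∀ z, H z ≤ E₀ → ∀ s t, dist (φ s z) (φ t z) ≤ K * |s - t|) := by
  obtain ⟨R, hR0, hR⟩ := h.norm_snd_le E₀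
  obtain ⟨K₁, hK₁, hK₁'⟩ := exists_lipschitz_strip h.contDiff_hamVF h.hamVF_add_intVec R
  obtain ⟨C, hC0, hC⟩ := exists_bound_strip h.contDiff_hamVF.continuous h.hamVF_add_intVec R
  lift C to ℝ≥0 using hC0.le
  have hle : K₁ ≤ K₁ + C := le_self_add
  have hCle : C ≤ K₁ + C := by simp
  have hmem : ∀ z, H z ≤ E₀ → ∀ t, ‖(φ t z).2‖ ≤ R := fun z hz t =>
    hR _ ((h.energy t z).trans_le hz)
  have hlip : LipschitzOnWith (K₁ + C) (hamVF n H) {z | ‖z.2‖ ≤ R} := hK₁.weaken hle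
  refine ⟨R, K₁ + C, hR0, hR, hlip, fun z hz => (hK₁' z hz).trans (NNReal.coe_le_coe.2 hle),
    fun z hz => (hC z hz).trans (NNReal.coe_le_coe.2 hCle),
    fun z z' hz hz' t => ?_, fun z hz s t => ?_⟩
  · have := dist_sol_le hlip (h.isSol_flow z) (h.isSol_flow z') (hmem z hz) (hmem z' hz') t
    simpa only [h.flow.1] using this
  · have := Convex.norm_image_sub_le_of_norm_hasDerivWithin_le (f := fun s => φ s z)
      (s := Set.univ) (x := t) (y := s)
      (fun s _ => (h.flow.2 z s).hasDerivWithinAt)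
      (fun s _ => (hC _ (hmem z hz s)).trans (NNReal.coe_le_coe.2 hCle))
      convex_univ trivial trivial
    rw [dist_eq_norm, ← Real.norm_eq_abs]
    exact this

lemma IsSol.energy (h : TonelliFlow n H φ) {γ : ℝ → E n × E n} (hγ : IsSol n H γ) (t : ℝ) :
    H (γ t) = H (γ 0) := by
  have hd : ∀ s, HasDerivAt (fun s => H (γ s)) 0 s := by
    intro s
    have h1 : HasFDerivAt H (fderiv ℝ H (γ s)) (γ s) :=
      (h.smooth.differentiable (by norm_num) _).hasFDerivAt
    have h2 := h1.comp_hasDerivAt s (hγ s)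
    rw [h.fderiv_apply] at h2
    simp only [hamVF, dotP_neg_right] at h2
    rw [dotP_comm n (gradX n H _ _), add_neg_cancel] at h2
    exact h2
  exact is_const_of_deriv_eq_zero (fun s => (hd s).differentiableAt) (fun s => (hd s).deriv) t 0

/-- Integral curves are orbits of the flow. -/
lemma IsSol.eq_flow (h : TonelliFlow n H φ) {γ : ℝ → E n × E n} (hγ : IsSol n H γ) (t : ℝ) :
    γ t = φ t (γ 0) := by
  obtain ⟨R, K, hR0, hR, hlip, -⟩ := h.exists_flow_bounds (H (γ 0))
  have := dist_sol_le hlip hγ (h.isSol_flow (γ 0)) (fun t => hR _ (hγ.energy h t).le)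
    (fun t => hR _ (h.energy t _).le) t
  simp only [h.flow.1, dist_self, mul_zero] at this
  exact dist_le_zero.1 this

lemma flow_zero (h : TonelliFlow n H φ) (z : E n × E n) : φ 0 z = z := h.flow.1 z

lemma flow_add (h : TonelliFlow n H φ) (s t : ℝ) (z : E n × E n) :
    φ (s + t) z = φ s (φ t z) := by
  have := ((h.isSol_flow z).comp_add t).eq_flow h s
  simpa using this

lemma flow_neg (h : TonelliFlow n H φ) (t : ℝ) (z : E n × E n) : φ (-t) (φ t z) = z := by
  rw [← h.flow_add, neg_add_cancel, h.flow_zero]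

lemma flow_neg' (h : TonelliFlow n H φ) (t : ℝ) (z : E n × E n) : φ t (φ (-t) z) = z := by
  rw [← h.flow_add, add_neg_cancel, h.flow_zero]

lemma flow_translate (h : TonelliFlow n H φ) (t : ℝ) (x p : E n) (m : Fin n → ℤ) :
    φ t (x + intVec m, p) = ((φ t (x, p)).1 + intVec m, (φ t (x, p)).2) := by
  have hs : IsSol n H fun s => φ s (x, p) + (intVec m, 0) := by
    intro s
    have := (h.flow.2 (x, p) s).add_const (intVec m, 0)
    have e : φ s (x, p) + (intVec m, 0) = ((φ s (x, p)).1 + intVec m, (φ s (x, p)).2) := by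
      ext1 <;> simp
    simp only [e] at this ⊢
    rw [h.hamVF_add_intVec]
    exact this
  have := hs.eq_flow h t
  simp only [h.flow_zero] at this
  have e2 : (x, p) + (intVec m, 0) = (x + intVec m, p) := by ext1 <;> simp
  rw [e2] at this
  rw [← this]
  ext1 <;> simp

lemma continuous_H (h : TonelliFlow n H φ) : Continuous H := h.smooth.continuous

lemma continuous_flow_left (h : TonelliFlow n H φ) (z : E n × E n) : Continuous fun s => φ s z :=
  continuous_iff_continuousAt.2 fun s => (h.flow.2 z s).continuousAt

lemma eventually_energy_le (h : TonelliFlow n H φ) (z : E n × E n) :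
    ∀ᶠ z' in 𝓝 z, H z' ≤ H z + 1 :=
  h.continuous_H.continuousAt.eventually_le_const (by linarith)

lemma hasFDerivAt_flow (h : TonelliFlow n H φ) (t : ℝ) (z : E n × E n) :
    HasFDerivAt (φ t) (fderiv ℝ (φ t) z) z :=
  ((h.flow_smooth t).differentiable (by norm_num) z).hasFDerivAt

lemma hasFDerivAt_hamVF (h : TonelliFlow n H φ) (z : E n × E n) :
    HasFDerivAt (hamVF n H) (fderiv ℝ (hamVF n H) z) z :=
  (h.contDiff_hamVF.differentiable (by norm_num) z).hasFDerivAt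

lemma fderiv_flow_zero (h : TonelliFlow n H φ) (z : E n × E n) :
    fderiv ℝ (φ 0) z = ContinuousLinearMap.id ℝ _ := by
  have : φ 0 = id := funext h.flow_zero
  rw [this, fderiv_id]

/-- Bound on the derivative of the flow on energy sublevels. -/
lemma norm_fderiv_flow_le {E₀ : ℝ} {K : ℝ≥0} (h : TonelliFlow n H φ)
    (hK : ∀ z z', H z ≤ E₀ → H z' ≤ E₀ → ∀ t,
      dist (φ t z) (φ t z') ≤ Real.exp (K * |t|) * dist z z') {z : E n × E n} (hz : H z < E₀)
    (t : ℝ) : ‖fderiv ℝ (φ t) z‖ ≤ Real.exp (K * |t|) := by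
  refine (h.hasFDerivAt_flow t z).le_of_lip' (Real.exp_pos _).le ?_
  filter_upwards [h.continuous_H.continuousAt.eventually_lt_const hz] with z' hz'
  simpa only [dist_eq_norm] using hK z' z hz'.le hz.le t

/-- Integral form of the variational equation. -/
lemma fderiv_flow_integral (h : TonelliFlow n H φ) (z ζ : E n × E n) :
    (∀ t, IntervalIntegrable
      (fun s => fderiv ℝ (hamVF n H) (φ s z) (fderiv ℝ (φ s) z ζ)) volume 0 t) ∧
    ∀ t, fderiv ℝ (φ t) z ζ
      = ζ + ∫ s in (0 : ℝ)..t, fderiv ℝ (hamVF n H) (φ s z) (fderiv ℝ (φ s) z ζ) := by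
  obtain ⟨R, K, hR0, hR, hlip, hDX, hX, hexp, -⟩ := h.exists_flow_bounds (H z + 1)
  set τ : ℕ → ℝ := fun k => 1 / ((k : ℝ) + 1) with hτ
  have hτ0 : Tendsto τ atTop (𝓝 0) := tendsto_one_div_add_atTop_nhds_zero_nat
  have hτpos : ∀ k, 0 < τ k := fun k => by simp only [hτ]; positivity
  have hline : Tendsto (fun k => z + τ k • ζ) atTop (𝓝 z) := by
    have := (hτ0.smul_const ζ).const_add z
    simpa using this
  -- replace the sequence by one whose points lie in the energy sublevel
  obtain ⟨N, hN⟩ := eventually_atTop.1 (hline.eventually (h.eventually_energy_le z))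
  have hshift : Tendsto (fun k : ℕ => k + N) atTop atTop := tendsto_add_atTop_nat N
  set σ : ℕ → ℝ := fun k => τ (k + N) with hσ
  have hσ0 : Tendsto σ atTop (𝓝[≠] 0) :=
    tendsto_nhdsWithin_iff.2 ⟨hτ0.comp hshift, Eventually.of_forall fun k => (hτpos _).ne'⟩
  have hσE : ∀ k, H (z + σ k • ζ) ≤ H z + 1 := fun k => hN (k + N) (Nat.le_add_left _ _)
  have hσpos : ∀ k, 0 < σ k := fun k => hτpos _
  have hdq : ∀ {f : E n × E n → E n × E n} {L : (E n × E n) →L[ℝ] (E n × E n)},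
      HasFDerivAt f L z →
      Tendsto (fun k => (σ k)⁻¹ • (f (z + σ k • ζ) - f z)) atTop (𝓝 (L ζ)) := by
    intro f L hf
    have hl := (hf.hasLineDerivAt ζ)
    unfold HasLineDerivAt at hl
    have := hl.tendsto_slope_zero.comp hσ0
    simpa [Function.comp_def] using this
  have hlim : ∀ s, Tendsto (fun k => (σ k)⁻¹ • (hamVF n H (φ s (z + σ k • ζ)) -
      hamVF n H (φ s z))) atTop (𝓝 (fderiv ℝ (hamVF n H) (φ s z) (fderiv ℝ (φ s) z ζ))) := by
    intro s
    exact hdq ((h.hasFDerivAt_hamVF _).comp z (h.hasFDerivAt_flow s z))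
  have hcont : ∀ k, Continuous fun s => (σ k)⁻¹ • (hamVF n H (φ s (z + σ k • ζ)) -
      hamVF n H (φ s z)) := by
    intro k
    have c1 : ∀ z, Continuous fun s => hamVF n H (φ s z) := fun z =>
      h.contDiff_hamVF.continuous.comp (h.continuous_flow_left z)
    have a := c1 (z + σ k • ζ)
    have b := c1 z
    fun_prop
  have hmem : ∀ z', H z' ≤ H z + 1 → ∀ s, ‖(φ s z').2‖ ≤ R := fun z' hz' s =>
    hR _ ((h.energy s z').trans_le hz')
  have hbd : ∀ k s, ‖(σ k)⁻¹ • (hamVF n H (φ s (z + σ k • ζ)) - hamVF n H (φ s z))‖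
      ≤ K * Real.exp (K * |s|) * ‖ζ‖ := by
    intro k s
    have h1 := hlip.dist_le_mul _ (hmem _ (hσE k) s) _ (hmem z (by linarith) s)
    have h2 := hexp _ z (hσE k) (by linarith) s
    rw [dist_eq_norm] at h1
    rw [dist_eq_norm (z + σ k • ζ), add_sub_cancel_left, norm_smul,
      Real.norm_of_nonneg (hσpos k).le] at h2
    rw [norm_smul, norm_inv, Real.norm_of_nonneg (hσpos k).le]
    rw [inv_mul_le_iff₀ (hσpos k)]
    calc _ ≤ _ := h1
      _ ≤ K * (Real.exp (K * |s|) * (σ k * ‖ζ‖)) := by gcongr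
      _ = _ := by ring
  have hbcont : Continuous fun s : ℝ => (K : ℝ) * Real.exp (K * |s|) * ‖ζ‖ := by fun_prop
  have hmeas : AEStronglyMeasurable
      (fun s => fderiv ℝ (hamVF n H) (φ s z) (fderiv ℝ (φ s) z ζ)) (volume : Measure ℝ) :=
    aestronglyMeasurable_of_tendsto_ae atTop (fun k => (hcont k).aestronglyMeasurable)
      (Eventually.of_forall hlim)
  have hle : ∀ s, ‖fderiv ℝ (hamVF n H) (φ s z) (fderiv ℝ (φ s) z ζ)‖
      ≤ K * Real.exp (K * |s|) * ‖ζ‖ := fun s =>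
    le_of_tendsto (hlim s).norm (Eventually.of_forall fun k => hbd k s)
  refine ⟨fun t => (hbcont.intervalIntegrable 0 t).mono_fun hmeas.restrict
    (Eventually.of_forall fun s => (hle s).trans (le_abs_self _)), fun t => ?_⟩
  have hI : Tendsto (fun k => ∫ s in (0 : ℝ)..t, (σ k)⁻¹ • (hamVF n H (φ s (z + σ k • ζ)) -
      hamVF n H (φ s z))) atTop
      (𝓝 (∫ s in (0 : ℝ)..t, fderiv ℝ (hamVF n H) (φ s z) (fderiv ℝ (φ s) z ζ))) :=
    intervalIntegral.tendsto_integral_filter_of_dominated_convergence _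
      (Eventually.of_forall fun k => (hcont k).aestronglyMeasurable.restrict)
      (Eventually.of_forall fun k => Eventually.of_forall fun s _ => hbd k s)
      (hbcont.intervalIntegrable 0 t) (Eventually.of_forall fun s _ => hlim s)
  have hval : ∀ k, ∫ s in (0 : ℝ)..t, (σ k)⁻¹ • (hamVF n H (φ s (z + σ k • ζ)) -
      hamVF n H (φ s z)) = (σ k)⁻¹ • (φ t (z + σ k • ζ) - φ t z) - ζ := by
    intro k
    rw [intervalIntegral.integral_eq_sub_of_hasDerivAt
      (f := fun s => (σ k)⁻¹ • (φ s (z + σ k • ζ) - φ s z))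
      (fun s _ => ((h.flow.2 _ s).fun_sub (h.flow.2 _ s)).fun_const_smul _)
      ((hcont k).intervalIntegrable 0 t)]
    simp only [h.flow_zero, add_sub_cancel_left, inv_smul_smul₀ (hσpos k).ne']
  simp only [hval] at hI
  have h2 := (hdq (h.hasFDerivAt_flow t z)).sub_const ζ
  have := tendsto_nhds_unique hI h2
  rw [this]
  abel

/-- The variational equation. -/
lemma hasDerivAt_fderiv_flow (h : TonelliFlow n H φ) (z ζ : E n × E n) (t : ℝ) :
    HasDerivAt (fun s => fderiv ℝ (φ s) z ζ)
      (fderiv ℝ (hamVF n H) (φ t z) (fderiv ℝ (φ t) z ζ)) t := by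
  obtain ⟨hII, heq⟩ := h.fderiv_flow_integral z ζ
  have hII' : ∀ a b, IntervalIntegrable
      (fun s => fderiv ℝ (hamVF n H) (φ s z) (fderiv ℝ (φ s) z ζ)) volume a b :=
    fun a b => (hII a).symm.trans (hII b)
  have hc : Continuous fun s => fderiv ℝ (φ s) z ζ := by
    rw [show (fun s => fderiv ℝ (φ s) z ζ) = _ from funext heq]
    exact continuous_const.add (intervalIntegral.continuous_primitive hII' 0)
  have hc2 : Continuous fun s => fderiv ℝ (hamVF n H) (φ s z) (fderiv ℝ (φ s) z ζ) :=
    ((h.contDiff_hamVF.continuous_fderiv (by norm_num)).comp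
      (h.continuous_flow_left z)).clm_apply hc
  have := (intervalIntegral.integral_hasDerivAt_right (hII t)
    hc2.aestronglyMeasurable.stronglyMeasurableAtFilter hc2.continuousAt).const_add ζ
  rw [show (fun s => fderiv ℝ (φ s) z ζ) = _ from funext heq]
  exact this

/-- The derivative of the flow in phase space is jointly continuous. -/
lemma continuous_fderiv_flow (h : TonelliFlow n H φ) :
    Continuous fun q : ℝ × (E n × E n) => fderiv ℝ (φ q.1) q.2 := by
  refine continuous_iff_continuousAt.2 fun ⟨t₀, z₀⟩ => ?_
  obtain ⟨R, K, hR0, hR, hlip, hDX, hX, hexp, -⟩ := h.exists_flow_bounds (H z₀ + 1)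
  set C : ℝ := K * Real.exp (K * (|t₀| + 1)) with hC
  have hbd : ∀ z, H z < H z₀ + 1 → ∀ t, |t - t₀| ≤ 1 →
      ‖fderiv ℝ (φ t) z - fderiv ℝ (φ t₀) z‖ ≤ C * |t - t₀| := by
    intro z hz t ht
    refine ContinuousLinearMap.opNorm_le_bound _ (by positivity) fun ζ => ?_
    have := Convex.norm_image_sub_le_of_norm_hasDerivWithin_le
      (f := fun s => fderiv ℝ (φ s) z ζ) (s := Metric.closedBall t₀ 1) (x := t₀) (y := t)
      (C := C * ‖ζ‖)
      (fun s _ => (h.hasDerivAt_fderiv_flow z ζ s).hasDerivWithinAt) (fun s hs => ?_)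
      (convex_closedBall _ _) (Metric.mem_closedBall_self zero_le_one)
      (by simpa [Real.dist_eq] using ht)
    · rw [sub_apply]
      refine this.trans (le_of_eq ?_)
      rw [Real.norm_eq_abs]
      ring
    · have hs' : |s| ≤ |t₀| + 1 := by
        have h1 : |s - t₀| ≤ 1 := by simpa [Real.dist_eq] using hs
        have h2 := abs_add_le (s - t₀) t₀
        rw [sub_add_cancel] at h2
        linarith
      calc _ ≤ ‖fderiv ℝ (hamVF n H) (φ s z)‖ * (‖fderiv ℝ (φ s) z‖ * ‖ζ‖) :=
            (ContinuousLinearMap.le_opNorm _ _).trans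
              (by gcongr; exact ContinuousLinearMap.le_opNorm _ _)
        _ ≤ K * (Real.exp (K * |s|) * ‖ζ‖) := by
            gcongr
            · exact hDX _ (hR _ ((h.energy s z).trans_le hz.le))
            · exact h.norm_fderiv_flow_le hexp hz s
        _ ≤ K * (Real.exp (K * (|t₀| + 1)) * ‖ζ‖) := by gcongr
        _ = _ := by rw [hC]; ring
  rw [ContinuousAt, tendsto_iff_norm_sub_tendsto_zero]
  have hlim : Tendsto (fun q : ℝ × (E n × E n) =>
      C * |q.1 - t₀| + ‖fderiv ℝ (φ t₀) q.2 - fderiv ℝ (φ t₀) z₀‖) (𝓝 (t₀, z₀)) (𝓝 0) := by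
    have hc : Continuous fun q : ℝ × (E n × E n) =>
        C * |q.1 - t₀| + ‖fderiv ℝ (φ t₀) q.2 - fderiv ℝ (φ t₀) z₀‖ := by
      have := (h.flow_smooth t₀).continuous_fderiv (by norm_num)
      fun_prop
    have := hc.tendsto (t₀, z₀)
    simpa using this
  refine squeeze_zero' (Eventually.of_forall fun _ => norm_nonneg _) ?_ hlim
  have e1 : ∀ᶠ q : ℝ × (E n × E n) in 𝓝 (t₀, z₀), H q.2 < H z₀ + 1 :=
    (h.continuous_H.comp continuous_snd).continuousAt.eventually_lt_const (by simp)
  have e2 : ∀ᶠ q : ℝ × (E n × E n) in 𝓝 (t₀, z₀), |q.1 - t₀| < 1 := by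
    have hc : Continuous fun q : ℝ × (E n × E n) => |q.1 - t₀| := by fun_prop
    exact hc.continuousAt.eventually_lt_const (by simp)
  filter_upwards [e1, e2] with q h1 h2
  calc _ = ‖(fderiv ℝ (φ q.1) q.2 - fderiv ℝ (φ t₀) q.2)
        + (fderiv ℝ (φ t₀) q.2 - fderiv ℝ (φ t₀) z₀)‖ := by congr 1; abel
    _ ≤ _ := (norm_add_le _ _).trans (by gcongr; exact hbd q.2 h1 q.1 h2.le)

lemma continuous_flow (h : TonelliFlow n H φ) :
    Continuous fun q : ℝ × (E n × E n) => φ q.1 q.2 := by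
  refine continuous_iff_continuousAt.2 fun ⟨t₀, z₀⟩ => ?_
  obtain ⟨R, K, hR0, hR, hlip, hDX, hX, hexp, hmove⟩ := h.exists_flow_bounds (H z₀ + 1)
  rw [ContinuousAt, tendsto_iff_dist_tendsto_zero]
  have hlim : Tendsto (fun q : ℝ × (E n × E n) =>
      K * |q.1 - t₀| + dist (φ t₀ q.2) (φ t₀ z₀)) (𝓝 (t₀, z₀)) (𝓝 0) := by
    have hc : Continuous fun q : ℝ × (E n × E n) =>
        K * |q.1 - t₀| + dist (φ t₀ q.2) (φ t₀ z₀) := by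
      have := (h.flow_smooth t₀).continuous
      fun_prop
    have := hc.tendsto (t₀, z₀)
    simpa using this
  refine squeeze_zero' (Eventually.of_forall fun _ => dist_nonneg) ?_ hlim
  have e1 : ∀ᶠ q : ℝ × (E n × E n) in 𝓝 (t₀, z₀), H q.2 < H z₀ + 1 :=
    (h.continuous_H.comp continuous_snd).continuousAt.eventually_lt_const (by simp)
  filter_upwards [e1] with q h1
  exact (dist_triangle _ (φ t₀ q.2) _).trans (by gcongr; exact hmove _ h1.le _ _)

lemma hasStrictFDerivAt_flow (h : TonelliFlow n H φ) (q : ℝ × (E n × E n)) :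
    HasStrictFDerivAt (fun q : ℝ × (E n × E n) => φ q.1 q.2)
      ((ContinuousLinearMap.toSpanSingleton ℝ (hamVF n H (φ q.1 q.2))).coprod
        (fderiv ℝ (φ q.1) q.2)) q := by
  have hc : Continuous fun q : ℝ × (E n × E n) =>
      ContinuousLinearMap.toSpanSingleton ℝ (hamVF n H (φ q.1 q.2)) :=
    (ContinuousLinearMap.toSpanSingletonLIE ℝ (E n × E n)).continuous.comp
      (h.contDiff_hamVF.continuous.comp h.continuous_flow)
  exact hasStrictFDerivAt_uncurry_coprod (f := φ) (u := q)
    (f₁ := fun t z => ContinuousLinearMap.toSpanSingleton ℝ (hamVF n H (φ t z)))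
    (f₂ := fun t z => fderiv ℝ (φ t) z)
    (Eventually.of_forall fun v => (h.flow.2 v.2 v.1).hasFDerivAt)
    (Eventually.of_forall fun v => h.hasFDerivAt_flow v.1 v.2) hc.continuousAt
    h.continuous_fderiv_flow.continuousAt

/-- The flow is symplectic. -/
lemma omega0_fderiv_flow (h : TonelliFlow n H φ) (t : ℝ) (z ζ ζ' : E n × E n) :
    omega0 n (fderiv ℝ (φ t) z ζ) (fderiv ℝ (φ t) z ζ') = omega0 n ζ ζ' := by
  have hd : ∀ s, HasDerivAt (fun s => omega0 n (fderiv ℝ (φ s) z ζ) (fderiv ℝ (φ s) z ζ')) 0 s := by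
    intro s
    have h1 := h.hasDerivAt_fderiv_flow z ζ s
    have h2 := h.hasDerivAt_fderiv_flow z ζ' s
    have := (hasDerivAt_dotP h1.snd h2.fst).sub (hasDerivAt_dotP h1.fst h2.snd)
    convert! this using 1
    have := h.omega0_fderiv_hamVF_add (φ s z) (fderiv ℝ (φ s) z ζ) (fderiv ℝ (φ s) z ζ')
    simp only [omega0] at this
    linarith
  have := is_const_of_deriv_eq_zero (fun s => (hd s).differentiableAt) (fun s => (hd s).deriv) t 0
  simpa only [h.fderiv_flow_zero, ContinuousLinearMap.id_apply] using this

end TonelliFlow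

/-- The action of the orbit of `z` over the time interval `[0, t]`. -/
def act (n : ℕ) (H : E n × E n → ℝ) (φ : ℝ → E n × E n → E n × E n) (t : ℝ) (z : E n × E n) : ℝ :=
  ∫ s in (0 : ℝ)..t, lagr n H (φ s z)

/-- The derivative of the action with respect to the initial condition. -/
def actD (n : ℕ) (φ : ℝ → E n × E n → E n × E n) (t : ℝ) (z : E n × E n) :
    (E n × E n) →L[ℝ] ℝ :=
  (dotB n (φ t z).2).comp ((ContinuousLinearMap.fst ℝ (E n) (E n)).comp (fderiv ℝ (φ t) z)) -
    (dotB n z.2).comp (ContinuousLinearMap.fst ℝ (E n) (E n))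

lemma actD_apply (n : ℕ) (φ : ℝ → E n × E n → E n × E n) (t : ℝ) (z ζ : E n × E n) :
    actD n φ t z ζ = dotP n (φ t z).2 (fderiv ℝ (φ t) z ζ).1 - dotP n z.2 ζ.1 := rfl

namespace TonelliFlow

variable {n : ℕ} {H : E n × E n → ℝ} {φ : ℝ → E n × E n → E n × E n}

lemma hasFDerivAt_lagr (h : TonelliFlow n H φ) (z : E n × E n) :
    HasFDerivAt (lagr n H) (fderiv ℝ (lagr n H) z) z :=
  (h.contDiff_lagr.differentiable (by norm_num) z).hasFDerivAt

lemma fderiv_lagr (h : TonelliFlow n H φ) (z ζ : E n × E n) :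
    fderiv ℝ (lagr n H) z ζ =
      dotP n z.2 (fderiv ℝ (hamVF n H) z ζ).1 - dotP n (gradX n H z.1 z.2) ζ.1 := by
  have h1 : HasFDerivAt H (fderiv ℝ H z) z :=
    (h.smooth.differentiable (by norm_num) _).hasFDerivAt
  have h2 : HasFDerivAt (fun z : E n × E n => dotB n z.2) _ z :=
    (dotB n).hasFDerivAt.comp z hasFDerivAt_snd
  have h3 := (h2.clm_apply (h.hasFDerivAt_hamVF z).fst).sub h1
  have h4 := (h.hasFDerivAt_lagr z).unique h3
  rw [h4]
  simp only [sub_apply, add_apply, ContinuousLinearMap.comp_apply,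
    ContinuousLinearMap.flip_apply, h.fderiv_apply, dotB_apply, ContinuousLinearMap.coe_fst',
    ContinuousLinearMap.coe_snd', hamVF]
  rw [dotP_comm n ζ.2]
  ring

lemma continuous_lagr_flow (h : TonelliFlow n H φ) (z : E n × E n) :
    Continuous fun s => lagr n H (φ s z) :=
  h.contDiff_lagr.continuous.comp (h.continuous_flow_left z)

lemma hasDerivAt_act (h : TonelliFlow n H φ) (z : E n × E n) (t : ℝ) :
    HasDerivAt (fun t => act n H φ t z) (lagr n H (φ t z)) t :=
  intervalIntegral.integral_hasDerivAt_right ((h.continuous_lagr_flow z).intervalIntegrable _ _)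
    (h.continuous_lagr_flow z).aestronglyMeasurable.stronglyMeasurableAtFilter
    (h.continuous_lagr_flow z).continuousAt

@[simp] lemma act_zero (z : E n × E n) : act n H φ 0 z = 0 := by simp [act]

lemma act_add (h : TonelliFlow n H φ) (s t : ℝ) (z : E n × E n) :
    act n H φ (s + t) z = act n H φ t z + act n H φ s (φ t z) := by
  unfold act
  simp only [← h.flow_add]
  rw [intervalIntegral.integral_comp_add_right (fun r => lagr n H (φ r z)), zero_add,
    intervalIntegral.integral_add_adjacent_intervals
      ((h.continuous_lagr_flow z).intervalIntegrable _ _)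
      ((h.continuous_lagr_flow z).intervalIntegrable _ _)]

lemma act_translate (h : TonelliFlow n H φ) (t : ℝ) (x p : E n) (m : Fin n → ℤ) :
    act n H φ t (x + intVec m, p) = act n H φ t (x, p) := by
  unfold act
  simp only [h.flow_translate, h.lagr_add_intVec]

lemma hasDerivAt_actD (h : TonelliFlow n H φ) (z ζ : E n × E n) (t : ℝ) :
    HasDerivAt (fun t => actD n φ t z ζ)
      (fderiv ℝ (lagr n H) (φ t z) (fderiv ℝ (φ t) z ζ)) t := by
  have h1 := h.hasDerivAt_fderiv_flow z ζ t
  have := (hasDerivAt_dotP (h.flow.2 z t).snd h1.fst).sub_const (dotP n z.2 ζ.1)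
  convert! this using 1
  rw [h.fderiv_lagr]
  change _ = _ + dotP n (-gradX n H (φ t z).1 (φ t z).2) _
  rw [dotP_neg_left, ← sub_eq_add_neg]

lemma continuous_actD (h : TonelliFlow n H φ) :
    Continuous fun q : ℝ × (E n × E n) => actD n φ q.1 q.2 := by
  have h1 := h.continuous_flow
  have h2 := h.continuous_fderiv_flow
  have h3 : Continuous fun q : ℝ × (E n × E n) => dotB n (φ q.1 q.2).2 :=
    (dotB n).continuous.comp (continuous_snd.comp h1)
  have h4 : Continuous fun q : ℝ × (E n × E n) => dotB n q.2.2 :=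
    (dotB n).continuous.comp (continuous_snd.comp continuous_snd)
  unfold actD
  exact (h3.clm_comp (continuous_const.clm_comp h2)).sub (h4.clm_comp continuous_const)

lemma hasFDerivAt_act (h : TonelliFlow n H φ) (t : ℝ) (z : E n × E n) :
    HasFDerivAt (act n H φ t) (actD n φ t z) z := by
  set F' : E n × E n → ℝ → (E n × E n) →L[ℝ] ℝ :=
    fun z s => (fderiv ℝ (lagr n H) (φ s z)).comp (fderiv ℝ (φ s) z) with hF'
  have hc : Continuous fun q : ℝ × (E n × E n) => F' q.2 q.1 :=
    ((h.contDiff_lagr.continuous_fderiv (by norm_num)).comp h.continuous_flow).clm_comp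
      h.continuous_fderiv_flow
  have hcz : Continuous (F' z) := hc.comp (by fun_prop : Continuous fun s : ℝ => (s, z))
  have hK : IsCompact ((Set.uIcc 0 t) ×ˢ Metric.closedBall z 1) :=
    isCompact_uIcc.prod (isCompact_closedBall _ _)
  obtain ⟨C, hC⟩ := hK.exists_bound_of_continuousOn hc.continuousOn
  have := intervalIntegral.hasFDerivAt_integral_of_dominated_of_fderiv_le (μ := volume)
    (F := fun z s => lagr n H (φ s z)) (F' := F') (x₀ := z) (s := Metric.ball z 1)
    (a := 0) (b := t) (bound := fun _ => C) (Metric.ball_mem_nhds _ one_pos)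
    (Eventually.of_forall fun z => (h.continuous_lagr_flow z).aestronglyMeasurable.restrict)
    ((h.continuous_lagr_flow z).intervalIntegrable _ _)
    hcz.aestronglyMeasurable.restrict
    (Eventually.of_forall fun s hs z' hz' =>
      hC (s, z') ⟨Set.uIoc_subset_uIcc hs, Metric.ball_subset_closedBall hz'⟩)
    intervalIntegrable_const
    (Eventually.of_forall fun s _ z' _ => (h.hasFDerivAt_lagr _).comp z' (h.hasFDerivAt_flow s z'))
  suffices e : actD n φ t z = ∫ s in (0 : ℝ)..t, F' z s by rw [e]; exact this
  refine ContinuousLinearMap.ext fun ζ => ?_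
  rw [ContinuousLinearMap.intervalIntegral_apply (hcz.intervalIntegrable _ _)]
  have hII : Continuous fun s => F' z s ζ := hcz.clm_apply continuous_const
  have h2 := intervalIntegral.integral_eq_sub_of_hasDerivAt (f := fun s => actD n φ s z ζ)
    (fun s _ => h.hasDerivAt_actD z ζ s) (hII.intervalIntegrable 0 t)
  simp only [hF', ContinuousLinearMap.comp_apply] at h2 ⊢
  rw [h2]
  simp [actD_apply, h.flow_zero, h.fderiv_flow_zero]

lemma continuous_lagr_flow_prod (h : TonelliFlow n H φ) :
    Continuous fun q : ℝ × (E n × E n) => lagr n H (φ q.1 q.2) :=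
  h.contDiff_lagr.continuous.comp h.continuous_flow

lemma hasStrictFDerivAt_act (h : TonelliFlow n H φ) (q : ℝ × (E n × E n)) :
    HasStrictFDerivAt (fun q : ℝ × (E n × E n) => act n H φ q.1 q.2)
      ((ContinuousLinearMap.toSpanSingleton ℝ (lagr n H (φ q.1 q.2))).coprod
        (actD n φ q.1 q.2)) q := by
  have hc : Continuous fun q : ℝ × (E n × E n) =>
      ContinuousLinearMap.toSpanSingleton ℝ (lagr n H (φ q.1 q.2)) :=
    (ContinuousLinearMap.toSpanSingletonLIE ℝ ℝ).continuous.comp h.continuous_lagr_flow_prod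
  exact hasStrictFDerivAt_uncurry_coprod (f := act n H φ) (u := q)
    (f₁ := fun t z => ContinuousLinearMap.toSpanSingleton ℝ (lagr n H (φ t z)))
    (f₂ := fun t z => actD n φ t z)
    (Eventually.of_forall fun v => (h.hasDerivAt_act v.2 v.1).hasFDerivAt)
    (Eventually.of_forall fun v => h.hasFDerivAt_act v.1 v.2) hc.continuousAt
    h.continuous_actD.continuousAt

lemma continuous_act (h : TonelliFlow n H φ) :
    Continuous fun q : ℝ × (E n × E n) => act n H φ q.1 q.2 :=
  continuous_iff_continuousAt.2 fun q => (h.hasStrictFDerivAt_act q).continuousAt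

end TonelliFlow

lemma tendsto_clm_apply {α V W : Type*} [NormedAddCommGroup V] [NormedSpace ℝ V]
    [NormedAddCommGroup W] [NormedSpace ℝ W] {l : Filter α} {L : α → V →L[ℝ] W} {v : α → V}
    {L₀ : V →L[ℝ] W} {v₀ : V} (hL : Tendsto L l (𝓝 L₀)) (hv : Tendsto v l (𝓝 v₀)) :
    Tendsto (fun a => L a (v a)) l (𝓝 (L₀ v₀)) :=
  ((isBoundedBilinearMap_apply (𝕜 := ℝ) (E := V) (F := W)).continuous.tendsto (L₀, v₀)).comp
    (hL.prodMk_nhds hv)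

namespace TonelliFlow

variable {n : ℕ} {H : E n × E n → ℝ} {φ : ℝ → E n × E n → E n × E n}

/-- The fiberwise Hessian is positive definite. -/
lemma hess_pos (h : TonelliFlow n H φ) (z : E n × E n) {y : E n} (hy : y ≠ 0) :
    0 < dotP n y (fderiv ℝ (hamVF n H) z (0, y)).1 := by
  obtain ⟨x, p⟩ := z
  have h1 := h.posdef x p y hy
  have e : (fun p' => fderiv ℝ (fun p'' => H (x, p'')) p' y) =
      fun p' => dotP n (hamVF n H (x, p')).1 y := by
    funext p'
    exact clm_eq_dotP _ _
  rw [e] at h1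
  have h2 : HasFDerivAt (fun p' => (hamVF n H (x, p')).1) _ p :=
    ((h.hasFDerivAt_hamVF (x, p)).comp p (hasFDerivAt_prodMk_right x p)).fst
  have h3 : HasFDerivAt (fun p' => dotB n y (hamVF n H (x, p')).1) _ p :=
    (dotB n y).hasFDerivAt.comp p h2
  have e2 : (fun p' => dotP n (hamVF n H (x, p')).1 y) =
      fun p' => dotB n y (hamVF n H (x, p')).1 := by
    funext p'
    rw [dotP_comm]; rfl
  rw [e2, h3.fderiv] at h1
  simpa [dotB_apply] using h1

lemma fderiv_flow_injective (h : TonelliFlow n H φ) (t : ℝ) (z : E n × E n) {ζ : E n × E n}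
    (hζ : fderiv ℝ (φ t) z ζ = 0) : ζ = 0 := by
  have h1 : ∀ ζ', omega0 n ζ ζ' = 0 := by
    intro ζ'
    rw [← h.omega0_fderiv_flow t z ζ ζ', hζ]
    simp [omega0]
  have h2 : ζ.2 = 0 := dotP_left_injective fun v => by
    simpa [omega0] using h1 (v, 0)
  have h3 : ζ.1 = 0 := dotP_left_injective fun v => by
    simpa [omega0] using h1 (0, v)
  exact Prod.ext h3 h2

/-- A flow-invariant Lipschitz Lagrangian plane field along an orbit, transverse to the vertical,
prevents conjugate points along this orbit. -/
lemma eq_zero_of_invariant_lagrangian (h : TonelliFlow n H φ) {z : E n × E n} {S : E n →L[ℝ] E n}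
    {K : ℝ} (hsymm : ∀ v w, dotP n (S v) w = dotP n (S w) v)
    (hinv : ∀ s v, ‖(fderiv ℝ (φ s) z (v, S v)).2‖ ≤ K * ‖(fderiv ℝ (φ s) z (v, S v)).1‖)
    {t : ℝ} (ht : t ≠ 0) {w : E n} (hw : (fderiv ℝ (φ t) z (0, w)).1 = 0) : w = 0 := by
  by_contra hw0
  set G : E n →L[ℝ] E n × E n := (ContinuousLinearMap.id ℝ (E n)).prod S with hG
  have hGv : ∀ v, G v = (v, S v) := fun v => rfl
  set D : ℝ → E n →L[ℝ] E n × E n := fun s => (fderiv ℝ (φ s) z).comp G with hD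
  set B : ℝ → E n →L[ℝ] E n := fun s => (ContinuousLinearMap.fst ℝ (E n) (E n)).comp (D s) with hB
  have hDv : ∀ s v, D s v = fderiv ℝ (φ s) z (v, S v) := fun s v => rfl
  have hBv : ∀ s v, B s v = (D s v).1 := fun s v => rfl
  have hBinj : ∀ s, Function.Injective (B s) := by
    intro s
    rw [injective_iff_map_eq_zero]
    intro v hv
    have h1 : (fderiv ℝ (φ s) z (v, S v)).1 = 0 := hv
    have h2 : (fderiv ℝ (φ s) z (v, S v)).2 = 0 := by
      have := hinv s v
      rw [h1, norm_zero, mul_zero] at this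
      exact norm_le_zero_iff.1 this
    exact congrArg Prod.fst (h.fderiv_flow_injective s z (Prod.ext h1 h2))
  have hunit : ∀ s, IsUnit (B s) := by
    intro s
    have e := (LinearEquiv.ofInjectiveEndo (B s).toLinearMap (hBinj s)).toContinuousLinearEquiv
    refine ⟨ContinuousLinearEquiv.unitsEquiv ℝ (E n) |>.symm
      (LinearEquiv.ofInjectiveEndo (B s).toLinearMap (hBinj s)).toContinuousLinearEquiv, ?_⟩
    ext v
    rfl
  -- derivatives along the orbit
  have hD' : ∀ s v, HasDerivAt (fun s => D s v) (fderiv ℝ (hamVF n H) (φ s z) (D s v)) s :=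
    fun s v => h.hasDerivAt_fderiv_flow z _ s
  set k : ℝ → E n := fun s => Ring.inverse (B s) (fderiv ℝ (φ s) z (0, w)).1 with hk
  have hBk : ∀ s, B s (k s) = (fderiv ℝ (φ s) z (0, w)).1 := by
    intro s
    simp only [hk]
    rw [← mul_apply_eq_comp, Ring.mul_inverse_cancel _ (hunit s)]
    rfl
  have hBdiff : ∀ s, DifferentiableAt ℝ B s := by
    intro s
    have hc : ContDiff ℝ 1 B := by
      rw [contDiff_clm_apply_iff]
      intro v
      have hd : ∀ s, HasDerivAt (fun s => B s v) (fderiv ℝ (hamVF n H) (φ s z) (D s v)).1 s :=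
        fun s => (hD' s v).fst
      rw [contDiff_one_iff_deriv]
      refine ⟨fun s => (hd s).differentiableAt, ?_⟩
      rw [show deriv (fun s => B s v) = _ from funext fun s => (hd s).deriv]
      have c1 : Continuous fun s => D s v :=
        continuous_iff_continuousAt.2 fun s => (hD' s v).continuousAt
      exact continuous_fst.comp (((h.contDiff_hamVF.continuous_fderiv (by norm_num)).comp
        (h.continuous_flow_left z)).clm_apply c1)
    exact hc.differentiable (by norm_num) s
  have hkdiff : ∀ s, HasDerivAt k (deriv k s) s := by
    intro s
    refine DifferentiableAt.hasDerivAt ?_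
    obtain ⟨U, hU⟩ := hunit s
    have h1 : DifferentiableAt ℝ (Ring.inverse (M₀ := E n →L[ℝ] E n)) (B s) := by
      rw [← hU]; exact differentiableAt_inverse (𝕜 := ℝ) U.isUnit
    exact (h1.comp s (hBdiff s)).clm_apply
      (h.hasDerivAt_fderiv_flow z (0, w) s).differentiableAt.fst
  set y : ℝ → E n := fun s => (fderiv ℝ (φ s) z (0, w)).2 - (D s (k s)).2 with hy
  have hwy : ∀ s v, dotP n w v = dotP n (y s) (B s v) := by
    intro s v
    have h1 := h.omega0_fderiv_flow s z (0, w) (v, S v)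
    have h2 := h.omega0_fderiv_flow s z (k s, S (k s)) (v, S v)
    rw [← hDv] at h1
    rw [← hDv, ← hDv] at h2
    simp only [omega0, dotP_zero_left, sub_zero] at h1 h2
    rw [← hBv, ← hBk s] at h1
    rw [← hBv, ← hBv, hsymm, dotP_comm n (S v), sub_self] at h2
    simp only [hy, dotP_sub_left]
    linarith
  have hy0 : ∀ s, y s ≠ 0 := by
    intro s hs
    exact hw0 (dotP_left_injective fun v => by rw [hwy s v, hs, dotP_zero_left, dotP_zero_left])
  have hk' : ∀ s, B s (deriv k s) = (fderiv ℝ (hamVF n H) (φ s z) (0, y s)).1 := by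
    intro s
    have h1 := (hBdiff s).hasDerivAt.clm_apply (hkdiff s)
    have h2 : HasDerivAt (fun s => (B s) (k s))
        (fderiv ℝ (hamVF n H) (φ s z) (fderiv ℝ (φ s) z (0, w))).1 s := by
      simp only [hBk]
      exact (h.hasDerivAt_fderiv_flow z (0, w) s).fst
    have h3 : deriv B s (k s) = (fderiv ℝ (hamVF n H) (φ s z) (D s (k s))).1 := by
      have a := (hBdiff s).hasDerivAt.clm_apply (hasDerivAt_const s (k s))
      have b : HasDerivAt (fun s' => B s' (k s)) (fderiv ℝ (hamVF n H) (φ s z) (D s (k s))).1 s :=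
        (hD' s (k s)).fst
      have := a.unique b
      simpa using this
    have h4 := h1.unique h2
    rw [h3] at h4
    have e : ((0 : E n), y s) = fderiv ℝ (φ s) z (0, w) - D s (k s) := by
      refine Prod.ext ?_ rfl
      change 0 = (fderiv ℝ (φ s) z (0, w)).1 - B s (k s)
      rw [hBk, sub_self]
    rw [e, map_sub, Prod.fst_sub, ← eq_sub_of_add_eq' h4]
  have hg : ∀ s, HasDerivAt (fun s => dotP n w (k s)) (dotP n w (deriv k s)) s := by
    intro s
    simpa using hasDerivAt_dotP (hasDerivAt_const s w) (hkdiff s)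
  have hmono : StrictMono fun s => dotP n w (k s) := by
    refine strictMono_of_deriv_pos fun s => ?_
    rw [(hg s).deriv, hwy s, hk' s]
    exact h.hess_pos _ (hy0 s)
  have hk0 : ∀ s, (fderiv ℝ (φ s) z (0, w)).1 = 0 → dotP n w (k s) = 0 := by
    intro s hs
    simp only [hk, hs, map_zero, dotP_zero_right]
  have h0 := hk0 0 (by simp [h.fderiv_flow_zero])
  have h1 := hk0 t hw
  exact ht (hmono.injective (h1.trans h0.symm))

/-- A continuous foliation by invariant Lipschitz Lagrangian graphs rules out conjugate points. -/
lemma noConjugatePoints_of_graphs (h : TonelliFlow n H φ)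
    (hgr : ∀ x p : E n, ∃ (f : E n → E n) (K : ℝ≥0) (c : E n) (u : E n → ℝ), f x = p ∧
      LipschitzWith K f ∧ ContDiff ℝ 1 u ∧ (∀ y, f y = c + gradF n u y) ∧
      ∀ t y, (φ t (y, f y)).2 = f (φ t (y, f y)).1) :
    NoConjugatePoints n φ := by
  intro z t ht w hw
  obtain ⟨f, K, c, u, hfx, hf, hu, hfu, hinv⟩ := hgr z.1 z.2
  -- at differentiability points
  have hdiff : ∀ y, DifferentiableAt ℝ f y → ‖fderiv ℝ f y‖ ≤ K ∧
      (∀ v w, dotP n (fderiv ℝ f y v) w = dotP n (fderiv ℝ f y w) v) ∧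
      ∀ s v, ‖(fderiv ℝ (φ s) (y, f y) (v, fderiv ℝ f y v)).2‖ ≤
        K * ‖(fderiv ℝ (φ s) (y, f y) (v, fderiv ℝ f y v)).1‖ := by
    intro y hy
    refine ⟨norm_fderiv_le_of_lipschitz ℝ hf, fun v w => ?_, fun s v => ?_⟩
    · have h1 : ∀ x, HasFDerivAt u (dotB n (f x - c)) x := by
        intro x
        have e : dotB n (f x - c) = fderiv ℝ u x := by
          ext1 v
          rw [fderiv_eq_dotP_gradF, dotB_apply, hfu, add_sub_cancel_left]
        rw [e]
        exact (hu.differentiable (by norm_num) x).hasFDerivAt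
      have h2 : HasFDerivAt (fun x => dotB n (f x - c)) ((dotB n).comp (fderiv ℝ f y)) y :=
        (dotB n).hasFDerivAt.comp y (hy.hasFDerivAt.sub_const c)
      exact second_derivative_symmetric h1 h2 v w
    · have h1 : HasFDerivAt (fun x => φ s (x, f x)) _ y :=
        (h.hasFDerivAt_flow s (y, f y)).comp y ((hasFDerivAt_id y).prodMk hy.hasFDerivAt)
      have h2 := (h1.hasLineDerivAt v)
      unfold HasLineDerivAt at h2
      have h3 := h2.tendsto_slope_zero
      have h4 := (continuous_snd.tendsto _).comp h3 |>.norm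
      have h5 := ((continuous_fst.tendsto _).comp h3 |>.norm).const_mul (K : ℝ)
      refine le_of_tendsto_of_tendsto h4 h5 (Eventually.of_forall fun τ => ?_)
      have := hf.dist_le_mul (φ s (y + τ • v, f (y + τ • v))).1 (φ s (y, f y)).1
      rw [← hinv, ← hinv, dist_eq_norm, dist_eq_norm] at this
      simp only [Function.comp_apply, zero_add, zero_smul, add_zero, Prod.smul_snd, Prod.smul_fst,
        Prod.snd_sub, Prod.fst_sub, norm_smul]
      calc _ ≤ ‖τ⁻¹‖ * (K * ‖(φ s (y + τ • v, f (y + τ • v))).1 - (φ s (y, f y)).1‖) := by gcongr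
        _ = _ := by ring
  -- pass to the limit
  have hdense : Dense {y | DifferentiableAt ℝ f y} :=
    Measure.dense_of_ae (μ := volume) hf.ae_differentiableAt
  obtain ⟨ys, hys, hlim⟩ := mem_closure_iff_seq_limit.1 (hdense z.1)
  obtain ⟨S, -, ψ, hψ, hS⟩ := (isCompact_closedBall (0 : E n →L[ℝ] E n) K).tendsto_subseq
    (x := fun k => fderiv ℝ f (ys k)) (fun k => by simpa using (hdiff _ (hys k)).1)
  have hlim' : Tendsto (fun k => ys (ψ k)) atTop (𝓝 z.1) := hlim.comp hψ.tendsto_atTop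
  have hz : (z.1, f z.1) = z := by rw [hfx]
  have hSv : ∀ v, Tendsto (fun k => fderiv ℝ f (ys (ψ k)) v) atTop (𝓝 (S v)) := fun v =>
    tendsto_clm_apply hS tendsto_const_nhds
  refine h.eq_zero_of_invariant_lagrangian (S := S) (K := K) (fun v w => ?_) (fun s v => ?_) ht hw
  · refine tendsto_nhds_unique (f := fun k => dotP n (fderiv ℝ f (ys (ψ k)) v) w) (l := atTop) ?_ ?_
    · exact tendsto_clm_apply (((dotB n).continuous.tendsto _).comp (hSv v)) tendsto_const_nhds
    · simp only [(hdiff _ (hys (ψ _))).2.1 v w]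
      exact tendsto_clm_apply (((dotB n).continuous.tendsto _).comp (hSv w)) tendsto_const_nhds
  · have h1 : Tendsto (fun k => fderiv ℝ (φ s) (ys (ψ k), f (ys (ψ k)))
        (v, fderiv ℝ f (ys (ψ k)) v)) atTop (𝓝 (fderiv ℝ (φ s) z (v, S v))) := by
      refine tendsto_clm_apply ?_ (tendsto_const_nhds.prodMk_nhds (hSv v))
      have := ((h.flow_smooth s).continuous_fderiv (by norm_num)).tendsto z
      refine this.comp ?_
      rw [← congrArg 𝓝 hz]
      exact hlim'.prodMk_nhds ((hf.continuous.tendsto _).comp hlim')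
    exact le_of_tendsto_of_tendsto ((continuous_snd.tendsto _).comp h1).norm
      (((continuous_fst.tendsto _).comp h1).norm.const_mul (K : ℝ))
      (Eventually.of_forall fun k => (hdiff _ (hys (ψ k))).2.2 s v)

/-- Fiberwise convexity. -/
lemma subgradient (h : TonelliFlow n H φ) (x p q : E n) :
    H (x, p) + dotP n (gradP n H x p) (q - p) ≤ H (x, q) := by
  by_cases hpq : q - p = 0
  · rw [sub_eq_zero] at hpq; subst hpq; simp
  set v := q - p with hv
  have hd0 : ∀ s : ℝ, HasDerivAt (fun s : ℝ => (x, p + s • v)) ((0 : E n), v) s := by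
    intro s
    have h1 : HasDerivAt (fun s : ℝ => p + s • v) ((1 : ℝ) • v) s :=
      ((hasDerivAt_id s).smul_const v).const_add p
    rw [one_smul] at h1
    exact (hasDerivAt_const s x).prodMk h1
  have hd : ∀ s : ℝ, HasDerivAt (fun s : ℝ => H (x, p + s • v))
      (dotP n v (hamVF n H (x, p + s • v)).1) s := by
    intro s
    have h1 : HasFDerivAt H (fderiv ℝ H (x, p + s • v)) (x, p + s • v) :=
      (h.smooth.differentiable (by norm_num) _).hasFDerivAt
    have h2 := h1.comp_hasDerivAt s (hd0 s)
    rw [h.fderiv_apply] at h2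
    convert! h2 using 1
    simp [hamVF, dotP_comm]
  have hd2 : ∀ s : ℝ, HasDerivAt (fun s : ℝ => dotP n v (hamVF n H (x, p + s • v)).1)
      (dotP n v (fderiv ℝ (hamVF n H) (x, p + s • v) (0, v)).1) s := by
    intro s
    have h0 : HasDerivAt (fun s : ℝ => hamVF n H (x, p + s • v))
        (fderiv ℝ (hamVF n H) (x, p + s • v) (0, v)) s := by
      have h00 := h.hasFDerivAt_hamVF (x, p + s • v)
      exact h00.comp_hasDerivAt s (hd0 s)
    have h1 : HasDerivAt (fun s : ℝ => (hamVF n H (x, p + s • v)).1) _ s := h0.fst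
    have := hasDerivAt_dotP (hasDerivAt_const s v) h1
    simpa using! this
  have hmono : Monotone fun s : ℝ => dotP n v (hamVF n H (x, p + s • v)).1 := by
    refine monotone_of_deriv_nonneg (fun s => (hd2 s).differentiableAt) fun s => ?_
    rw [(hd2 s).deriv]
    exact (h.hess_pos _ hpq).le
  obtain ⟨ξ, hξ, hξe⟩ := exists_hasDerivAt_eq_slope (fun s : ℝ => H (x, p + s • v)) _ zero_lt_one
    (fun s _ => (hd s).continuousAt.continuousWithinAt) (fun s _ => hd s)
  have hm := hmono hξ.1.le
  simp only [zero_smul, add_zero, one_smul, sub_zero, div_one] at hξe hm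
  have e : p + v = q := by simp [hv]
  rw [e] at hξe
  simp only [hamVF] at hm hξe
  rw [dotP_comm]
  linarith

/-- Fenchel's inequality. -/
lemma fenchel (h : TonelliFlow n H φ) (x p q : E n) :
    dotP n q (gradP n H x p) - H (x, q) ≤ lagr n H (x, p) := by
  have := h.subgradient x p q
  rw [dotP_sub_right, dotP_comm n _ q, dotP_comm n _ p] at this
  simp only [lagr]
  linarith

lemma exists_H_bound (h : TonelliFlow n H φ) (R : ℝ) :
    ∃ C, 0 < C ∧ ∀ z : E n × E n, ‖z.2‖ ≤ R → |H z| ≤ C :=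
  exists_bound_strip h.continuous_H h.periodic R

lemma dotP_le_H (h : TonelliFlow n H φ) (V : ℝ) :
    ∃ C, 0 < C ∧ ∀ x p v : E n, ‖v‖ ≤ V → dotP n p v ≤ H (x, p) + C := by
  obtain ⟨R, hR⟩ := h.superlinear (n * |V|)
  obtain ⟨M, hM0, hM⟩ := h.exists_H_bound R
  refine ⟨n * |V| * |R| + M, by positivity, fun x p v hv => ?_⟩
  have h1 : dotP n p v ≤ n * |V| * ‖p‖ := by
    refine (le_abs_self _).trans ((abs_dotP_le n p v).trans ?_)
    have := mul_le_mul_of_nonneg_left (hv.trans (le_abs_self V))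
      (by positivity : 0 ≤ n * ‖p‖)
    linarith
  rcases le_total R ‖p‖ with hp | hp
  · have := hR x p hp
    have : 0 ≤ n * |V| * |R| := by positivity
    linarith
  · have h2 := (abs_le.1 (hM (x, p) hp)).1
    have h3 : n * |V| * ‖p‖ ≤ n * |V| * |R| := by
      have := hp.trans (le_abs_self R)
      gcongr
    linarith

lemma norm_gradP_le_lagr (h : TonelliFlow n H φ) (hn : 1 ≤ n) :
    ∃ C, 0 < C ∧ ∀ z : E n × E n, ‖gradP n H z.1 z.2‖ ≤ lagr n H z + C := by
  obtain ⟨M, hM0, hM⟩ := h.exists_H_bound 1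
  refine ⟨M, hM0, fun z => ?_⟩
  obtain ⟨e, he, he'⟩ := exists_norm_eq_dotP hn (gradP n H z.1 z.2)
  have h1 := h.fenchel z.1 z.2 e
  rw [dotP_comm, he'] at h1
  have h2 := (abs_le.1 (hM (z.1, e) he.le)).2
  linarith

lemma lagr_coercive (h : TonelliFlow n H φ) (hn : 1 ≤ n) (A : ℝ) :
    ∃ R, 0 < R ∧ ∀ z : E n × E n, lagr n H z ≤ A → ‖z.2‖ ≤ R := by
  obtain ⟨M₁, hM₁0, hM₁⟩ := h.norm_gradP_le_lagr hn
  obtain ⟨M₀, hM₀0, hM₀⟩ := h.exists_H_bound 0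
  obtain ⟨R, hR⟩ := h.superlinear (n * (|A| + M₁) + 1)
  refine ⟨max R M₀, lt_max_of_lt_right hM₀0, fun z hz => ?_⟩
  obtain ⟨x, p⟩ := z
  rcases le_total ‖p‖ R with hp | hp
  · exact hp.trans (le_max_left _ _)
  refine le_trans ?_ (le_max_right _ _)
  have h1 : ‖gradP n H x p‖ ≤ |A| + M₁ := (hM₁ (x, p)).trans (by linarith [le_abs_self A])
  have h2 := h.subgradient x p 0
  have h3 := (abs_le.1 (hM₀ (x, 0) (by simp))).2
  have h4 : dotP n (gradP n H x p) p ≤ n * (|A| + M₁) * ‖p‖ := by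
    refine (le_abs_self _).trans ((abs_dotP_le n _ _).trans ?_)
    gcongr
  rw [zero_sub, dotP_neg_right] at h2
  have := hR x p hp
  nlinarith

/-- Orbits with small average action have bounded momentum. -/
lemma act_coercive (h : TonelliFlow n H φ) (hn : 1 ≤ n) (A : ℝ) :
    ∃ R, 0 < R ∧ ∀ s : ℝ, 0 < s → ∀ z, act n H φ s z ≤ A * s → ∀ r, ‖(φ r z).2‖ ≤ R := by
  obtain ⟨R₁, hR₁0, hR₁⟩ := h.lagr_coercive hn A
  obtain ⟨M, hM0, hM⟩ := h.exists_H_bound R₁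
  obtain ⟨R, hR0, hR⟩ := h.norm_snd_le M
  refine ⟨R, hR0, fun s hs z hz r => ?_⟩
  obtain ⟨ξ, hξ, hξe⟩ := exists_hasDerivAt_eq_slope (fun t => act n H φ t z) _ hs
    (fun t _ => (h.hasDerivAt_act z t).continuousAt.continuousWithinAt)
    (fun t _ => h.hasDerivAt_act z t)
  have h1 : lagr n H (φ ξ z) ≤ A := by
    rw [hξe, div_le_iff₀ (by linarith)]
    simpa using hz
  have h2 := (abs_le.1 (hM _ (hR₁ _ h1))).2
  apply hR
  rw [h.energy] at h2 ⊢
  exact h2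

end TonelliFlow

/-- The map `(t, x, p) ↦ (t, x, π φ_t(x, p))`. -/
def baseMap {n : ℕ} (φ : ℝ → E n × E n → E n × E n) (q : ℝ × (E n × E n)) : ℝ × (E n × E n) :=
  (q.1, (q.2.1, (φ q.1 q.2).1))

namespace TonelliFlow

variable {n : ℕ} {H : E n × E n → ℝ} {φ : ℝ → E n × E n → E n × E n}

lemma hasStrictFDerivAt_baseMap (h : TonelliFlow n H φ) (hc : NoConjugatePoints n φ)
    (q : ℝ × (E n × E n)) (hq : q.1 ≠ 0) :
    ∃ L : (ℝ × (E n × E n)) ≃L[ℝ] (ℝ × (E n × E n)),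
      HasStrictFDerivAt (baseMap φ) (L : (ℝ × (E n × E n)) →L[ℝ] (ℝ × (E n × E n))) q := by
  have h1 : HasStrictFDerivAt (fun q : ℝ × (E n × E n) => (φ q.1 q.2).1) _ q :=
    (h.hasStrictFDerivAt_flow q).fst
  have h2 : HasStrictFDerivAt (fun q : ℝ × (E n × E n) => q.2.1) _ q :=
    (hasStrictFDerivAt_snd (𝕜 := ℝ) (p := q)).fst
  have h3 : HasStrictFDerivAt (baseMap φ) _ q := hasStrictFDerivAt_fst.prodMk (h2.prodMk h1)
  set D := (ContinuousLinearMap.fst ℝ ℝ (E n × E n)).prod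
    (((ContinuousLinearMap.fst ℝ (E n) (E n)).comp (ContinuousLinearMap.snd ℝ ℝ (E n × E n))).prod
      ((ContinuousLinearMap.fst ℝ (E n) (E n)).comp
        ((ContinuousLinearMap.toSpanSingleton ℝ (hamVF n H (φ q.1 q.2))).coprod
        (fderiv ℝ (φ q.1) q.2)))) with hD
  have hinj : Function.Injective (D : (ℝ × (E n × E n)) →ₗ[ℝ] (ℝ × (E n × E n))) := by
    rw [injective_iff_map_eq_zero]
    rintro ⟨τ, ξ, ζ⟩ hz
    have e : ((τ, (ξ, (τ • hamVF n H (φ q.1 q.2) + fderiv ℝ (φ q.1) q.2 (ξ, ζ)).1)) :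
      ℝ × (E n × E n)) = 0 := hz
    simp only [Prod.mk_eq_zero] at e
    obtain ⟨rfl, rfl, e⟩ := e
    rw [zero_smul, zero_add] at e
    have := hc q.2 q.1 hq ζ e
    simp [this]
  refine ⟨(LinearEquiv.ofInjectiveEndo _ hinj).toContinuousLinearEquiv, ?_⟩
  convert! h3 using 1

/-- Local solutions `p` of `π φ_t(x, p) = η(t)`. -/
lemma local_branch (h : TonelliFlow n H φ) (hc : NoConjugatePoints n φ) (x : E n) {η : ℝ → E n}
    (hη : Continuous η) {t : ℝ} (ht : t ≠ 0) {p : E n} (hp : (φ t (x, p)).1 = η t) :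
    ∃ ε > 0, ∃ l : ℝ → E n, ContinuousOn l (Metric.ball t ε) ∧
      (∀ s ∈ Metric.ball t ε, (φ s (x, l s)).1 = η s) ∧
      (∀ s ∈ Metric.ball t ε, ∀ q ∈ Metric.ball p ε, (φ s (x, q)).1 = η s → q = l s) ∧
      (DifferentiableAt ℝ η t → DifferentiableAt ℝ l t) := by
  obtain ⟨L, hL⟩ := h.hasStrictFDerivAt_baseMap hc (t, (x, p)) ht
  set e := hL.toOpenPartialHomeomorph (baseMap φ) with he
  have hco : ∀ q, e q = baseMap φ q := fun q => rfl
  have hsrc : (t, (x, p)) ∈ e.source := hL.mem_toOpenPartialHomeomorph_source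
  have hcη : Continuous fun s : ℝ => (s, (x, η s)) := by fun_prop
  have htgt : (t, (x, η t)) ∈ e.target := by
    have := e.map_source hsrc
    rwa [hco, baseMap, hp] at this
  have h1 : ∀ᶠ s in 𝓝 t, (s, (x, η s)) ∈ e.target :=
    hcη.continuousAt.eventually (e.open_target.mem_nhds htgt)
  have h2 : ∀ᶠ z in 𝓝 ((t, p) : ℝ × E n), (z.1, (x, z.2)) ∈ e.source := by
    have : Continuous fun z : ℝ × E n => (z.1, (x, z.2)) := by fun_prop
    exact this.continuousAt.eventually (e.open_source.mem_nhds hsrc)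
  obtain ⟨ε₁, hε₁, h1'⟩ := Metric.eventually_nhds_iff_ball.1 h1
  obtain ⟨ε₂, hε₂, h2'⟩ := Metric.eventually_nhds_iff_ball.1 h2
  have hsymm : ∀ s, (s, (x, η s)) ∈ e.target → e.symm (s, (x, η s)) =
      (s, (x, (e.symm (s, (x, η s))).2.2)) ∧
      (φ s (x, (e.symm (s, (x, η s))).2.2)).1 = η s := by
    intro s hs
    have := e.right_inv hs
    rw [hco] at this
    set w := e.symm (s, (x, η s)) with hw
    obtain ⟨w1, w2, w3⟩ := w
    simp only [baseMap, Prod.mk.injEq] at this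
    obtain ⟨rfl, rfl, hh⟩ := this
    exact ⟨rfl, hh⟩
  refine ⟨min ε₁ ε₂, lt_min hε₁ hε₂, fun s => (e.symm (s, (x, η s))).2.2, ?_, ?_, ?_, ?_⟩
  · have : ContinuousOn (fun s => e.symm (s, (x, η s))) (Metric.ball t (min ε₁ ε₂)) :=
      e.continuousOn_symm.comp hcη.continuousOn
        (fun s hs => h1' s (Metric.ball_subset_ball (min_le_left _ _) hs))
    exact (continuous_snd.comp continuous_snd).comp_continuousOn this
  · intro s hs
    exact (hsymm s (h1' s (Metric.ball_subset_ball (min_le_left _ _) hs))).2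
  · intro s hs q hq hsq
    have : (s, q) ∈ Metric.ball ((t, p) : ℝ × E n) ε₂ := by
      rw [Metric.mem_ball, Prod.dist_eq]
      exact max_lt (lt_of_lt_of_le hs (min_le_right _ _)) (lt_of_lt_of_le hq (min_le_right _ _))
    have h3 := e.left_inv (h2' _ this)
    rw [hco, baseMap] at h3
    simp only [hsq] at h3
    exact (congrArg (fun w => w.2.2) h3).symm
  · intro hd
    have h4 : HasStrictFDerivAt e.symm (L.symm : (ℝ × (E n × E n)) →L[ℝ] (ℝ × (E n × E n)))
      (baseMap φ (t, (x, p))) := hL.to_localInverse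
    have h5 : DifferentiableAt ℝ e.symm (t, (x, η t)) := by
      have := h4.hasFDerivAt.differentiableAt
      rwa [baseMap, hp] at this
    have h6 : DifferentiableAt ℝ (fun s : ℝ => (s, (x, η s))) t :=
      differentiableAt_id.prodMk ((differentiableAt_const x).prodMk hd)
    have h7 : DifferentiableAt ℝ (fun s : ℝ => e.symm (s, (x, η s))) t :=
      DifferentiableAt.comp t h5 h6
    exact h7.snd.snd

/-- Variation of the action along a curve of orbits issued from a fixed base point. -/
lemma hasDerivAt_act_curve (h : TonelliFlow n H φ) {x : ℝ → E n} {l η : ℝ → E n} {t : ℝ}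
    {x' l' η' : E n} (hx : HasDerivAt x x' t)
    (hl : HasDerivAt l l' t) (hη : HasDerivAt η η' t)
    (hlη : ∀ᶠ s in 𝓝 t, (φ s (x s, l s)).1 = η s) :
    HasDerivAt (fun s => act n H φ s (x s, l s))
      (dotP n (φ t (x t, l t)).2 η' - dotP n (l t) x' - H (x t, l t)) t := by
  have hcurve : HasDerivAt (fun s : ℝ => (s, (x s, l s))) ((1 : ℝ), (x', l')) t :=
    (hasDerivAt_id t).prodMk (hx.prodMk hl)
  have h1 := (h.hasStrictFDerivAt_act (t, (x t, l t))).hasFDerivAt.comp_hasDerivAt t hcurve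
  have h2 := (h.hasStrictFDerivAt_flow (t, (x t, l t))).hasFDerivAt.comp_hasDerivAt t hcurve
  change HasDerivAt (fun s => φ s (x s, l s)) _ t at h2
  have h3 : HasDerivAt (fun s => (φ s (x s, l s)).1) _ t := h2.fst
  have h4 := (h3.congr_of_eventuallyEq (f₁ := η)
    (by filter_upwards [hlη] with s hs using hs.symm)).unique hη
  convert! h1 using 1
  simp only [ContinuousLinearMap.coprod_apply, ContinuousLinearMap.toSpanSingleton_apply,
    actD_apply, one_smul, Prod.fst_add] at h4 ⊢
  rw [← h4, dotP_add_right, lagr, h.energy]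
  simp only [hamVF]
  ring

/-- A curve of momenta at `x` whose time-`s` projections follow the curve `η` on `[δ, t]`. -/
def IsLift (φ : ℝ → E n × E n → E n × E n) (x : E n) (η : ℝ → E n) (δ t : ℝ) (q : ℝ → E n) : Prop :=
  ContinuousOn q (Set.Icc δ t) ∧ ∀ s ∈ Set.Icc δ t, (φ s (x, q s)).1 = η s

lemma IsLift.exists_bound (h : TonelliFlow n H φ) (hn : 1 ≤ n) (hc : NoConjugatePoints n φ)
    (x : E n) {η η' : ℝ → E n} (hη : ∀ s, HasDerivAt η (η' s) s) {M : ℝ}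
    (hM : ∀ s, ‖η' s‖ ≤ M) {δ : ℝ} (hδ : 0 < δ) (p : E n) :
    ∃ R : ℝ, ∀ t q, IsLift φ x η δ t q → q δ = p → ∀ s ∈ Set.Icc δ t, ‖q s‖ ≤ R := by
  obtain ⟨C, hC0, hC⟩ := h.dotP_le_H M
  obtain ⟨R, hR0, hR⟩ := h.act_coercive hn (|act n H φ δ (x, p)| / δ + C)
  refine ⟨R, fun t q hq hqδ s hs => ?_⟩
  have hηc : Continuous η := continuous_iff_continuousAt.2 fun s => (hη s).continuousAt
  have hcont : ContinuousOn (fun s => act n H φ s (x, q s)) (Set.Icc δ t) := by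
    have : ContinuousOn (fun s => (s, (x, q s))) (Set.Icc δ t) :=
      continuousOn_id.prodMk (continuousOn_const.prodMk hq.1)
    exact h.continuous_act.comp_continuousOn this
  have hd : ∀ s ∈ Set.Ico δ t, HasDerivWithinAt (fun s => act n H φ s (x, q s))
      (dotP n (φ s (x, q s)).2 (η' s) - H (x, q s)) (Set.Ici s) s := by
    intro s hs
    have hs' : s ∈ Set.Icc δ t := ⟨hs.1, hs.2.le⟩
    obtain ⟨ε, hε, l, hlc, hl, hlu, hld⟩ := h.local_branch hc x hηc (hδ.trans_le hs.1).ne'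
      (hq.2 s hs')
    have hls : l s = q s := (hlu s (Metric.mem_ball_self hε) (q s) (Metric.mem_ball_self hε)
      (hq.2 s hs')).symm
    have h1 := h.hasDerivAt_act_curve (x := fun _ => x) (hasDerivAt_const s x)
      (hld (hη s).differentiableAt).hasDerivAt (hη s)
      (by filter_upwards [Metric.ball_mem_nhds s hε] with r hr using hl r hr)
    rw [dotP_zero_right, sub_zero, hls] at h1
    have hIcc : Set.Icc δ t ∈ 𝓝[Set.Ici s] s :=
      mem_of_superset (Icc_mem_nhdsGE hs.2) (Set.Icc_subset_Icc_left hs.1)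
    refine h1.hasDerivWithinAt.congr_of_eventuallyEq ?_ (by simp [hls])
    have h2 : ∀ᶠ r in 𝓝[Set.Ici s] s, q r ∈ Metric.ball (q s) ε :=
      ((hq.1 s hs').mono_of_mem_nhdsWithin hIcc).eventually (Metric.ball_mem_nhds _ hε)
    have h3 : ∀ᶠ r in 𝓝[Set.Ici s] s, r ∈ Metric.ball s ε :=
      mem_nhdsWithin_of_mem_nhds (Metric.ball_mem_nhds s hε)
    filter_upwards [h2, h3, hIcc] with r h2 h3 h4
    rw [hlu r h3 (q r) h2 (hq.2 r h4)]
  have hle : ∀ s ∈ Set.Icc δ t, act n H φ s (x, q s) ≤ act n H φ δ (x, p) + C * (s - δ) := by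
    intro s hs
    refine image_le_of_deriv_right_le_deriv_boundary (f := fun s => act n H φ s (x, q s))
      (B := fun s => act n H φ δ (x, p) + C * (s - δ)) (B' := fun _ => C) hcont hd
      (by simp [hqδ]) (by fun_prop) (fun s _ => ?_) (fun s hs => ?_) hs
    · have := (((hasDerivAt_id s).sub_const δ).const_mul C).const_add (act n H φ δ (x, p))
      rw [mul_one] at this
      exact this.hasDerivWithinAt
    · have h1 := hC (φ s (x, q s)).1 (φ s (x, q s)).2 (η' s) (hM s)
      have h2 := h.energy s (x, q s)
      rw [Prod.mk.eta, h2] at h1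
      linarith
  have hs0 : 0 < s := hδ.trans_le hs.1
  have := hR s hs0 (x, q s) ?_ 0
  · simpa [h.flow_zero] using this
  refine (hle s hs).trans ?_
  have h1 : act n H φ δ (x, p) ≤ |act n H φ δ (x, p)| / δ * s := by
    rw [div_mul_eq_mul_div, le_div_iff₀ hδ]
    exact mul_le_mul (le_abs_self _) hs.1 hδ.le (abs_nonneg _)
  nlinarith [mul_pos hC0 hδ]

lemma IsLift.exists_of_curve (h : TonelliFlow n H φ) (hn : 1 ≤ n) (hc : NoConjugatePoints n φ)
    (x : E n) {η η' : ℝ → E n} (hη : ∀ s, HasDerivAt η (η' s) s) {M : ℝ}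
    (hM : ∀ s, ‖η' s‖ ≤ M) {δ t : ℝ} (hδ : 0 < δ) (hδt : δ ≤ t) {p : E n}
    (hp : (φ δ (x, p)).1 = η δ) : ∃ q, IsLift φ x η δ t q ∧ q δ = p := by
  have hηc : Continuous η := continuous_iff_continuousAt.2 fun s => (hη s).continuousAt
  obtain ⟨R, hR⟩ := IsLift.exists_bound h hn hc x hη hM hδ p
  set S : Set ℝ := {s | s ∈ Set.Icc δ t ∧ ∃ q, IsLift φ x η δ s q ∧ q δ = p} with hS
  have hSδ : δ ∈ S := by
    refine ⟨⟨le_rfl, hδt⟩, fun _ => p, ⟨continuousOn_const, fun s hs => ?_⟩, rfl⟩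
    rw [Set.Icc_self, Set.mem_singleton_iff] at hs
    rw [hs, hp]
  have hbdd : BddAbove S := ⟨t, fun s hs => hs.1.2⟩
  set σ := sSup S with hσ
  have hδσ : δ ≤ σ := le_csSup hbdd hSδ
  have hσt : σ ≤ t := csSup_le ⟨δ, hSδ⟩ fun s hs => hs.1.2
  obtain ⟨u, -, hu, huS⟩ := exists_seq_tendsto_sSup ⟨δ, hSδ⟩ hbdd
  choose q hq hqδ using fun j => (huS j).2
  have hbd : ∀ j, q j (u j) ∈ Metric.closedBall (0 : E n) R := fun j => by
    rw [mem_closedBall_zero_iff]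
    exact hR _ _ (hq j) (hqδ j) _ ⟨(huS j).1.1, le_rfl⟩
  obtain ⟨p₀, -, ψ, hψ, hψl⟩ := (isCompact_closedBall (0 : E n) R).tendsto_subseq hbd
  have huψ : Tendsto (u ∘ ψ) atTop (𝓝 σ) := hu.comp hψ.tendsto_atTop
  have hσp : (φ σ (x, p₀)).1 = η σ := by
    have h1 : Tendsto (fun j => (φ (u (ψ j)) (x, q (ψ j) (u (ψ j)))).1) atTop
        (𝓝 (φ σ (x, p₀)).1) := by
      have := (continuous_fst.comp h.continuous_flow).tendsto (σ, (x, p₀))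
      exact this.comp (huψ.prodMk_nhds (tendsto_const_nhds.prodMk_nhds hψl))
    refine tendsto_nhds_unique h1 ?_
    have h2 : Tendsto (fun j => η (u (ψ j))) atTop (𝓝 (η σ)) := (hηc.tendsto σ).comp huψ
    refine h2.congr fun j => ?_
    exact ((hq (ψ j)).2 _ ⟨(huS _).1.1, le_rfl⟩).symm
  obtain ⟨ε, hε, l, hlc, hl, hlu, -⟩ := h.local_branch hc x hηc (hδ.trans_le hδσ).ne' hσp
  obtain ⟨j, hj1, hj2⟩ := ((huψ.eventually (Metric.ball_mem_nhds σ hε)).and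
    (hψl.eventually (Metric.ball_mem_nhds p₀ hε))).exists
  set s₁ := u (ψ j) with hs₁
  have hjl : q (ψ j) s₁ = l s₁ := hlu s₁ hj1 _ hj2 ((hq (ψ j)).2 _ ⟨(huS _).1.1, le_rfl⟩)
  have hs₁σ : s₁ ≤ σ := le_csSup hbdd (huS _)
  have hball : ∀ s, s₁ ≤ s → s < σ + ε → s ∈ Metric.ball σ ε := by
    intro s h1 h2
    have := hj1
    simp only [Function.comp, Metric.mem_ball, Real.dist_eq, abs_lt] at this ⊢
    constructor <;> linarith
  have key : min t (σ + ε / 2) ∈ S := by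
    refine ⟨⟨le_min hδt (by linarith), min_le_left _ _⟩,
      fun s => if s ≤ s₁ then q (ψ j) s else l s, ⟨?_, ?_⟩, ?_⟩
    · refine ContinuousOn.if (p := fun s => s ≤ s₁) ?_ ?_ ?_
      · intro s hs
        have : frontier {s : ℝ | s ≤ s₁} ⊆ {s₁} := by
          have := frontier_Iic_subset s₁
          exact this
        have := this hs.2
        rw [Set.mem_singleton_iff] at this
        rw [this, hjl]
      · refine (hq (ψ j)).1.mono ?_
        rintro s ⟨h1, h2⟩
        have : closure {s : ℝ | s ≤ s₁} = Set.Iic s₁ := closure_Iic s₁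
        rw [this] at h2
        exact ⟨h1.1, h2⟩
      · refine hlc.mono ?_
        rintro s ⟨h1, h2⟩
        have : closure {s : ℝ | ¬ s ≤ s₁} = Set.Ici s₁ := by
          simp only [not_le]
          exact closure_Ioi s₁
        rw [this] at h2
        exact hball s h2 (by linarith [h1.2, min_le_right t (σ + ε / 2)])
    · intro s hs
      by_cases hss : s ≤ s₁
      · simp only [hss, if_true]
        exact (hq (ψ j)).2 s ⟨hs.1, hss⟩
      · simp only [hss, if_false]
        exact hl s (hball s (not_le.1 hss).le (by linarith [hs.2, min_le_right t (σ + ε / 2)]))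
    · simp only [hs₁, (huS (ψ j)).1.1, if_true, hqδ]
  have := le_csSup hbdd key
  have ht : min t (σ + ε / 2) = t := by
    rcases min_choice t (σ + ε / 2) with h1 | h1
    · exact h1
    · rw [h1] at this; linarith
  rw [ht] at key
  exact key.2

lemma isLocalHomeomorph_baseMap_exp (h : TonelliFlow n H φ) (hc : NoConjugatePoints n φ) :
    IsLocalHomeomorph fun q : ℝ × (E n × E n) => baseMap φ (Real.exp q.1, q.2) := by
  intro q
  obtain ⟨L, hL⟩ := h.hasStrictFDerivAt_baseMap hc (Real.exp q.1, q.2) (Real.exp_pos _).ne'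
  have h1 := (Real.hasStrictDerivAt_exp q.1).hasStrictFDerivAt_equiv (Real.exp_pos _).ne'
  have h2 : HasStrictFDerivAt (fun w : ℝ × (E n × E n) => (Real.exp w.1, w.2))
      ((ContinuousLinearEquiv.prodCongr (ContinuousLinearEquiv.unitsEquivAut ℝ
        (Units.mk0 (Real.exp q.1) (Real.exp_pos _).ne'))
        (ContinuousLinearEquiv.refl ℝ (E n × E n)) :
          (ℝ × (E n × E n)) ≃L[ℝ] (ℝ × (E n × E n))) :
          (ℝ × (E n × E n)) →L[ℝ] (ℝ × (E n × E n))) q :=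
    h1.prodMap q (hasStrictFDerivAt_id q.2)
  have h3 : HasStrictFDerivAt (fun q : ℝ × (E n × E n) => baseMap φ (Real.exp q.1, q.2))
    ((ContinuousLinearEquiv.trans _ L : (ℝ × (E n × E n)) ≃L[ℝ] (ℝ × (E n × E n))) :
          (ℝ × (E n × E n)) →L[ℝ] (ℝ × (E n × E n))) q := hL.comp q h2
  exact ⟨h3.toOpenPartialHomeomorph _, h3.mem_toOpenPartialHomeomorph_source, rfl⟩

/-- The projected orbit of `(x, p)`, corrected linearly so as to end at `y` at time `t`. -/
def correctedCurve (φ : ℝ → E n × E n → E n × E n) (x : E n) (t : ℝ) (y p : E n) (s : ℝ) : E n :=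
  (φ s (x, p)).1 + ((s - t / 2) / (t / 2)) • (y - (φ t (x, p)).1)

lemma exists_lift_correctedCurve (h : TonelliFlow n H φ) (hn : 1 ≤ n)
    (hc : NoConjugatePoints n φ) (x : E n) {t : ℝ} (ht : 0 < t) (y p : E n) :
    ∃ q, IsLift φ x (correctedCurve φ x t y p) (t / 2) t q ∧ q (t / 2) = p := by
  obtain ⟨R, K, -, hR, -, -, hK, -⟩ := h.exists_flow_bounds (H (x, p))
  have hd : ∀ s, HasDerivAt (correctedCurve φ x t y p)
      ((hamVF n H (φ s (x, p))).1 + (1 / (t / 2)) • (y - (φ t (x, p)).1)) s := by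
    intro s
    have h1 : HasDerivAt (fun s : ℝ => (s - t / 2) / (t / 2)) (1 / (t / 2)) s :=
      ((hasDerivAt_id s).sub_const _).div_const _
    have h2 : HasDerivAt (fun s => (φ s (x, p)).1) (hamVF n H (φ s (x, p))).1 s :=
      (h.flow.2 (x, p) s).fst
    exact h2.add (h1.smul_const (y - (φ t (x, p)).1))
  refine IsLift.exists_of_curve h hn hc x hd
    (M := K + ‖(1 / (t / 2)) • (y - (φ t (x, p)).1)‖) (fun s => ?_)
    (by linarith) (by linarith) ?_
  · refine (norm_add_le _ _).trans ?_
    gcongr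
    exact (norm_fst_le _).trans (hK _ (hR _ (h.energy s _).le))
  · simp [correctedCurve]

lemma base_surjective (h : TonelliFlow n H φ) (hn : 1 ≤ n) (hc : NoConjugatePoints n φ) (x : E n)
    {t : ℝ} (ht : 0 < t) (y : E n) : ∃ p, (φ t (x, p)).1 = y := by
  obtain ⟨q, hq, -⟩ := h.exists_lift_correctedCurve hn hc x ht y 0
  refine ⟨q t, ?_⟩
  rw [hq.2 t ⟨by linarith, le_rfl⟩, correctedCurve]
  have : (t - t / 2) / (t / 2) = 1 := by field_simp; ring
  rw [this, one_smul]
  abel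

lemma base_injective (h : TonelliFlow n H φ) (hn : 1 ≤ n) (hc : NoConjugatePoints n φ) (x : E n)
    {t : ℝ} (ht : 0 < t) {p₀ p₁ : E n} (hp : (φ t (x, p₀)).1 = (φ t (x, p₁)).1) : p₀ = p₁ := by
  set y := (φ t (x, p₁)).1 with hy
  set pt : ℝ → E n := fun τ => AffineMap.lineMap p₀ p₁ τ with hpt
  have hptc : Continuous pt := AffineMap.lineMap_continuous
  have hex : ∀ τ : unitInterval, ∃ q, IsLift φ x (correctedCurve φ x t y (pt τ)) (t / 2) t q ∧
      q (t / 2) = pt τ ∧ ((φ t (x, pt τ)).1 = y → q t = pt τ) := by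
    intro τ
    by_cases hτ : (φ t (x, pt τ)).1 = y
    · refine ⟨fun _ => pt τ, ⟨continuousOn_const, fun s _ => ?_⟩, rfl, fun _ => rfl⟩
      simp [correctedCurve, hτ]
    · obtain ⟨q, h1, h2⟩ := h.exists_lift_correctedCurve hn hc x ht y (pt τ)
      exact ⟨q, h1, h2, fun h3 => absurd h3 hτ⟩
  choose q hq hq0 hqe using hex
  set s : unitInterval → ℝ := fun σ => t / 2 + σ * (t / 2) with hs
  have hsc : Continuous s := by fun_prop
  have hsI : ∀ σ, s σ ∈ Set.Icc (t / 2) t := by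
    intro σ
    have h0 := σ.2.1
    have h1 := σ.2.2
    constructor <;> simp only [hs] <;> nlinarith
  have hs0 : ∀ σ, 0 < s σ := fun σ => lt_of_lt_of_le (by linarith) (hsI σ).1
  have hfc : Continuous fun w : unitInterval × unitInterval =>
      (s w.1, (x, correctedCurve φ x t y (pt w.2) (s w.1))) := by
    have h1 : Continuous fun w : unitInterval × unitInterval => s w.1 := hsc.comp continuous_fst
    have h2 : Continuous fun w : unitInterval × unitInterval => pt w.2 :=
      hptc.comp (continuous_subtype_val.comp continuous_snd)
    have h3 : Continuous fun w : unitInterval × unitInterval => (φ (s w.1) (x, pt w.2)).1 :=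
      continuous_fst.comp (h.continuous_flow.comp (h1.prodMk (continuous_const.prodMk h2)))
    have h4 : Continuous fun w : unitInterval × unitInterval => (φ t (x, pt w.2)).1 :=
      continuous_fst.comp (h.continuous_flow.comp
        (continuous_const.prodMk (continuous_const.prodMk h2)))
    refine h1.prodMk (continuous_const.prodMk ?_)
    exact h3.add (((h1.sub continuous_const).div_const _).smul (continuous_const.sub h4))
  have hg := (h.isLocalHomeomorph_baseMap_exp hc).continuous_lift
    (T2Space.isSeparatedMap _) ⟨_, hfc⟩
    (g := fun w => (Real.log (s w.1), (x, q w.2 (s w.1)))) ?_ ?_ ?_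
  · have hend : Continuous fun τ => q τ t := by
      have h1 : Continuous fun τ : unitInterval => q τ (s 1) :=
        continuous_snd.comp (continuous_snd.comp (hg.comp (Continuous.prodMk_right 1)))
      have : s 1 = t := by simp [hs]
      rwa [this] at h1
    have hloc : IsLocallyConstant fun τ => q τ t := by
      rw [IsLocallyConstant.iff_eventually_eq]
      intro τ₀
      have hyτ : ∀ τ, (φ t (x, q τ t)).1 = y := fun τ => by
        rw [(hq τ).2 t ⟨by linarith, le_rfl⟩, correctedCurve]
        have : (t - t / 2) / (t / 2) = 1 := by field_simp; ring
        rw [this, one_smul]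
        abel
      obtain ⟨ε, hε, l, -, -, hlu, -⟩ := h.local_branch hc x (continuous_const (y := y)) ht.ne'
        (hyτ τ₀)
      filter_upwards [hend.continuousAt.eventually (Metric.ball_mem_nhds _ hε)] with τ hτ
      rw [hlu t (Metric.mem_ball_self hε) _ hτ (hyτ τ),
        hlu t (Metric.mem_ball_self hε) _ (Metric.mem_ball_self hε) (hyτ τ₀)]
    have h01 := hloc.apply_eq_of_preconnectedSpace 0 1
    have e0 : q 0 t = p₀ := by
      rw [hqe 0] <;> simp [hpt, hp]
    have e1 : q 1 t = p₁ := by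
      rw [hqe 1] <;> simp [hpt, hy]
    simpa [e0, e1] using h01
  · funext w
    simp only [Function.comp, baseMap, Real.exp_log (hs0 _), ContinuousMap.coe_mk,
      (hq w.2).2 _ (hsI w.1)]
  · have : s 0 = t / 2 := by simp [hs]
    simp only [this, hq0]
    exact continuous_const.prodMk (continuous_const.prodMk (hptc.comp continuous_subtype_val))
  · intro τ
    refine (hsc.log fun σ => (hs0 σ).ne').prodMk (continuous_const.prodMk ?_)
    exact (hq τ).1.comp_continuous hsc hsI

end TonelliFlow

/-- A Tonelli flow without conjugate points. -/
structure FreeFlow (n : ℕ) (H : E n × E n → ℝ) (φ : ℝ → E n × E n → E n × E n) : Prop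
    extends TonelliFlow n H φ where
  one_le : 1 ≤ n
  ncp : NoConjugatePoints n φ

/-- The momentum at `x` of the orbit going from `x` to `y` in time `t`. -/
def mom (n : ℕ) (φ : ℝ → E n × E n → E n × E n) (t : ℝ) (x y : E n) : E n :=
  Classical.epsilon fun p => (φ t (x, p)).1 = y

/-- The momentum at `y` of the orbit going from `x` to `y` in time `t`. -/
def momF (n : ℕ) (φ : ℝ → E n × E n → E n × E n) (t : ℝ) (x y : E n) : E n :=
  (φ t (x, mom n φ t x y)).2

/-- The action of the orbit going from `x` to `y` in time `t`. -/
def pot (n : ℕ) (H : E n × E n → ℝ) (φ : ℝ → E n × E n → E n × E n) (t : ℝ) (x y : E n) : ℝ :=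
  act n H φ t (x, mom n φ t x y)

namespace FreeFlow

variable {n : ℕ} {H : E n × E n → ℝ} {φ : ℝ → E n × E n → E n × E n}

lemma mom_spec (h : FreeFlow n H φ) {t : ℝ} (ht : 0 < t) (x y : E n) :
    (φ t (x, mom n φ t x y)).1 = y :=
  Classical.epsilon_spec (p := fun p => (φ t (x, p)).1 = y)
    (h.base_surjective h.one_le h.ncp x ht y)

lemma mom_eq (h : FreeFlow n H φ) {t : ℝ} (ht : 0 < t) {x y p : E n} (hp : (φ t (x, p)).1 = y) :
    mom n φ t x y = p :=
  h.base_injective h.one_le h.ncp x ht ((h.mom_spec ht x y).trans hp.symm)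

lemma flow_mom (h : FreeFlow n H φ) {t : ℝ} (ht : 0 < t) (x y : E n) :
    φ t (x, mom n φ t x y) = (y, momF n φ t x y) := Prod.ext (h.mom_spec ht x y) rfl

lemma mom_flow (h : FreeFlow n H φ) {t : ℝ} (ht : 0 < t) (z : E n × E n) :
    mom n φ t z.1 (φ t z).1 = z.2 := h.mom_eq ht rfl

lemma momF_flow (h : FreeFlow n H φ) {t : ℝ} (ht : 0 < t) (z : E n × E n) :
    momF n φ t z.1 (φ t z).1 = (φ t z).2 := by rw [momF, h.mom_flow ht]

lemma pot_flow (h : FreeFlow n H φ) {t : ℝ} (ht : 0 < t) (z : E n × E n) :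
    pot n H φ t z.1 (φ t z).1 = act n H φ t z := by rw [pot, h.mom_flow ht]

lemma mom_translate (h : FreeFlow n H φ) {t : ℝ} (ht : 0 < t) (x y : E n) (m : Fin n → ℤ) :
    mom n φ t (x + intVec m) (y + intVec m) = mom n φ t x y :=
  h.mom_eq ht (by rw [h.flow_translate, h.mom_spec ht])

lemma momF_translate (h : FreeFlow n H φ) {t : ℝ} (ht : 0 < t) (x y : E n) (m : Fin n → ℤ) :
    momF n φ t (x + intVec m) (y + intVec m) = momF n φ t x y := by
  rw [momF, h.mom_translate ht, h.flow_translate, momF]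

lemma pot_translate (h : FreeFlow n H φ) {t : ℝ} (ht : 0 < t) (x y : E n) (m : Fin n → ℤ) :
    pot n H φ t (x + intVec m) (y + intVec m) = pot n H φ t x y := by
  rw [pot, h.mom_translate ht, h.act_translate, pot]

lemma hasStrictFDerivAt_mom (h : FreeFlow n H φ) (q : ℝ × (E n × E n)) (hq : 0 < q.1) :
    ∃ L : (ℝ × (E n × E n)) →L[ℝ] E n,
      HasStrictFDerivAt (fun q : ℝ × (E n × E n) => mom n φ q.1 q.2.1 q.2.2) L q := by
  obtain ⟨t, x, y⟩ := q
  simp only at hq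
  obtain ⟨L, hL⟩ := h.hasStrictFDerivAt_baseMap h.ncp (t, (x, mom n φ t x y)) hq.ne'
  have h1 := hL.to_local_left_inverse
    (g := fun q => (q.1, (q.2.1, mom n φ q.1 q.2.1 q.2.2))) ?_
  · rw [baseMap, h.mom_spec hq] at h1
    exact ⟨_, h1.snd.snd⟩
  · filter_upwards [continuous_fst.continuousAt.eventually (lt_mem_nhds hq)] with w hw
    have hw' : 0 < w.1 := hw
    simp only [baseMap]
    rw [h.mom_eq hw' rfl]

lemma continuousAt_mom (h : FreeFlow n H φ) (q : ℝ × (E n × E n)) (hq : 0 < q.1) :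
    ContinuousAt (fun q : ℝ × (E n × E n) => mom n φ q.1 q.2.1 q.2.2) q := by
  obtain ⟨L, hL⟩ := h.hasStrictFDerivAt_mom q hq
  exact hL.continuousAt

lemma tendsto_mom (h : FreeFlow n H φ) (q : ℝ × (E n × E n)) (hq : 0 < q.1) :
    Tendsto (fun q : ℝ × (E n × E n) => (q.1, (q.2.1, mom n φ q.1 q.2.1 q.2.2))) (𝓝 q)
      (𝓝 (q.1, (q.2.1, mom n φ q.1 q.2.1 q.2.2))) := by
  have h0 := h.continuousAt_mom q hq
  have h3 : Tendsto (fun q : ℝ × (E n × E n) => q.2.1) (𝓝 q) (𝓝 q.2.1) :=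
    (continuous_fst.comp continuous_snd).tendsto q
  exact (continuous_fst.tendsto q).prodMk_nhds (h3.prodMk_nhds h0)

lemma continuousAt_pot (h : FreeFlow n H φ) (q : ℝ × (E n × E n)) (hq : 0 < q.1) :
    ContinuousAt (fun q : ℝ × (E n × E n) => pot n H φ q.1 q.2.1 q.2.2) q := by
  have h2 : Tendsto (fun q : ℝ × (E n × E n) => act n H φ q.1 q.2) _ _ :=
    h.continuous_act.tendsto (q.1, (q.2.1, mom n φ q.1 q.2.1 q.2.2))
  have h3 := h2.comp (h.tendsto_mom q hq)
  exact h3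

lemma contDiff_mom (h : FreeFlow n H φ) {t : ℝ} (ht : 0 < t) :
    ContDiff ℝ 1 fun w : E n × E n => mom n φ t w.1 w.2 := by
  have hf : ContDiff ℝ 1 fun z : E n × E n => (z.1, (φ t z).1) :=
    contDiff_fst.prodMk (contDiff_fst.comp (h.flow_smooth t))
  have hmc : Continuous fun w : E n × E n => mom n φ t w.1 w.2 :=
    continuous_iff_continuousAt.2 fun w => (h.continuousAt_mom (t, w) ht).comp
      (f := fun w : E n × E n => (t, w)) (by fun_prop)
  let e : (E n × E n) ≃ₜ (E n × E n) :=
    { toFun := fun z => (z.1, (φ t z).1)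
      invFun := fun w => (w.1, mom n φ t w.1 w.2)
      left_inv := fun z => by simp [h.mom_flow ht]
      right_inv := fun w => by simp [h.mom_spec ht]
      continuous_toFun := hf.continuous
      continuous_invFun := continuous_fst.prodMk hmc }
  have hinj : ∀ z, ∃ L : (E n × E n) ≃L[ℝ] (E n × E n),
      HasFDerivAt e (L : (E n × E n) →L[ℝ] (E n × E n)) z := by
    intro z
    have h1 : HasFDerivAt (fun z : E n × E n => (z.1, (φ t z).1)) _ z :=
      hasFDerivAt_fst.prodMk (h.hasFDerivAt_flow t z).fst
    set D := (ContinuousLinearMap.fst ℝ (E n) (E n)).prod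
      ((ContinuousLinearMap.fst ℝ (E n) (E n)).comp (fderiv ℝ (φ t) z)) with hD
    have hi : Function.Injective (D : (E n × E n) →ₗ[ℝ] (E n × E n)) := by
      rw [injective_iff_map_eq_zero]
      rintro ⟨ξ, ζ⟩ hz
      have e : ((ξ, (fderiv ℝ (φ t) z (ξ, ζ)).1) : E n × E n) = 0 := hz
      simp only [Prod.mk_eq_zero] at e
      obtain ⟨rfl, e⟩ := e
      simp [h.ncp z t ht.ne' ζ e]
    refine ⟨(LinearEquiv.ofInjectiveEndo _ hi).toContinuousLinearEquiv, ?_⟩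
    convert! h1 using 1
  choose L hL using hinj
  have := e.contDiff_symm hL hf
  exact contDiff_snd.comp this

lemma contDiff_momF (h : FreeFlow n H φ) {t : ℝ} (ht : 0 < t) :
    ContDiff ℝ 1 fun w : E n × E n => momF n φ t w.1 w.2 :=
  contDiff_snd.comp ((h.flow_smooth t).comp (contDiff_fst.prodMk (h.contDiff_mom ht)))

lemma hasFDerivAt_pot (h : FreeFlow n H φ) {t : ℝ} (ht : 0 < t) (w : E n × E n) :
    HasFDerivAt (fun w : E n × E n => pot n H φ t w.1 w.2)
      ((dotB n (momF n φ t w.1 w.2)).comp (ContinuousLinearMap.snd ℝ (E n) (E n)) -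
        (dotB n (mom n φ t w.1 w.2)).comp (ContinuousLinearMap.fst ℝ (E n) (E n))) w := by
  have h1 : HasFDerivAt (fun w : E n × E n => mom n φ t w.1 w.2)
      (fderiv ℝ (fun w : E n × E n => mom n φ t w.1 w.2) w) w :=
    ((h.contDiff_mom ht).differentiable (by norm_num) w).hasFDerivAt
  set M := fderiv ℝ (fun w : E n × E n => mom n φ t w.1 w.2) w with hM
  have h2 : HasFDerivAt (fun w : E n × E n => (w.1, mom n φ t w.1 w.2))
    ((ContinuousLinearMap.fst ℝ (E n) (E n)).prod M) w := hasFDerivAt_fst.prodMk h1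
  have h3 := (h.hasFDerivAt_act t (w.1, mom n φ t w.1 w.2)).comp w h2
  have h4 : HasFDerivAt (fun w : E n × E n => (φ t (w.1, mom n φ t w.1 w.2)).1) _ w :=
    ((h.hasFDerivAt_flow t (w.1, mom n φ t w.1 w.2)).comp w h2).fst
  have h5 : (fun w : E n × E n => (φ t (w.1, mom n φ t w.1 w.2)).1) = Prod.snd :=
    funext fun w => h.mom_spec ht _ _
  rw [h5] at h4
  have h6 := h4.unique hasFDerivAt_snd
  refine h3.congr_fderiv (ContinuousLinearMap.ext fun ζ => ?_)
  have h7 : (fderiv ℝ (φ t) (w.1, mom n φ t w.1 w.2) (ζ.1, M ζ)).1 = ζ.2 :=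
    congrArg (fun L : (E n × E n) →L[ℝ] E n => L ζ) h6
  change actD n φ t (w.1, mom n φ t w.1 w.2) (ζ.1, M ζ) = _
  rw [actD_apply, h7]
  rfl

lemma hasFDerivAt_pot_right (h : FreeFlow n H φ) {t : ℝ} (ht : 0 < t) (x y : E n) :
    HasFDerivAt (pot n H φ t x) (dotB n (momF n φ t x y)) y := by
  have := (h.hasFDerivAt_pot ht (x, y)).comp y (hasFDerivAt_prodMk_right x y)
  refine this.congr_fderiv (ContinuousLinearMap.ext fun v => ?_)
  change dotP n (momF n φ t x y) v - dotP n (mom n φ t x y) 0 = _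
  rw [dotP_zero_right, sub_zero]
  rfl

lemma hasFDerivAt_pot_left (h : FreeFlow n H φ) {t : ℝ} (ht : 0 < t) (x y : E n) :
    HasFDerivAt (fun x => pot n H φ t x y) (-dotB n (mom n φ t x y)) x := by
  have := (h.hasFDerivAt_pot ht (x, y)).comp x (hasFDerivAt_prodMk_left (𝕜 := ℝ) x y)
  refine this.congr_fderiv (ContinuousLinearMap.ext fun v => ?_)
  change dotP n (momF n φ t x y) 0 - dotP n (mom n φ t x y) v = _
  rw [dotP_zero_right, zero_sub]
  rfl

/-- Triangle inequality for the potential. -/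
lemma pot_add_le (h : FreeFlow n H φ) {t s : ℝ} (ht : 0 < t) (hs : 0 < s) (x y z : E n) :
    pot n H φ (t + s) x z ≤ pot n H φ t x y + pot n H φ s y z := by
  set w := (y, mom n φ s y z) with hw
  set η : ℝ → E n := fun r => (φ (r - t) w).1 with hη
  have hηd : ∀ r, HasDerivAt η (gradP n H (φ (r - t) w).1 (φ (r - t) w).2) r := by
    intro r
    have h1 : HasDerivAt (fun r => φ (r - t) w) (hamVF n H (φ (r - t) w)) r :=
      (h.flow.2 w (r - t)).comp_sub_const r t
    exact h1.fst
  have hS : ∀ r, t ≤ r → HasDerivAt (fun r => pot n H φ r x (η r))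
      (dotP n (momF n φ r x (η r)) (gradP n H (φ (r - t) w).1 (φ (r - t) w).2) -
        H (x, mom n φ r x (η r))) r := by
    intro r hr
    have hr0 : 0 < r := ht.trans_le hr
    obtain ⟨L, hL⟩ := h.hasStrictFDerivAt_mom (r, (x, η r)) hr0
    have hcurve : HasDerivAt (fun s : ℝ => (s, (x, η s))) ((1 : ℝ), ((0 : E n), _)) r :=
      (hasDerivAt_id r).prodMk ((hasDerivAt_const r x).prodMk (hηd r))
    have h1 := hL.hasFDerivAt.comp_hasDerivAt r hcurve
    change HasDerivAt (fun s => mom n φ s x (η s)) _ r at h1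
    have h2 := h.hasDerivAt_act_curve (hasDerivAt_const r x) h1 (hηd r) (by
      filter_upwards [lt_mem_nhds hr0] with s hs
      exact h.mom_spec hs _ _)
    rw [dotP_zero_right, sub_zero] at h2
    exact h2
  have hB : ∀ r, HasDerivAt (fun r => act n H φ (r - t) w) (lagr n H (φ (r - t) w)) r :=
    fun r => (h.hasDerivAt_act w (r - t)).comp_sub_const r t
  obtain ⟨ξ, hξ, hξe⟩ := exists_hasDerivAt_eq_slope
    (fun r => act n H φ (r - t) w - pot n H φ r x (η r)) _ (by linarith : t < t + s)
    (fun r hr => ((hB r).fun_sub (hS r hr.1)).continuousAt.continuousWithinAt)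
    (fun r hr => (hB r).fun_sub (hS r hr.1.le))
  have hξ0 : 0 < ξ := ht.trans hξ.1
  have hf := h.fenchel (φ (ξ - t) w).1 (φ (ξ - t) w).2 (momF n φ ξ x (η ξ))
  have he : H (x, mom n φ ξ x (η ξ)) = H (η ξ, momF n φ ξ x (η ξ)) := by
    rw [← h.flow_mom hξ0, h.energy]
  rw [he] at hξe
  have e1 : η (t + s) = z := by
    simp only [hη, add_sub_cancel_left, hw]
    exact h.mom_spec hs _ _
  have e2 : η t = y := by simp [hη, h.flow_zero, hw]
  have e3 : act n H φ s w = pot n H φ s y z := rfl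
  simp only [add_sub_cancel_left, e1, sub_self, e2, TonelliFlow.act_zero, e3, Prod.mk.eta] at hξe hf
  have hnn : 0 ≤ (pot n H φ s y z - pot n H φ (t + s) x z - (0 - pot n H φ t x y)) / s := by
    rw [← hξe]
    have : η ξ = (φ (ξ - t) w).1 := rfl
    rw [this] at hf ⊢
    linarith
  have h9 := mul_nonneg hnn hs.le
  rw [div_mul_cancel₀ _ hs.ne'] at h9
  linarith

end FreeFlow

/-- The momentum at `x` of the orbit going from `x` to `x + m` in time `T`. -/
def loopMom (n : ℕ) (φ : ℝ → E n × E n → E n × E n) (T : ℝ) (m : Fin n → ℤ) (x : E n) : E n :=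
  mom n φ T x (x + intVec m)

/-- The action of loops of homology class `m` in time `T`. -/
def loopAct (n : ℕ) (H : E n × E n → ℝ) (φ : ℝ → E n × E n → E n × E n) (T : ℝ)
    (m : Fin n → ℤ) : ℝ :=
  pot n H φ T 0 (intVec m)

/-- A continuous periodic function attains its extrema. -/
lemma exists_forall_le_of_periodic {n : ℕ} {g : E n → ℝ} (hg : Continuous g)
    (hper : ∀ x (m : Fin n → ℤ), g (x + intVec m) = g x) : ∃ x, ∀ y, g x ≤ g y := by
  obtain ⟨x, -, hx⟩ := (isCompact_univ_pi fun _ : Fin n => isCompact_Icc (a := (0 : ℝ)) (b := 1)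
    ).exists_isMinOn ⟨0, fun i _ => by simp⟩ hg.continuousOn
  refine ⟨x, fun y => ?_⟩
  have h1 : y = (fun i => Int.fract (y i)) + intVec (fun i => ⌊y i⌋) := by
    funext i
    simp [intVec, Int.fract_add_floor]
  rw [h1, hper]
  exact hx fun i _ => ⟨Int.fract_nonneg _, (Int.fract_lt_one _).le⟩

namespace FreeFlow

variable {n : ℕ} {H : E n × E n → ℝ} {φ : ℝ → E n × E n → E n × E n}

lemma pot_lower (h : FreeFlow n H φ) (Q : ℝ) :
    ∃ M, 0 < M ∧ ∀ q : E n, ‖q‖ ≤ Q → ∀ t, 0 < t → ∀ x y,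
      dotP n q (y - x) - M * t ≤ pot n H φ t x y := by
  obtain ⟨M, hM0, hM⟩ := h.exists_H_bound Q
  refine ⟨M, hM0, fun q hq t ht x y => ?_⟩
  set z := (x, mom n φ t x y) with hz
  have hd : ∀ s, HasDerivAt (fun s => act n H φ s z - dotP n q (φ s z).1 + M * s)
      (lagr n H (φ s z) - dotP n q (gradP n H (φ s z).1 (φ s z).2) + M) s := by
    intro s
    have h1 : HasDerivAt (fun s => (φ s z).1) (gradP n H (φ s z).1 (φ s z).2) s :=
      (h.flow.2 z s).fst
    have h2 := hasDerivAt_dotP (hasDerivAt_const s q) h1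
    rw [dotP_zero_left, add_zero] at h2
    have h3 := (hasDerivAt_id s).const_mul M
    rw [mul_one] at h3
    exact ((h.hasDerivAt_act z s).sub h2).add h3
  have hmono := monotone_of_deriv_nonneg (fun s => (hd s).differentiableAt) fun s => by
    rw [(hd s).deriv]
    have h1 := h.fenchel (φ s z).1 (φ s z).2 q
    have h2 := (abs_le.1 (hM ((φ s z).1, q) hq)).2
    rw [Prod.mk.eta] at h1
    linarith
  have := hmono ht.le
  have e : (φ t z).1 = y := h.mom_spec ht x y
  have e' : act n H φ t z = pot n H φ t x y := rfl
  simp only [TonelliFlow.act_zero, h.flow_zero, e, e'] at this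
  rw [dotP_sub_right]
  have e2 : z.1 = x := rfl
  rw [e2] at this
  linarith

lemma pot_iterate_le (h : FreeFlow n H φ) {t : ℝ} (ht : 0 < t) {C : ℝ} (v : E n)
    (hC : ∀ x, pot n H φ t x (x + v) ≤ C) (x : E n) (N : ℕ) :
    pot n H φ ((N + 1 : ℕ) * t) x (x + ((N + 1 : ℕ) : ℝ) • v) ≤ (N + 1 : ℕ) * C := by
  induction N with
  | zero => simpa using hC x
  | succ N ih =>
    have h1 := h.pot_add_le (t := (N + 1 : ℕ) * t) (by positivity) ht x
      (x + ((N + 1 : ℕ) : ℝ) • v) (x + ((N + 1 : ℕ) : ℝ) • v + v)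
    have h2 := hC (x + ((N + 1 : ℕ) : ℝ) • v)
    have e1 : ((N + 1 + 1 : ℕ) : ℝ) * t = (N + 1 : ℕ) * t + t := by push_cast; ring
    have e2 : x + ((N + 1 + 1 : ℕ) : ℝ) • v = x + ((N + 1 : ℕ) : ℝ) • v + v := by
      push_cast; module
    rw [e1, e2]
    push_cast at *
    linarith

lemma exists_floor_bounds {T : ℝ} (hT : 1 ≤ T) :
    ∃ N : ℕ, 1 ≤ T / (N + 1 : ℕ) ∧ T / (N + 1 : ℕ) ≤ 2 ∧ ((N + 1 : ℕ) : ℝ) ≤ T := by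
  have hf : 1 ≤ ⌊T⌋₊ := Nat.le_floor (by simpa using hT)
  refine ⟨⌊T⌋₊ - 1, ?_⟩
  rw [Nat.sub_add_cancel hf]
  have h1 : (⌊T⌋₊ : ℝ) ≤ T := Nat.floor_le (by linarith)
  have h2 : T < ⌊T⌋₊ + 1 := Nat.lt_floor_add_one T
  have h3 : (1 : ℝ) ≤ ⌊T⌋₊ := by exact_mod_cast hf
  refine ⟨?_, ?_, h1⟩
  · rwa [le_div_iff₀ (by linarith), one_mul]
  · rw [div_le_iff₀ (by linarith)]; linarith

lemma pot_upper (h : FreeFlow n H φ) (V : ℝ) :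
    ∃ C, 0 < C ∧ ∀ T, 1 ≤ T → ∀ x y : E n, ‖y - x‖ ≤ V * T → pot n H φ T x y ≤ C * T := by
  have hg : ContinuousOn (Function.uncurry fun (x : E n) (w : ℝ × E n) =>
      pot n H φ w.1 x (x + w.2))
      (Set.univ ×ˢ (Set.Icc (1 : ℝ) 2 ×ˢ Metric.closedBall (0 : E n) (2 * |V|))) := by
    rintro ⟨x, w⟩ ⟨-, hw⟩
    have h0 : (0 : ℝ) < w.1 := lt_of_lt_of_le one_pos hw.1.1
    have h1 := h.continuousAt_pot (w.1, (x, x + w.2)) h0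
    have h2 : Continuous fun q : E n × (ℝ × E n) => (q.2.1, (q.1, q.1 + q.2.2)) := by fun_prop
    have h3 := ContinuousAt.comp (f := fun q : E n × (ℝ × E n) => (q.2.1, (q.1, q.1 + q.2.2)))
      (x := (x, w)) h1 h2.continuousAt
    exact h3.continuousWithinAt
  have hper : ∀ (x : E n) (m : Fin n → ℤ),
      ∀ w ∈ Set.Icc (1 : ℝ) 2 ×ˢ Metric.closedBall (0 : E n) (2 * |V|),
      pot n H φ w.1 (x + intVec m) (x + intVec m + w.2) = pot n H φ w.1 x (x + w.2) := by
    intro x m w hw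
    have h0 : (0 : ℝ) < w.1 := by
      have : (1 : ℝ) ≤ w.1 := hw.1.1
      linarith
    rw [show x + intVec m + w.2 = x + w.2 + intVec m by abel, h.pot_translate h0]
  obtain ⟨C, hC0, hC⟩ := exists_bound_of_periodic
    (isCompact_Icc.prod (isCompact_closedBall _ _)) hg hper
  refine ⟨C, hC0, fun T hT x y hxy => ?_⟩
  obtain ⟨N, hN1, hN2, hN3⟩ := exists_floor_bounds hT
  set τ := T / (N + 1 : ℕ) with hτ
  have hN0 : (0 : ℝ) < (N + 1 : ℕ) := by positivity
  have e1 : ((N + 1 : ℕ) : ℝ) * τ = T := by rw [hτ]; field_simp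
  set v : E n := (1 / ((N + 1 : ℕ) : ℝ)) • (y - x) with hv
  have e2 : x + ((N + 1 : ℕ) : ℝ) • v = y := by
    rw [hv, smul_smul, mul_one_div_cancel hN0.ne', one_smul]; abel
  have hvn : ‖v‖ ≤ 2 * |V| := by
    rw [hv, norm_smul, Real.norm_of_nonneg (by positivity), one_div, inv_mul_le_iff₀ hN0]
    refine hxy.trans ?_
    rw [← e1]
    have h1 : V * ((N + 1 : ℕ) * τ) ≤ |V| * ((N + 1 : ℕ) * τ) := by
      gcongr
      exact le_abs_self V
    have h2 : |V| * ((N + 1 : ℕ) * τ) ≤ |V| * ((N + 1 : ℕ) * 2) := by gcongr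
    linarith
  have := h.pot_iterate_le (by linarith : 0 < τ) v (C := C) (fun x => (le_abs_self _).trans
    (hC x (τ, v) ⟨⟨hN1, hN2⟩, by simpa using hvn⟩)) x N
  rw [e1, e2] at this
  refine this.trans ?_
  rw [← e1]
  nlinarith [mul_pos hC0 hN0]

/-! ### Loops -/

lemma hasFDerivAt_pot_loop (h : FreeFlow n H φ) {T : ℝ} (hT : 0 < T) (v x : E n) :
    HasFDerivAt (fun x => pot n H φ T x (x + v))
      (dotB n (momF n φ T x (x + v) - mom n φ T x (x + v))) x := by
  have h1 : HasFDerivAt (fun x : E n => (x, x + v))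
      ((ContinuousLinearMap.id ℝ (E n)).prod (ContinuousLinearMap.id ℝ (E n))) x :=
    (hasFDerivAt_id x).prodMk ((hasFDerivAt_id x).add_const v)
  have h2 := (h.hasFDerivAt_pot hT (x, x + v)).comp x h1
  refine h2.congr_fderiv (ContinuousLinearMap.ext fun ξ => ?_)
  change dotP n _ ξ - dotP n _ ξ = dotP n _ ξ
  rw [dotP_sub_left]

lemma loop_iterate (h : FreeFlow n H φ) {T : ℝ} {m : Fin n → ℤ} {x p : E n}
    (hp : φ T (x, p) = (x + intVec m, p)) (N : ℕ) :
    φ (N * T) (x, p) = (x + intVec (N • m), p) ∧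
      act n H φ (N * T) (x, p) = N * act n H φ T (x, p) := by
  induction N with
  | zero => simp [h.flow_zero]
  | succ N ih =>
    have e : ((N + 1 : ℕ) : ℝ) * T = T + N * T := by push_cast; ring
    constructor
    · rw [e, h.flow_add, ih.1, h.flow_translate, hp, succ_nsmul, intVec_add]
      simp only [Prod.mk.injEq, and_true]
      abel
    · rw [e, h.act_add, ih.1, ih.2, h.act_translate]
      push_cast; ring

lemma pot_iterate_of_crit (h : FreeFlow n H φ) {T : ℝ} (hT : 0 < T) {m : Fin n → ℤ} {x : E n}
    (hx : momF n φ T x (x + intVec m) = mom n φ T x (x + intVec m)) {N : ℕ} (hN : 0 < N) :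
    pot n H φ (N * T) x (x + intVec (N • m)) = N * pot n H φ T x (x + intVec m) := by
  have hp : φ T (x, mom n φ T x (x + intVec m)) = (x + intVec m, mom n φ T x (x + intVec m)) := by
    rw [h.flow_mom hT, hx]
  obtain ⟨h1, h2⟩ := h.loop_iterate hp N
  have hNT : 0 < (N : ℝ) * T := by positivity
  have h3 := h.pot_flow hNT (x, mom n φ T x (x + intVec m))
  rw [h1] at h3
  rw [h3, h2, pot]

lemma momF_eq_mom_of_extr (h : FreeFlow n H φ) {T : ℝ} (hT : 0 < T) {v x : E n}
    (hx : IsLocalExtr (fun x => pot n H φ T x (x + v)) x) :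
    momF n φ T x (x + v) = mom n φ T x (x + v) := by
  have h1 := hx.hasFDerivAt_eq_zero (h.hasFDerivAt_pot_loop hT v x)
  rw [← sub_eq_zero]
  refine dotP_left_injective fun w => ?_
  rw [dotP_zero_left]
  exact congrArg (fun L : E n →L[ℝ] ℝ => L w) h1

lemma pot_loop_le (h : FreeFlow n H φ) {T : ℝ} (hT : 0 < T) (m : Fin n → ℤ) (x y : E n) :
    pot n H φ T x (x + intVec m) ≤ pot n H φ T y (y + intVec m) := by
  set g := fun x => pot n H φ T x (x + intVec m) with hg
  have hgc : Continuous g :=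
    continuous_iff_continuousAt.2 fun x => (h.hasFDerivAt_pot_loop hT _ x).continuousAt
  have hgp : ∀ x (k : Fin n → ℤ), g (x + intVec k) = g x := fun x k => by
    simp only [hg]
    rw [add_right_comm, h.pot_translate hT]
  obtain ⟨b, hb⟩ := exists_forall_le_of_periodic hgc hgp
  obtain ⟨a, ha⟩ := exists_forall_le_of_periodic (g := fun x => -g x) hgc.neg
    (fun x k => by rw [hgp])
  suffices hab : g a ≤ g b by
    have := ha x
    linarith [hb y]
  have hb' := h.momF_eq_mom_of_extr hT (v := intVec m) (x := b)
    (Or.inl (Eventually.of_forall hb))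
  have ha' := h.momF_eq_mom_of_extr hT (v := intVec m) (x := a)
    (Or.inr (Eventually.of_forall fun y => neg_le_neg_iff.1 (ha y)))
  -- compare long loops at `a` and `b`
  set C := pot n H φ T a b + pot n H φ T b (a + intVec (2 • m)) with hC
  have key : ∀ N : ℕ, 0 < N → (N + 2 : ℕ) * g a ≤ C + N * g b := by
    intro N hN
    have hN' : (0 : ℝ) < N := by exact_mod_cast hN
    have h1 := h.pot_iterate_of_crit hT ha' (N := N + 2) (by omega)
    have h2 := h.pot_iterate_of_crit hT hb' hN
    have h3 := h.pot_add_le (t := T) (s := N * T) hT (by positivity) a b (b + intVec (N • m))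
    have h4 := h.pot_add_le (t := T + N * T) (s := T) (by positivity) hT a (b + intVec (N • m))
      (a + intVec ((N + 2) • m))
    have e1 : T + N * T + T = ((N + 2 : ℕ) : ℝ) * T := by push_cast; ring
    have e2 : a + intVec ((N + 2) • m) = (a + intVec (2 • m)) + intVec (N • m) := by
      rw [add_comm N 2, add_nsmul, intVec_add]; abel
    rw [e1, h1] at h4
    rw [e2, h.pot_translate hT] at h4
    simp only [hg]
    linarith
  by_contra hlt
  push Not at hlt
  obtain ⟨N, hN⟩ := exists_nat_gt ((C - 2 * g a) / (g a - g b))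
  rw [div_lt_iff₀ (by linarith)] at hN
  have h1 := key (N + 1) (by omega)
  push_cast at h1
  linarith

lemma pot_loop (h : FreeFlow n H φ) {T : ℝ} (hT : 0 < T) (m : Fin n → ℤ) (x : E n) :
    pot n H φ T x (x + intVec m) = loopAct n H φ T m := by
  have := le_antisymm (h.pot_loop_le hT m x 0) (h.pot_loop_le hT m 0 x)
  rwa [zero_add] at this

lemma momF_loop (h : FreeFlow n H φ) {T : ℝ} (hT : 0 < T) (m : Fin n → ℤ) (x : E n) :
    momF n φ T x (x + intVec m) = loopMom n φ T m x :=
  h.momF_eq_mom_of_extr hT (Or.inl (Eventually.of_forall fun y => h.pot_loop_le hT m x y))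

lemma flow_loop (h : FreeFlow n H φ) {T : ℝ} (hT : 0 < T) (m : Fin n → ℤ) (x : E n) :
    φ T (x, loopMom n φ T m x) = (x + intVec m, loopMom n φ T m x) := by
  rw [← h.momF_loop hT, momF_loop h hT, loopMom, h.flow_mom hT]
  rw [h.momF_loop hT, loopMom]

lemma loopMom_invariant (h : FreeFlow n H φ) {T : ℝ} (hT : 0 < T) (m : Fin n → ℤ) (s : ℝ)
    (x : E n) : (φ s (x, loopMom n φ T m x)).2 =
      loopMom n φ T m (φ s (x, loopMom n φ T m x)).1 := by
  refine (h.mom_eq hT ?_).symm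
  rw [Prod.mk.eta, ← h.flow_add, add_comm, h.flow_add, h.flow_loop hT, h.flow_translate]

lemma loopMom_periodic (h : FreeFlow n H φ) {T : ℝ} (hT : 0 < T) (m k : Fin n → ℤ) (x : E n) :
    loopMom n φ T m (x + intVec k) = loopMom n φ T m x := by
  rw [loopMom, add_right_comm, h.mom_translate hT, loopMom]

lemma act_loop (h : FreeFlow n H φ) {T : ℝ} (hT : 0 < T) (m : Fin n → ℤ) (x : E n) :
    act n H φ T (x, loopMom n φ T m x) = loopAct n H φ T m := by
  rw [← h.pot_loop hT m x]; rfl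

lemma loopAct_nsmul (h : FreeFlow n H φ) {T : ℝ} (hT : 0 < T) (m : Fin n → ℤ) {N : ℕ}
    (hN : 0 < N) : loopAct n H φ (N * T) (N • m) = N * loopAct n H φ T m := by
  have hNT : 0 < (N : ℝ) * T := by positivity
  rw [← h.pot_loop hNT _ 0, ← h.pot_loop hT _ 0]
  exact h.pot_iterate_of_crit hT (h.momF_loop hT m 0) hN

lemma loopAct_add_le (h : FreeFlow n H φ) {T T' : ℝ} (hT : 0 < T) (hT' : 0 < T')
    (m m' : Fin n → ℤ) :
    loopAct n H φ (T + T') (m + m') ≤ loopAct n H φ T m + loopAct n H φ T' m' := by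
  have h1 := h.pot_add_le hT hT' 0 (intVec m) (intVec m + intVec m')
  rw [h.pot_loop hT'] at h1
  rw [loopAct, intVec_add]
  exact h1

end FreeFlow

/-- The effective Hamiltonian (Mañé critical value) of the cohomology class `c`. -/
def mane (n : ℕ) (H : E n × E n → ℝ) (φ : ℝ → E n × E n → E n × E n) (c : E n) : ℝ :=
  ⨆ q : {t : ℝ // 0 < t} × (Fin n → ℤ), (dotP n c (intVec q.2) - loopAct n H φ q.1 q.2) / q.1

/-- The excess of the loops of period `T` and homology class `m` over the minimal value permitted
by the critical value of `c`. -/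
def excess (n : ℕ) (H : E n × E n → ℝ) (φ : ℝ → E n × E n → E n × E n) (c : E n) (T : ℝ)
    (m : Fin n → ℤ) : ℝ :=
  loopAct n H φ T m - dotP n c (intVec m) + mane n H φ c * T

lemma norm_sub_intVec_round {n : ℕ} (x : E n) : ‖x - intVec fun i => round (x i)‖ ≤ 1 := by
  refine (pi_norm_le_iff_of_nonneg zero_le_one).2 fun i => ?_
  have := abs_sub_round (x i)
  simp only [Pi.sub_apply, intVec, Real.norm_eq_abs]
  linarith

namespace FreeFlow

variable {n : ℕ} {H : E n × E n → ℝ} {φ : ℝ → E n × E n → E n × E n}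

lemma loopAct_lower (h : FreeFlow n H φ) (Q : ℝ) :
    ∃ M, 0 < M ∧ ∀ q : E n, ‖q‖ ≤ Q → ∀ t, 0 < t → ∀ m : Fin n → ℤ,
      dotP n q (intVec m) - M * t ≤ loopAct n H φ t m := by
  obtain ⟨M, hM, hM'⟩ := h.pot_lower Q
  refine ⟨M, hM, fun q hq t ht m => ?_⟩
  have := hM' q hq t ht 0 (intVec m)
  rwa [sub_zero] at this

lemma bddAbove_mane (h : FreeFlow n H φ) (c : E n) :
    BddAbove (Set.range fun q : {t : ℝ // 0 < t} × (Fin n → ℤ) =>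
      (dotP n c (intVec q.2) - loopAct n H φ q.1 q.2) / q.1) := by
  obtain ⟨M, hM, hM'⟩ := h.loopAct_lower ‖c‖
  refine ⟨M, ?_⟩
  rintro _ ⟨⟨⟨t, ht⟩, m⟩, rfl⟩
  have := hM' c le_rfl t ht m
  simp only
  rw [div_le_iff₀ ht]
  linarith

lemma excess_nonneg (h : FreeFlow n H φ) (c : E n) {T : ℝ} (hT : 0 < T) (m : Fin n → ℤ) :
    0 ≤ excess n H φ c T m := by
  have h1 : (dotP n c (intVec m) - loopAct n H φ T m) / T ≤ mane n H φ c :=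
    le_ciSup (h.bddAbove_mane c) (⟨T, hT⟩, m)
  rw [div_le_iff₀ hT] at h1
  rw [excess]
  linarith

lemma mane_le_of_forall {c : E n} {A : ℝ}
    (hA : ∀ T, 0 < T → ∀ m : Fin n → ℤ, dotP n c (intVec m) - loopAct n H φ T m ≤ A * T) :
    mane n H φ c ≤ A := by
  have : Nonempty ({t : ℝ // 0 < t} × (Fin n → ℤ)) := ⟨(⟨1, one_pos⟩, 0)⟩
  refine ciSup_le fun q => ?_
  rw [div_le_iff₀ q.1.2]
  exact hA _ q.1.2 _

lemma exists_excess_lt_mul (c : E n) {ε : ℝ} (hε : 0 < ε) :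
    ∃ T, 0 < T ∧ ∃ m : Fin n → ℤ, excess n H φ c T m < ε * T := by
  by_contra! hcon
  have : mane n H φ c ≤ mane n H φ c - ε := mane_le_of_forall fun T hT m => by
    have := hcon T hT m
    rw [excess] at this
    linarith
  linarith

lemma excess_add_le (h : FreeFlow n H φ) (c : E n) {T T' : ℝ} (hT : 0 < T) (hT' : 0 < T')
    (m m' : Fin n → ℤ) :
    excess n H φ c (T + T') (m + m') ≤ excess n H φ c T m + excess n H φ c T' m' := by
  have := h.loopAct_add_le hT hT' m m'
  simp only [excess, intVec_add, dotP_add_right]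
  linarith

lemma excess_nsmul (h : FreeFlow n H φ) (c : E n) {T : ℝ} (hT : 0 < T) (m : Fin n → ℤ) {N : ℕ}
    (hN : 0 < N) : excess n H φ c (N * T) (N • m) = N * excess n H φ c T m := by
  simp only [excess, h.loopAct_nsmul hT m hN, intVec_smul, ← Nat.cast_smul_eq_nsmul ℝ N,
    dotP_smul_right]
  ring

lemma excess_upper (h : FreeFlow n H φ) (c : E n) :
    ∃ C, 0 < C ∧ ∀ T, 1 ≤ T → ∀ m : Fin n → ℤ, ‖intVec m‖ ≤ T → excess n H φ c T m ≤ C * T := by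
  obtain ⟨C, hC, hC'⟩ := h.pot_upper 1
  refine ⟨C + n * ‖c‖ + |mane n H φ c|, by positivity, fun T hT m hm => ?_⟩
  have h1 := hC' T hT 0 (intVec m) (by simpa using hm)
  have h2 := abs_dotP_le n c (intVec m)
  have h3 : n * ‖c‖ * ‖intVec m‖ ≤ n * ‖c‖ * T := by gcongr
  have h4 : mane n H φ c * T ≤ |mane n H φ c| * T := by
    gcongr; exact le_abs_self _
  have h5 := neg_abs_le (dotP n c (intVec m))
  rw [excess, loopAct]
  linarith

/-- Simultaneous Diophantine approximation. -/
lemma exists_near_intVec (n : ℕ) {δ : ℝ} (hδ : 0 < δ) :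
    ∃ M : ℕ, ∀ v : E n, ∃ j : ℕ, 1 ≤ j ∧ j ≤ M ∧ ∃ r : Fin n → ℤ,
      ‖(j : ℝ) • v - intVec r‖ ≤ δ := by
  obtain ⟨K, hK⟩ := exists_nat_gt (1 / δ)
  have hK0 : (0 : ℝ) < K := (by positivity : (0 : ℝ) < 1 / δ).trans hK
  have hKn : 0 < K := by exact_mod_cast hK0
  have hfl : ∀ a : ℝ, ⌊K * Int.fract a⌋₊ < K := fun a => by
    rw [Nat.floor_lt (by positivity)]
    nlinarith [Int.fract_lt_one a]
  refine ⟨K ^ n, fun v => ?_⟩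
  obtain ⟨a, b, hab, he⟩ := Fintype.exists_ne_map_eq_of_card_lt
    (fun (j : Fin (K ^ n + 1)) (i : Fin n) =>
      (⟨⌊K * Int.fract ((j : ℝ) * v i)⌋₊, hfl _⟩ : Fin K)) (by simp)
  wlog hlt : a < b generalizing a b
  · exact this b a hab.symm he.symm (lt_of_le_of_ne (not_lt.1 hlt) hab.symm)
  have hlt' : (a : ℕ) < b := hlt
  refine ⟨b - a, by omega, by omega, fun i => ⌊(b : ℝ) * v i⌋ - ⌊(a : ℝ) * v i⌋, ?_⟩
  refine (pi_norm_le_iff_of_nonneg hδ.le).2 fun i => ?_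
  have h1 := congrFun he i
  simp only [Fin.mk.injEq] at h1
  have ha := Nat.floor_le (a := K * Int.fract ((a : ℝ) * v i)) (by positivity)
  have hb := Nat.floor_le (a := K * Int.fract ((b : ℝ) * v i)) (by positivity)
  have ha' := Nat.lt_floor_add_one (K * Int.fract ((a : ℝ) * v i))
  have hb' := Nat.lt_floor_add_one (K * Int.fract ((b : ℝ) * v i))
  rw [h1] at ha ha'
  have e1 := Int.self_sub_floor ((a : ℝ) * v i)
  have e2 := Int.self_sub_floor ((b : ℝ) * v i)
  have e3 : ((b - a : ℕ) : ℝ) = b - a := by push_cast [hlt'.le]; ring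
  have e4 : (((b - a : ℕ) : ℝ) • v - intVec fun i => ⌊(b : ℝ) * v i⌋ - ⌊(a : ℝ) * v i⌋) i
      = Int.fract ((b : ℝ) * v i) - Int.fract ((a : ℝ) * v i) := by
    simp only [Pi.sub_apply, Pi.smul_apply, smul_eq_mul, intVec, e3]
    push_cast
    linarith
  rw [e4, Real.norm_eq_abs]
  have h5 : K * |Int.fract ((b : ℝ) * v i) - Int.fract ((a : ℝ) * v i)| ≤ 1 := by
    have e5 := abs_mul (K : ℝ) (Int.fract ((b : ℝ) * v i) - Int.fract ((a : ℝ) * v i))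
    rw [abs_of_pos hK0] at e5
    rw [← e5, abs_le]
    constructor <;> linarith
  have h6 : 1 ≤ K * δ := by
    rw [div_lt_iff₀ hδ] at hK; exact hK.le
  exact le_of_mul_le_mul_left (h5.trans h6) hK0

/-- There are loops of arbitrarily small excess. -/
lemma exists_excess_lt (h : FreeFlow n H φ) (c : E n) {ε : ℝ} (hε : 0 < ε) :
    ∃ T, 2 ≤ T ∧ ∃ m : Fin n → ℤ, excess n H φ c T m < ε := by
  obtain ⟨C, hC, hC'⟩ := h.excess_upper c
  set δ := ε / (4 * C) with hδ
  have hδ0 : 0 < δ := by positivity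
  obtain ⟨M, hM⟩ := exists_near_intVec n hδ0
  set ε' := ε / (8 * (M + 1)) with hε'
  have hε'0 : 0 < ε' := by positivity
  obtain ⟨T₁, hT₁, r₁, h₁⟩ := exists_excess_lt_mul (n := n) (H := H) (φ := φ) c hε'0
  obtain ⟨N, hN⟩ := exists_nat_gt (max ((1 / δ + 1) / T₁) (1 / T₁))
  have hN' : 1 / δ + 1 < N * T₁ := by
    rw [← div_lt_iff₀ hT₁]; exact (le_max_left _ _).trans_lt hN
  have hδ1 : 0 < 1 / δ := by positivity
  have hN0 : (0 : ℝ) < N := by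
    by_contra hcon
    nlinarith
  have hNn : 0 < N := by exact_mod_cast hN0
  set T₀ := N * T₁ with hT₀
  set r₀ := N • r₁ with hr₀
  have h₀ : excess n H φ c T₀ r₀ ≤ ε' * T₀ := by
    rw [hT₀, hr₀, h.excess_nsmul c hT₁ r₁ hNn]
    nlinarith
  set q := ⌊T₀⌋₊ with hq
  have hq1 : (q : ℝ) ≤ T₀ := Nat.floor_le (by linarith)
  have hq2 : T₀ < q + 1 := Nat.lt_floor_add_one T₀
  have hqn : 1 ≤ q := Nat.le_floor (by push_cast; linarith)
  have hq3 : (1 : ℝ) ≤ q := by exact_mod_cast hqn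
  have hq0 : (0 : ℝ) < q := by linarith
  have hqδ : 1 ≤ q * δ := by
    have : 1 / δ ≤ q := by linarith
    rwa [div_le_iff₀ hδ0] at this
  obtain ⟨j, hj1, hj2, r, hr⟩ := hM ((2 / q : ℝ) • intVec r₀)
  have hj1' : (1 : ℝ) ≤ j := by exact_mod_cast hj1
  have hj2' : (j : ℝ) ≤ M := by exact_mod_cast hj2
  set s : Fin n → ℤ := q • r - (2 * j) • r₀ with hs
  have hs' : intVec (q • r) = intVec s + intVec ((2 * j) • r₀) := by
    rw [← intVec_add, hs, sub_add_cancel]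
  have hsn : ‖intVec s‖ ≤ q * δ := by
    have e : intVec s = -((q : ℝ) • ((j : ℝ) • ((2 / q : ℝ) • intVec r₀) - intVec r)) := by
      rw [eq_sub_of_add_eq hs'.symm, intVec_smul, intVec_smul, ← Nat.cast_smul_eq_nsmul ℝ,
        ← Nat.cast_smul_eq_nsmul ℝ, smul_sub, smul_smul, smul_smul, neg_sub]
      congr 2
      push_cast
      field_simp
    rw [e, norm_neg, norm_smul, Real.norm_of_nonneg hq0.le]
    gcongr
  have hT1 : 2 * (j : ℝ) ≤ 2 * j * T₀ / q := by
    rw [le_div_iff₀ hq0]; nlinarith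
  refine ⟨2 * j * T₀ / q + δ, by linarith, r, ?_⟩
  have hT0 : 0 < T₀ := by linarith
  have k1 := h.excess_nsmul c (T := 2 * j * T₀ / q + δ) (by linarith) r hqn
  have e1 : (q : ℝ) * (2 * j * T₀ / q + δ) = (2 * j : ℕ) * T₀ + q * δ := by
    push_cast; field_simp
  have e2 : q • r = (2 * j) • r₀ + s := by rw [hs]; abel
  rw [e1, e2] at k1
  have k2 := h.excess_add_le c (T := (2 * j : ℕ) * T₀) (T' := q * δ)
    (by push_cast; positivity) (by positivity) ((2 * j) • r₀) s
  rw [h.excess_nsmul c hT0 r₀ (by omega)] at k2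
  have k3 := hC' _ hqδ s hsn
  push_cast at k1 k2
  have k4 : q * excess n H φ c (2 * j * T₀ / q + δ) r ≤ q * (4 * M * ε' + C * δ) := by
    have : 2 * (j : ℝ) * excess n H φ c T₀ r₀ ≤ 2 * M * (ε' * (2 * q)) := by
      have : T₀ ≤ 2 * q := by linarith
      calc 2 * (j : ℝ) * excess n H φ c T₀ r₀ ≤ 2 * j * (ε' * T₀) := by gcongr
        _ ≤ _ := by gcongr
    nlinarith
  have k5 := le_of_mul_le_mul_left k4 hq0
  have k6 : C * δ = ε / 4 := by rw [hδ]; field_simp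
  have k7 : 4 * M * ε' ≤ ε / 2 := by
    have : 4 * (M + 1) * ε' = ε / 2 := by rw [hε']; field_simp; norm_num
    nlinarith
  linarith

/-- Loops of bounded excess have bounded rotation vector. -/
lemma norm_intVec_le_of_excess (h : FreeFlow n H φ) (Q : ℝ) :
    ∃ V, 0 < V ∧ ∀ c : E n, ‖c‖ ≤ Q → |mane n H φ c| ≤ V ∧
      ∀ T, 0 < T → ∀ m : Fin n → ℤ, excess n H φ c T m ≤ T → ‖intVec m‖ ≤ V * T := by
  obtain ⟨M, hM, hM'⟩ := h.loopAct_lower (Q + 1)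
  set L := loopAct n H φ 1 0 with hL
  have hα : ∀ c : E n, ‖c‖ ≤ Q → |mane n H φ c| ≤ M + |L| := fun c hc => by
    rw [abs_le]
    constructor
    · have := h.excess_nonneg c one_pos 0
      rw [excess, ← hL, intVec_zero, dotP_zero_right] at this
      linarith [le_abs_self L]
    · refine mane_le_of_forall fun T hT m => ?_
      have := hM' c (by linarith) T hT m
      nlinarith [abs_nonneg L]
  refine ⟨1 + M + (M + |L|), by positivity, fun c hc => ⟨(hα c hc).trans (by linarith),
    fun T hT m hm => ?_⟩⟩
  obtain ⟨e, he1, he2⟩ := exists_norm_eq_dotP h.one_le (intVec m)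
  have h1 := hM' (c + e) ((norm_add_le _ _).trans (by linarith)) T hT m
  rw [dotP_add_left, dotP_comm n e, he2] at h1
  rw [excess] at hm
  have h2 := neg_abs_le (mane n H φ c)
  have h3 := hα c hc
  nlinarith

/-- Uniform continuity of the critical value on balls. -/
lemma mane_lipschitz (h : FreeFlow n H φ) (Q : ℝ) :
    ∃ V, 0 < V ∧ ∀ c c' : E n, ‖c‖ ≤ Q → ‖c'‖ ≤ Q →
      mane n H φ c' ≤ mane n H φ c + V * ‖c' - c‖ := by
  obtain ⟨V, hV, hV'⟩ := h.norm_intVec_le_of_excess Q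
  have hn : (0 : ℝ) < n := by exact_mod_cast h.one_le
  refine ⟨n * V, by positivity, fun c c' hc hc' => ?_⟩
  refine le_of_forall_pos_le_add fun ε hε => ?_
  obtain ⟨T, hT, m, hm⟩ := exists_excess_lt_mul (n := n) (H := H) (φ := φ) c' (lt_min hε one_pos)
  have h1 := (hV' c' hc').2 T hT m (hm.le.trans (by nlinarith [min_le_right ε 1]))
  have h2 := h.excess_nonneg c hT m
  have h3 := (le_abs_self _).trans (abs_dotP_le n (c' - c) (intVec m))
  rw [dotP_sub_left] at h3
  rw [excess] at h2 hm
  have h4 : n * ‖c' - c‖ * ‖intVec m‖ ≤ n * ‖c' - c‖ * (V * T) := by gcongr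
  have h5 : mane n H φ c' * T ≤ (mane n H φ c + n * V * ‖c' - c‖ + ε) * T := by
    nlinarith [min_le_left ε 1]
  exact le_of_mul_le_mul_right h5 hT

lemma continuous_mane (h : FreeFlow n H φ) : Continuous (mane n H φ) := by
  refine continuous_iff_continuousAt.2 fun c => ?_
  obtain ⟨V, hV, hV'⟩ := h.mane_lipschitz (‖c‖ + 1)
  have h1 : ∀ᶠ c' in 𝓝 c, ‖mane n H φ c' - mane n H φ c‖ ≤ V * ‖c' - c‖ := by
    filter_upwards [Metric.ball_mem_nhds c one_pos] with c' hc'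
    have hc2 : ‖c'‖ ≤ ‖c‖ + 1 := by
      rw [Metric.mem_ball, dist_eq_norm] at hc'
      linarith [norm_le_norm_add_norm_sub' c' c, norm_sub_rev c c']
    rw [Real.norm_eq_abs, abs_le]
    have k1 := hV' c c' (by linarith) hc2
    have k2 := hV' c' c hc2 (by linarith)
    rw [norm_sub_rev] at k2
    constructor <;> linarith
  refine tendsto_iff_norm_sub_tendsto_zero.2 ?_
  refine squeeze_zero' (Eventually.of_forall fun _ => norm_nonneg _) h1 ?_
  have : Continuous fun c' : E n => V * ‖c' - c‖ := by fun_prop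
  simpa using this.tendsto c

end FreeFlow

/-- First order Taylor estimate for a function with Lipschitz gradient. -/
lemma abs_taylor_le {n : ℕ} {f : E n → ℝ} {g : E n → E n} {K : ℝ} {y y' : E n}
    (hf : ∀ z, HasFDerivAt f (dotB n (g z)) z)
    (hg : ∀ z, ‖z - y‖ ≤ ‖y' - y‖ → ‖g z - g y‖ ≤ K * ‖z - y‖) (hK : 0 ≤ K) :
    |f y' - f y - dotP n (g y) (y' - y)| ≤ n * K * ‖y' - y‖ ^ 2 := by
  have h1 : ∀ z ∈ Metric.closedBall y ‖y' - y‖,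
      ‖dotB n (g z) - dotB n (g y)‖ ≤ n * K * ‖y' - y‖ := by
    intro z hz
    rw [Metric.mem_closedBall, dist_eq_norm] at hz
    rw [← map_sub]
    refine ContinuousLinearMap.opNorm_le_bound _ (by positivity) fun v => ?_
    rw [dotB_apply, Real.norm_eq_abs]
    refine (abs_dotP_le n _ v).trans ?_
    have := hg z hz
    have h3 : n * ‖g z - g y‖ ≤ n * (K * ‖y' - y‖) := by
      gcongr; exact this.trans (by gcongr)
    rw [mul_assoc (n : ℝ) K]
    gcongr
  have h2 := Convex.norm_image_sub_le_of_norm_hasFDerivWithin_le'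
    (fun z _ => (hf z).hasFDerivWithinAt) h1 (convex_closedBall y ‖y' - y‖)
    (Metric.mem_closedBall_self (norm_nonneg _)) (y := y') (by simp [dist_eq_norm])
  rw [Real.norm_eq_abs, dotB_apply] at h2
  nlinarith

/-- Linear forms that are small up to a quadratic term and a constant. -/
lemma norm_le_of_quad {n : ℕ} (hn : 1 ≤ n) {d : E n} {A ε : ℝ} (hε : 0 ≤ ε) (hε1 : ε ≤ 1)
    (hd : ∀ v, ‖v‖ ≤ 1 → dotP n d v ≤ A * ‖v‖ ^ 2 + ε) : ‖d‖ ≤ (A + 1) * √ε := by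
  obtain ⟨e, he1, he2⟩ := exists_norm_eq_dotP hn d
  have key : ∀ s, 0 < s → s ≤ 1 → s * ‖d‖ ≤ A * s ^ 2 + ε := fun s hs hs1 => by
    have := hd (s • e) (by rw [norm_smul, he1, mul_one, Real.norm_of_nonneg hs.le]; exact hs1)
    rwa [dotP_smul_right, he2, norm_smul, he1, mul_one, Real.norm_of_nonneg hs.le] at this
  rcases hε.eq_or_lt with h0 | h0
  · rw [← h0, Real.sqrt_zero, mul_zero]
    by_contra! hcon
    set s := min 1 (‖d‖ / (2 * (|A| + 1))) with hs
    have hs0 : 0 < s := lt_min one_pos (by positivity)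
    have h1 := key s hs0 (min_le_left _ _)
    rw [← h0, add_zero] at h1
    have h2 : s * (2 * (|A| + 1)) ≤ ‖d‖ := by
      rw [← le_div_iff₀ (by positivity)]; exact min_le_right _ _
    have h3 : A ≤ |A| := le_abs_self A
    nlinarith [abs_nonneg A, mul_pos hs0 hs0, mul_nonneg hs0.le (sub_nonneg.2 h2),
      mul_nonneg (mul_pos hs0 hs0).le (sub_nonneg.2 h3)]
  · have hs0 : 0 < √ε := Real.sqrt_pos.2 h0
    have h1 := key (√ε) hs0 (Real.sqrt_le_one.2 hε1)
    have h2 := Real.sq_sqrt hε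
    have h3 : √ε * ‖d‖ ≤ √ε * ((A + 1) * √ε) := by nlinarith
    exact le_of_mul_le_mul_left h3 hs0

/-- Periodic subsolutions of the critical Hamilton-Jacobi equation of class `c`. -/
structure IsSubsol (n : ℕ) (H : E n × E n → ℝ) (φ : ℝ → E n × E n → E n × E n) (c : E n)
    (u : E n → ℝ) : Prop where
  periodic : ∀ x (m : Fin n → ℤ), u (x + intVec m) = u x
  sub_le : ∀ t, 0 < t → ∀ y y',
    u y' - u y ≤ pot n H φ t y y' - dotP n c (y' - y) + mane n H φ c * t

/-- A periodic subsolution of class `c`. -/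
def subsol (n : ℕ) (H : E n × E n → ℝ) (φ : ℝ → E n × E n → E n × E n) (c y : E n) : ℝ :=
  ⨅ q : {t : ℝ // 0 < t} × (Fin n → ℤ),
    (pot n H φ q.1 0 (y + intVec q.2) - dotP n c (y + intVec q.2) + mane n H φ c * q.1)

namespace FreeFlow

variable {n : ℕ} {H : E n × E n → ℝ} {φ : ℝ → E n × E n → E n × E n}

lemma bddBelow_subsol (h : FreeFlow n H φ) (c y : E n) :
    BddBelow (Set.range fun q : {t : ℝ // 0 < t} × (Fin n → ℤ) =>
      pot n H φ q.1 0 (y + intVec q.2) - dotP n c (y + intVec q.2) + mane n H φ c * q.1) := by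
  refine ⟨-(mane n H φ c + dotP n c y + pot n H φ 1 y 0), ?_⟩
  rintro _ ⟨⟨⟨t, ht⟩, m⟩, rfl⟩
  have h1 := h.excess_nonneg c (T := t + 1) (by linarith) m
  have h2 := h.pot_add_le ht one_pos 0 (y + intVec m) (intVec m)
  have h3 := h.pot_translate one_pos y 0 m
  rw [zero_add] at h3
  rw [excess, loopAct] at h1
  simp only [dotP_add_right]
  linarith

lemma isSubsol_subsol (h : FreeFlow n H φ) (c : E n) : IsSubsol n H φ c (subsol n H φ c) := by
  have : Nonempty ({t : ℝ // 0 < t} × (Fin n → ℤ)) := ⟨(⟨1, one_pos⟩, 0)⟩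
  refine ⟨fun x m => ?_, fun t ht y y' => ?_⟩
  · rw [subsol, subsol]
    refine Equiv.iInf_congr (Equiv.prodCongr (Equiv.refl _) (Equiv.addLeft m)) fun q => ?_
    simp only [Equiv.prodCongr_apply, Equiv.coe_refl, Prod.map_fst, id_eq, Prod.map_snd,
      Equiv.coe_addLeft, intVec_add, add_assoc]
  · rw [sub_le_iff_le_add']
    rw [← sub_le_iff_le_add]
    refine le_ciInf fun q => ?_
    have h1 := ciInf_le (h.bddBelow_subsol c y')
      (⟨q.1 + t, add_pos q.1.2 ht⟩, q.2)
    have h2 := h.pot_add_le q.1.2 ht 0 (y + intVec q.2) (y' + intVec q.2)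
    rw [h.pot_translate ht] at h2
    rw [sub_le_iff_le_add]
    refine h1.trans ?_
    simp only [dotP_add_right, dotP_sub_right]
    linarith

lemma exists_pot_taylor (h : FreeFlow n H φ) (D : ℝ) :
    ∃ C, 0 < C ∧ ∀ x y : E n, ‖y - x‖ ≤ D →
      (∀ y', ‖y' - y‖ ≤ 1 → |pot n H φ 1 x y' - pot n H φ 1 x y -
        dotP n (momF n φ 1 x y) (y' - y)| ≤ C * ‖y' - y‖ ^ 2) ∧
      ∀ x', ‖x' - x‖ ≤ 1 → |pot n H φ 1 x' y - pot n H φ 1 x y +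
        dotP n (mom n φ 1 x y) (x' - x)| ≤ C * ‖x' - x‖ ^ 2 := by
  have hc : ContDiff ℝ 1 fun z : E n × E n => (z.1, z.1 + z.2) := by fun_prop
  obtain ⟨K₁, hK₁, -⟩ := TonelliFlow.exists_lipschitz_strip
    (g := fun z : E n × E n => momF n φ 1 z.1 (z.1 + z.2))
    ((h.contDiff_momF one_pos).comp hc)
    (fun x p m => by
      simp only
      rw [show x + intVec m + p = x + p + intVec m by abel, h.momF_translate one_pos]) (D + 1)
  obtain ⟨K₂, hK₂, -⟩ := TonelliFlow.exists_lipschitz_strip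
    (g := fun z : E n × E n => mom n φ 1 z.1 (z.1 + z.2))
    ((h.contDiff_mom one_pos).comp hc)
    (fun x p m => by
      simp only
      rw [show x + intVec m + p = x + p + intVec m by abel, h.mom_translate one_pos]) (D + 1)
  refine ⟨n * K₁ + n * K₂ + 1, by positivity, fun x y hxy => ⟨fun y' hy' => ?_, fun x' hx' => ?_⟩⟩
  · refine (abs_taylor_le (K := K₁) (fun z => h.hasFDerivAt_pot_right one_pos x z) (fun z hz => ?_)
      K₁.2).trans ?_
    · have hz1 : ‖z - x‖ ≤ D + 1 := by
        have := norm_add_le (z - y) (y - x)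
        rw [sub_add_sub_cancel] at this
        linarith
      have := hK₁.dist_le_mul (x, z - x) hz1 (x, y - x) (by simp only [Set.mem_ofPred_eq]; linarith)
      simpa [dist_eq_norm, Prod.norm_def] using this
    · gcongr
      have : 0 ≤ (n : ℝ) * K₂ := by positivity
      linarith
  · have hf : ∀ z, HasFDerivAt (fun z => -pot n H φ 1 z y) (dotB n (mom n φ 1 z y)) z := fun z =>
      ((h.hasFDerivAt_pot_left one_pos z y).neg).congr_fderiv (neg_neg _)
    have h1 := (abs_taylor_le (K := K₂) (y := x) (y' := x') hf (fun z hz => ?_) K₂.2)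
    · rw [← abs_neg]
      refine le_trans (le_of_eq ?_) (h1.trans ?_)
      · congr 1; ring
      · gcongr
        have : 0 ≤ (n : ℝ) * K₁ := by positivity
        linarith
    · have hz1 : ‖y - z‖ ≤ D + 1 := by
        have := norm_add_le (y - x) (x - z)
        rw [sub_add_sub_cancel, norm_sub_rev x z] at this
        linarith
      have := hK₂.dist_le_mul (z, y - z) hz1 (x, y - x) (by simp only [Set.mem_ofPred_eq]; linarith)
      simpa [dist_eq_norm, Prod.norm_def, norm_sub_rev] using this

/-- Local upper semiconcavity estimate at the end of an orbit. -/
lemma sub_le_of_orbit_end (h : FreeFlow n H φ) {C D : ℝ}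
    (hC : ∀ x y : E n, ‖y - x‖ ≤ D → ∀ y', ‖y' - y‖ ≤ 1 → |pot n H φ 1 x y' - pot n H φ 1 x y -
        dotP n (momF n φ 1 x y) (y' - y)| ≤ C * ‖y' - y‖ ^ 2) {c : E n} {u : E n → ℝ}
    (hu : IsSubsol n H φ c u) {T : ℝ} (hT : 1 < T) (z : E n × E n)
    (hz : ‖(φ T z).1 - (φ (T - 1) z).1‖ ≤ D) (y' : E n) (hy' : ‖y' - (φ T z).1‖ ≤ 1) :
    u y' - u z.1 ≤ act n H φ T z + dotP n (φ T z).2 (y' - (φ T z).1)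
      - dotP n c (y' - z.1) + mane n H φ c * T + C * ‖y' - (φ T z).1‖ ^ 2 := by
  set w := φ (T - 1) z with hw
  have e1 : φ T z = φ 1 w := by rw [hw, ← h.flow_add]; congr 1; ring
  have e2 := h.act_add 1 (T - 1) z
  rw [add_sub_cancel, ← hw, ← h.pot_flow (by linarith : 0 < T - 1), ← h.pot_flow one_pos w,
    ← hw, ← e1] at e2
  have h1 := hu.sub_le (T - 1) (by linarith) z.1 w.1
  have h2 := hu.sub_le 1 one_pos w.1 y'
  have h3 := (abs_le.1 (hC w.1 (φ T z).1 hz y' hy')).2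
  have h4 := h.momF_flow one_pos w
  rw [← e1] at h4
  rw [h4] at h3
  simp only [dotP_sub_right] at *
  linarith

/-- Local semiconvexity estimate at the beginning of an orbit. -/
lemma sub_le_of_orbit_start (h : FreeFlow n H φ) {C D : ℝ}
    (hC : ∀ x y : E n, ‖y - x‖ ≤ D → ∀ x', ‖x' - x‖ ≤ 1 → |pot n H φ 1 x' y - pot n H φ 1 x y +
        dotP n (mom n φ 1 x y) (x' - x)| ≤ C * ‖x' - x‖ ^ 2) {c : E n} {u : E n → ℝ}
    (hu : IsSubsol n H φ c u) {T : ℝ} (hT : 1 < T) (z : E n × E n)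
    (hz : ‖(φ 1 z).1 - z.1‖ ≤ D) (x' : E n) (hx' : ‖x' - z.1‖ ≤ 1) :
    u (φ T z).1 - u x' ≤ act n H φ T z - dotP n z.2 (x' - z.1)
      - dotP n c ((φ T z).1 - x') + mane n H φ c * T + C * ‖x' - z.1‖ ^ 2 := by
  set w := φ 1 z with hw
  have e1 : φ T z = φ (T - 1) w := by rw [hw, ← h.flow_add]; congr 1; ring
  have e2 := h.act_add (T - 1) 1 z
  rw [sub_add_cancel, ← hw, ← h.pot_flow (by linarith : 0 < T - 1), ← h.pot_flow one_pos z,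
    ← hw, ← e1] at e2
  have h1 := hu.sub_le (T - 1) (by linarith) w.1 (φ T z).1
  have h2 := hu.sub_le 1 one_pos x' w.1
  have h3 := (abs_le.1 (hC z.1 w.1 hz x' hx')).2
  have h4 := h.mom_flow one_pos z
  rw [← hw] at h4
  rw [h4] at h3
  simp only [dotP_sub_right] at *
  linarith

/-- Loops of bounded excess have bounded momentum. -/
lemma exists_loopMom_bound (h : FreeFlow n H φ) (Q : ℝ) :
    ∃ R, 0 < R ∧ ∀ c : E n, ‖c‖ ≤ Q → ∀ T, 1 ≤ T → ∀ m : Fin n → ℤ, excess n H φ c T m ≤ 1 →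
      ∀ x, ‖loopMom n φ T m x‖ ≤ R := by
  obtain ⟨V, hV, hV'⟩ := h.norm_intVec_le_of_excess Q
  obtain ⟨R, hR, hR'⟩ := h.act_coercive h.one_le (1 + n * |Q| * V + V)
  refine ⟨R, hR, fun c hc T hT m hm x => ?_⟩
  have h1 := hR' T (by linarith) (x, loopMom n φ T m x) ?_ 0
  · rwa [h.flow_zero] at h1
  · rw [h.act_loop (by linarith)]
    rw [excess] at hm
    have h2 := (hV' c hc).2 T (by linarith) m (by rw [excess]; linarith)
    have h3 := (le_abs_self _).trans (abs_dotP_le n c (intVec m))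
    have h4 : n * ‖c‖ * ‖intVec m‖ ≤ n * |Q| * (V * T) := by
      gcongr; exact hc.trans (le_abs_self Q)
    have h5 := neg_abs_le (mane n H φ c)
    have h6 := (hV' c hc).1
    nlinarith

/-- Every subsolution is approximated to second order along loops of small excess. -/
lemma exists_quad_bound (h : FreeFlow n H φ) (Q : ℝ) :
    ∃ C, 0 < C ∧ ∀ c : E n, ‖c‖ ≤ Q → ∀ u, IsSubsol n H φ c u → ∀ ε, ε ≤ 1 → ∀ T, 2 ≤ T →
      ∀ m : Fin n → ℤ, excess n H φ c T m ≤ ε → ∀ x x', ‖x' - x‖ ≤ 1 →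
        |u x' - u x - dotP n (loopMom n φ T m x - c) (x' - x)| ≤ C * ‖x' - x‖ ^ 2 + ε := by
  obtain ⟨R, hR, hR'⟩ := h.exists_loopMom_bound Q
  obtain ⟨E₀, hE₀, hE₀'⟩ := h.exists_H_bound R
  obtain ⟨-, K, -, -, -, -, -, -, hK⟩ := h.exists_flow_bounds E₀
  obtain ⟨C, hC, hC'⟩ := h.exists_pot_taylor K
  refine ⟨C, hC, fun c hc u hu ε hε T hT m hm x x' hx => ?_⟩
  set p := loopMom n φ T m x with hp
  have hT0 : 0 < T := by linarith
  have hfl := h.flow_loop hT0 m x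
  have hact := h.act_loop hT0 m x
  rw [← hp] at hfl hact
  have hEn : H (x, p) ≤ E₀ := (le_abs_self _).trans
    (hE₀' (x, p) (hR' c hc T (by linarith) m (hm.trans hε) x))
  have hspeed : ∀ s t, ‖(φ s (x, p)).1 - (φ t (x, p)).1‖ ≤ K * |s - t| := fun s t => by
    rw [← dist_eq_norm]
    exact (le_max_left _ _).trans (hK _ hEn s t)
  have k1 := h.sub_le_of_orbit_end (fun x y hxy => (hC' x y hxy).1) hu (by linarith : 1 < T) (x, p)
    ((hspeed _ _).trans (by simp)) (x' + intVec m) (by rw [hfl]; simpa using hx)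
  have k2 := h.sub_le_of_orbit_start (fun x y hxy => (hC' x y hxy).2) hu (by linarith : 1 < T)
    (x, p) (by have := hspeed 1 0; rw [h.flow_zero] at this; simpa using this) x' hx
  rw [excess] at hm
  simp only [hfl, hact, hu.periodic, add_sub_add_right_eq_sub] at k1 k2
  simp only [dotP_sub_right, dotP_sub_left, dotP_add_right] at *
  rw [abs_le]
  constructor <;> linarith

end FreeFlow

/-- A function with a quadratic remainder is differentiable. -/
lemma hasFDerivAt_of_quad {n : ℕ} {u : E n → ℝ} {x d : E n} {C : ℝ}
    (hu : ∀ x', ‖x' - x‖ ≤ 1 → |u x' - u x - dotP n d (x' - x)| ≤ C * ‖x' - x‖ ^ 2) :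
    HasFDerivAt u (dotB n d) x := by
  have h1 : (fun x' => u x' - u x - dotP n d (x' - x)) =O[𝓝 x] fun x' => ‖x' - x‖ ^ 2 := by
    refine Asymptotics.IsBigO.of_bound C ?_
    filter_upwards [Metric.closedBall_mem_nhds x one_pos] with x' hx'
    rw [Metric.mem_closedBall, dist_eq_norm] at hx'
    rw [Real.norm_eq_abs, Real.norm_of_nonneg (by positivity)]
    exact hu x' hx'
  have h2 := h1.hasFDerivAt (𝕜 := ℝ) one_lt_two
  have h3 : HasFDerivAt (fun x' => dotB n d (x' - x) + u x) (dotB n d) x :=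
    (((dotB n d).hasFDerivAt).comp x ((hasFDerivAt_id x).sub_const x)).add_const _
  have h4 := h2.add h3
  rw [zero_add] at h4
  refine h4.congr_of_eventuallyEq (Eventually.of_forall fun x' => ?_)
  simp only [Pi.add_apply, dotB_apply]
  ring

lemma gradF_eq_of_hasFDerivAt {n : ℕ} {u : E n → ℝ} {x d : E n}
    (hu : HasFDerivAt u (dotB n d) x) : gradF n u x = d :=
  dotP_left_injective fun v => by rw [← fderiv_eq_dotP_gradF, hu.fderiv, dotB_apply]

/-- The invariant foliation: the momentum at `x` of the leaf of class `c`, at `(x, c)`. -/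
def leaf (n : ℕ) (H : E n × E n → ℝ) (φ : ℝ → E n × E n → E n × E n) (q : E n × E n) : E n :=
  q.2 + gradF n (subsol n H φ q.2) q.1

namespace FreeFlow

variable {n : ℕ} {H : E n × E n → ℝ} {φ : ℝ → E n × E n → E n × E n}

lemma exists_quad_limit (h : FreeFlow n H φ) (Q : ℝ) :
    ∃ C R, 0 < C ∧ 0 < R ∧ ∀ c : E n, ‖c‖ ≤ Q → ∀ x, ∃ P, ‖P‖ ≤ R ∧ ∀ x', ‖x' - x‖ ≤ 1 →
      |subsol n H φ c x' - subsol n H φ c x - dotP n (P - c) (x' - x)| ≤ C * ‖x' - x‖ ^ 2 := by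
  obtain ⟨C, hC, hC'⟩ := h.exists_quad_bound Q
  obtain ⟨R, hR, hR'⟩ := h.exists_loopMom_bound Q
  refine ⟨C, R, hC, hR, fun c hc x => ?_⟩
  have hex : ∀ k : ℕ, ∃ T, 2 ≤ T ∧ ∃ m : Fin n → ℤ, excess n H φ c T m < 1 / ((k : ℝ) + 1) :=
    fun k => h.exists_excess_lt c (by positivity)
  choose T hT m hm using hex
  have hk1 : ∀ k : ℕ, 1 / ((k : ℝ) + 1) ≤ 1 := fun k => by
    rw [div_le_one (by positivity)]; linarith [(Nat.cast_nonneg k : (0 : ℝ) ≤ k)]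
  obtain ⟨P, hP, ψ, hψ, hlim⟩ := (isCompact_closedBall (0 : E n) R).tendsto_subseq
    (x := fun k => loopMom n φ (T k) (m k) x) (fun k => mem_closedBall_zero_iff.2
      (hR' c hc (T k) (by linarith [hT k]) (m k) ((hm k).le.trans (hk1 k)) x))
  refine ⟨P, mem_closedBall_zero_iff.1 hP, fun x' hx' => ?_⟩
  have h1 : Tendsto (fun k => 1 / (((ψ k : ℕ) : ℝ) + 1)) atTop (𝓝 0) :=
    tendsto_one_div_add_atTop_nhds_zero_nat.comp hψ.tendsto_atTop
  have hcont : Continuous fun p : E n => |subsol n H φ c x' - subsol n H φ c x -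
      dotP n (p - c) (x' - x)| := by
    have := continuous_dotP (n := n) (f := fun p : E n => p - c) (g := fun _ => x' - x)
      (by fun_prop) continuous_const
    fun_prop
  have h2 := (hcont.tendsto P).comp hlim
  have h3 : Tendsto (fun k => C * ‖x' - x‖ ^ 2 + 1 / (((ψ k : ℕ) : ℝ) + 1)) atTop
      (𝓝 (C * ‖x' - x‖ ^ 2 + 0)) := h1.const_add _
  rw [add_zero] at h3
  exact le_of_tendsto_of_tendsto' h2 h3 fun k => hC' c hc _ (h.isSubsol_subsol c) _ (hk1 _) _
    (hT _) _ (hm _).le x x' hx'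

/-- Uniform estimates on the leaves. -/
lemma exists_leaf_bounds (h : FreeFlow n H φ) (Q : ℝ) :
    ∃ C, 0 < C ∧ ∀ c : E n, ‖c‖ ≤ Q → ∀ x, ‖leaf n H φ (x, c)‖ ≤ C ∧
      (∀ x', ‖x' - x‖ ≤ 1 → |subsol n H φ c x' - subsol n H φ c x -
        dotP n (leaf n H φ (x, c) - c) (x' - x)| ≤ C * ‖x' - x‖ ^ 2) ∧
      ∀ ε, 0 ≤ ε → ε ≤ 1 → ∀ T, 2 ≤ T → ∀ m : Fin n → ℤ, excess n H φ c T m ≤ ε →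
        ‖loopMom n φ T m x - leaf n H φ (x, c)‖ ≤ C * √ε := by
  obtain ⟨C, R, hC, hR, hCR⟩ := h.exists_quad_limit Q
  obtain ⟨C', hC', hC1⟩ := h.exists_quad_bound Q
  refine ⟨C + C' + R + 1, by positivity, fun c hc x => ?_⟩
  obtain ⟨P, hP, hP'⟩ := hCR c hc x
  have hPl : leaf n H φ (x, c) = P := by
    rw [leaf, gradF_eq_of_hasFDerivAt (hasFDerivAt_of_quad hP'), add_sub_cancel]
  rw [hPl]
  refine ⟨by linarith, fun x' hx' => (hP' x' hx').trans ?_, fun ε hε hε1 T hT m hm => ?_⟩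
  · gcongr; linarith
  · refine (norm_le_of_quad h.one_le (A := C + C') hε hε1 fun v hv => ?_).trans ?_
    · have h1 := hC1 c hc _ (h.isSubsol_subsol c) ε hε1 T hT m hm x (x + v) (by simpa using hv)
      have h2 := hP' (x + v) (by simpa using hv)
      rw [add_sub_cancel_left, abs_le] at h1 h2
      simp only [dotP_sub_left] at *
      linarith
    · exact mul_le_mul_of_nonneg_right (by linarith) (Real.sqrt_nonneg _)

lemma hasFDerivAt_subsol (h : FreeFlow n H φ) (c x : E n) :
    HasFDerivAt (subsol n H φ c) (dotB n (leaf n H φ (x, c) - c)) x := by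
  obtain ⟨C, -, hC⟩ := h.exists_leaf_bounds ‖c‖
  exact hasFDerivAt_of_quad (hC c le_rfl x).2.1

lemma lipschitz_leaf (h : FreeFlow n H φ) (c : E n) :
    ∃ K : ℝ≥0, LipschitzWith K fun x => leaf n H φ (x, c) := by
  obtain ⟨C, hC, hC'⟩ := h.exists_leaf_bounds ‖c‖
  refine ⟨⟨6 * C, by positivity⟩, LipschitzWith.of_dist_le_mul fun x y => ?_⟩
  rw [dist_eq_norm, dist_comm, dist_eq_norm]
  change _ ≤ 6 * C * _
  set η := ‖y - x‖ with hη
  rcases le_total (1 / 2) η with h2 | h2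
  · have h3 := norm_sub_le (leaf n H φ (x, c)) (leaf n H φ (y, c))
    have h4 := (hC' c le_rfl x).1
    have h5 := (hC' c le_rfl y).1
    nlinarith
  rcases (norm_nonneg (y - x)).eq_or_lt with h0 | h0
  · rw [sub_eq_zero.1 (norm_eq_zero.1 h0.symm), sub_self, norm_zero]
    positivity
  rw [← hη] at h0
  rw [norm_sub_rev]
  obtain ⟨e, he1, he2⟩ := exists_norm_eq_dotP h.one_le (leaf n H φ (y, c) - leaf n H φ (x, c))
  have hηe : ‖η • e‖ = η := by rw [norm_smul, he1, mul_one, Real.norm_of_nonneg h0.le]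
  have k1 := (hC' c le_rfl y).2.1 (y + η • e) (by rw [add_sub_cancel_left, hηe]; linarith)
  have h7 : ‖y + η • e - x‖ ≤ 2 * η := by
    have := norm_add_le (y - x) (η • e)
    rw [hηe, ← hη, sub_add_eq_add_sub] at this
    linarith
  have k2 := (hC' c le_rfl x).2.1 (y + η • e) (by linarith)
  have k3 := (hC' c le_rfl x).2.1 y (by linarith)
  rw [add_sub_cancel_left, hηe] at k1
  rw [← hη] at k3
  have k4 : C * ‖y + η • e - x‖ ^ 2 ≤ C * (2 * η) ^ 2 := by gcongr
  have k1' := (abs_le.1 k1).1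
  have k2' := (abs_le.1 (k2.trans k4)).2
  have k3' := (abs_le.1 k3).1
  have k5 : η * ‖leaf n H φ (y, c) - leaf n H φ (x, c)‖ ≤ η * (6 * C * η) := by
    rw [← he2, ← dotP_smul_right]
    simp only [dotP_sub_left, dotP_sub_right, dotP_add_right] at *
    have k1' := (abs_le.1 k1).2
    have k2' := (abs_le.1 (k2.trans k4)).1
    have k3' := (abs_le.1 k3).2
    linarith
  exact le_of_mul_le_mul_left k5 h0

lemma contDiff_subsol (h : FreeFlow n H φ) (c : E n) : ContDiff ℝ 1 (subsol n H φ c) := by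
  obtain ⟨K, hK⟩ := h.lipschitz_leaf c
  refine contDiff_one_iff_hasFDerivAt.2 ⟨_, ?_, h.hasFDerivAt_subsol c⟩
  exact (dotB n).continuous.comp (hK.continuous.sub continuous_const)

lemma leaf_translate (h : FreeFlow n H φ) (x c : E n) (m : Fin n → ℤ) :
    leaf n H φ (x + intVec m, c) = leaf n H φ (x, c) := by
  have h1 := h.hasFDerivAt_subsol c (x + intVec m)
  have h2 : HasFDerivAt (fun x => x + intVec m) (ContinuousLinearMap.id ℝ (E n)) x :=
    (hasFDerivAt_id x).add_const _
  have h3 := h1.comp x h2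
  rw [ContinuousLinearMap.comp_id, show subsol n H φ c ∘ (fun x => x + intVec m) = subsol n H φ c
    from funext fun y => (h.isSubsol_subsol c).periodic y m] at h3
  have h4 := gradF_eq_of_hasFDerivAt h3
  rw [gradF_eq_of_hasFDerivAt (h.hasFDerivAt_subsol c x)] at h4
  exact (sub_left_inj.1 h4).symm

/-- Leaves are limits of graphs of loops. -/
lemma exists_loopMom_seq (h : FreeFlow n H φ) (c : E n) :
    ∃ (T : ℕ → ℝ) (m : ℕ → Fin n → ℤ) (δ : ℕ → ℝ), (∀ k, 2 ≤ T k) ∧ Tendsto δ atTop (𝓝 0) ∧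
      (∀ k, excess n H φ c (T k) (m k) ≤ δ k) ∧
      ∀ k x, ‖loopMom n φ (T k) (m k) x - leaf n H φ (x, c)‖ ≤ δ k := by
  obtain ⟨C, hC, hC'⟩ := h.exists_leaf_bounds ‖c‖
  have hex : ∀ k : ℕ, ∃ T, 2 ≤ T ∧ ∃ m : Fin n → ℤ, excess n H φ c T m < 1 / ((k : ℝ) + 1) :=
    fun k => h.exists_excess_lt c (by positivity)
  choose T hT m hm using hex
  have hk1 : ∀ k : ℕ, 1 / ((k : ℝ) + 1) ≤ 1 := fun k => by
    rw [div_le_one (by positivity)]; linarith [(Nat.cast_nonneg k : (0 : ℝ) ≤ k)]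
  have h0 := tendsto_one_div_add_atTop_nhds_zero_nat (𝕜 := ℝ)
  have h1 : Tendsto (fun k : ℕ => √(1 / ((k : ℝ) + 1))) atTop (𝓝 0) := by
    have := (Real.continuous_sqrt.tendsto 0).comp h0
    rwa [Real.sqrt_zero] at this
  refine ⟨T, m, fun k => 1 / ((k : ℝ) + 1) + C * √(1 / ((k : ℝ) + 1)), hT, ?_, fun k => ?_,
    fun k x => ?_⟩
  · simpa using h0.add (h1.const_mul C)
  · have : 0 ≤ C * √(1 / ((k : ℝ) + 1)) := by positivity
    linarith [hm k]
  · have := (hC' c le_rfl x).2.2 (1 / ((k : ℝ) + 1)) (by positivity) (hk1 k) (T k) (hT k) (m k)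
      (hm k).le
    have h2 : (0 : ℝ) ≤ 1 / ((k : ℝ) + 1) := by positivity
    linarith

lemma tendsto_of_norm_sub_le {y : ℕ → E n} {l : E n} {δ : ℕ → ℝ} (hδ : Tendsto δ atTop (𝓝 0))
    (hy : ∀ k, ‖y k - l‖ ≤ δ k) : Tendsto y atTop (𝓝 l) :=
  tendsto_iff_norm_sub_tendsto_zero.2 (squeeze_zero (fun _ => norm_nonneg _) hy hδ)

/-- The leaves are invariant. -/
lemma leaf_invariant (h : FreeFlow n H φ) (c : E n) (t : ℝ) (x : E n) :
    (φ t (x, leaf n H φ (x, c))).2 = leaf n H φ ((φ t (x, leaf n H φ (x, c))).1, c) := by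
  obtain ⟨T, m, δ, hT, hδ, -, hm⟩ := h.exists_loopMom_seq c
  obtain ⟨K, hK⟩ := h.lipschitz_leaf c
  have h1 : Tendsto (fun k => (x, loopMom n φ (T k) (m k) x)) atTop
      (𝓝 (x, leaf n H φ (x, c))) :=
    (tendsto_const_nhds (x := x)).prodMk_nhds (tendsto_of_norm_sub_le hδ fun k => hm k x)
  have hφc : Continuous (φ t) := (h.flow_smooth t).continuous
  have h2 := (hφc.tendsto _).comp h1
  have h3 := (continuous_snd.tendsto _).comp h2
  have h4 := ((hK.continuous.comp continuous_fst).tendsto _).comp h2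
  have h5 : Tendsto (fun k => (φ t (x, loopMom n φ (T k) (m k) x)).2 -
      leaf n H φ ((φ t (x, loopMom n φ (T k) (m k) x)).1, c)) atTop (𝓝 0) := by
    refine squeeze_zero_norm (fun k => ?_) hδ
    rw [h.loopMom_invariant (by linarith [hT k])]
    exact hm k _
  exact sub_eq_zero.1 (tendsto_nhds_unique (h3.sub h4) h5)

lemma continuous_leaf (h : FreeFlow n H φ) : Continuous (leaf n H φ) := by
  refine continuous_iff_continuousAt.2 fun ⟨x, c⟩ => ?_
  obtain ⟨C, hC, hC'⟩ := h.exists_leaf_bounds (‖c‖ + 1)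
  obtain ⟨K, hK⟩ := h.lipschitz_leaf c
  rw [Metric.continuousAt_iff']
  intro ε hε
  set η := min 1 ((ε / (4 * C)) ^ 2) with hη
  have hη0 : 0 < η := lt_min one_pos (by positivity)
  have hηC : C * √η ≤ ε / 4 := by
    have : √η ≤ ε / (4 * C) := Real.sqrt_le_iff.2 ⟨by positivity, min_le_right _ _⟩
    calc C * √η ≤ C * (ε / (4 * C)) := by gcongr
      _ = ε / 4 := by field_simp
  obtain ⟨T, hT, m, hm⟩ := h.exists_excess_lt c hη0
  have hcont : Continuous fun c' : E n => excess n H φ c' T m := by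
    have h1 := continuous_dotP (n := n) (f := fun p : E n => p) (g := fun _ => intVec m)
      continuous_id continuous_const
    have h2 := h.continuous_mane
    unfold excess
    fun_prop
  have h1 : ∀ᶠ q : E n × E n in 𝓝 (x, c), excess n H φ q.2 T m < η :=
    ((hcont.comp continuous_snd).tendsto (x, c)).eventually (gt_mem_nhds hm)
  have h2 : ∀ᶠ q : E n × E n in 𝓝 (x, c), ‖q.2‖ < ‖c‖ + 1 :=
    ((continuous_norm.comp continuous_snd).tendsto (x, c)).eventually
      (gt_mem_nhds (by simp))
  have h3 : ∀ᶠ q : E n × E n in 𝓝 (x, c),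
      dist (leaf n H φ (q.1, c)) (leaf n H φ (x, c)) < ε / 2 :=
    ((hK.continuous.comp continuous_fst).tendsto (x, c)).eventually
      (Metric.ball_mem_nhds _ (by positivity))
  filter_upwards [h1, h2, h3] with q hq1 hq2 hq3
  have k1 := (hC' q.2 hq2.le q.1).2.2 η hη0.le (min_le_left _ _) T hT m hq1.le
  have k2 := (hC' c (by linarith) q.1).2.2 η hη0.le (min_le_left _ _) T hT m hm.le
  rw [← dist_eq_norm] at k1 k2
  rw [dist_comm] at k1
  have k3 := dist_triangle4 (leaf n H φ (q.1, q.2)) (loopMom n φ T m q.1) (leaf n H φ (q.1, c))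
    (leaf n H φ (x, c))
  change dist (leaf n H φ (q.1, q.2)) _ < ε
  linarith

lemma exists_subsol_bound (h : FreeFlow n H φ) (c : E n) :
    ∃ B, 0 < B ∧ ∀ x, |subsol n H φ c x| ≤ B := by
  obtain ⟨B, hB, hB'⟩ := exists_bound_of_periodic (n := n) (Y := Unit)
    (g := fun x _ => subsol n H φ c x) (K := Set.univ) isCompact_univ
    (((h.contDiff_subsol c).continuous.comp continuous_fst).continuousOn)
    (fun x m _ _ => (h.isSubsol_subsol c).periodic x m)
  exact ⟨B, hB, fun x => hB' x () trivial⟩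

lemma act_one_leaf (h : FreeFlow n H φ) (c x : E n) :
    act n H φ 1 (x, leaf n H φ (x, c)) = dotP n c ((φ 1 (x, leaf n H φ (x, c))).1 - x)
      - mane n H φ c + (subsol n H φ c (φ 1 (x, leaf n H φ (x, c))).1 - subsol n H φ c x) := by
  obtain ⟨T, m, δ, hT, hδ, hex, hm⟩ := h.exists_loopMom_seq c
  set u := subsol n H φ c with hu
  have hus := h.isSubsol_subsol c
  set v : E n × E n → ℝ := fun z => act n H φ 1 z - dotP n c ((φ 1 z).1 - x) + mane n H φ c
    - (u (φ 1 z).1 - u x) with hv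
  have hφc : Continuous (φ 1) := (h.flow_smooth 1).continuous
  have hac : Continuous fun z => act n H φ 1 z := by
    have h1 := h.continuous_act
    exact h1.comp (by fun_prop : Continuous fun z : E n × E n => ((1 : ℝ), z))
  have huc : Continuous u := (h.contDiff_subsol c).continuous
  have hvc : Continuous v := by
    have := continuous_dotP (n := n) (f := fun _ : E n × E n => c)
      (g := fun z => (φ 1 z).1 - x) continuous_const (by fun_prop)
    fun_prop
  have h1 : Tendsto (fun k => (x, loopMom n φ (T k) (m k) x)) atTop
      (𝓝 (x, leaf n H φ (x, c))) :=
    (tendsto_const_nhds (x := x)).prodMk_nhds (tendsto_of_norm_sub_le hδ fun k => hm k x)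
  have h2 := (hvc.tendsto _).comp h1
  have h3 : Tendsto (fun k => v (x, loopMom n φ (T k) (m k) x)) atTop (𝓝 0) := by
    refine squeeze_zero (fun k => ?_) (fun k => ?_) hδ
    · have k1 := hus.sub_le 1 one_pos x (φ 1 (x, loopMom n φ (T k) (m k) x)).1
      have k2 := h.pot_flow one_pos (x, loopMom n φ (T k) (m k) x)
      simp only at k2
      rw [k2] at k1
      simp only [hv]
      linarith
    · have hTk := hT k
      have hT0 : 0 < T k := by linarith
      set w := φ 1 (x, loopMom n φ (T k) (m k) x) with hw
      have e0 := h.flow_loop hT0 (m k) x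
      have e1 : φ (T k - 1) w = φ (T k) (x, loopMom n φ (T k) (m k) x) := by
        rw [hw, ← h.flow_add]; congr 1; ring
      have e2 := h.act_add (T k - 1) 1 (x, loopMom n φ (T k) (m k) x)
      rw [sub_add_cancel, h.act_loop hT0, ← hw, ← h.pot_flow (by linarith : 0 < T k - 1) w,
        e1, e0] at e2
      have k1 : u (x + intVec (m k)) - u w.1 ≤ _ :=
        hus.sub_le (T k - 1) (by linarith) w.1 (x + intVec (m k))
      have k3 : u (x + intVec (m k)) = u x := hus.periodic _ _
      rw [k3] at k1
      have k2 := hex k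
      rw [excess] at k2
      simp only [hv, ← hw]
      simp only [dotP_sub_right, dotP_add_right] at *
      linarith
  have h4 := tendsto_nhds_unique h2 h3
  simp only [hv] at h4
  linarith

/-- Orbits on the leaves are calibrated. -/
lemma act_leaf (h : FreeFlow n H φ) (c x : E n) (N : ℕ) :
    act n H φ N (x, leaf n H φ (x, c)) = dotP n c ((φ N (x, leaf n H φ (x, c))).1 - x)
      - mane n H φ c * N + (subsol n H φ c (φ N (x, leaf n H φ (x, c))).1
        - subsol n H φ c x) := by
  induction N with
  | zero =>
    simp only [Nat.cast_zero, h.flow_zero, TonelliFlow.act_zero, sub_self, dotP_zero_right]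
    simp
  | succ N ih =>
    set z : E n × E n := (x, leaf n H φ (x, c)) with hz
    set w := φ N z with hw
    have hwl : w = (w.1, leaf n H φ (w.1, c)) := by
      rw [hw, hz, ← h.leaf_invariant]
    have e1 := h.act_add 1 (N : ℝ) z
    have e2 := h.act_one_leaf c w.1
    rw [← hwl] at e2
    have e3 : φ ((N + 1 : ℕ) : ℝ) z = φ 1 w := by
      rw [hw, ← h.flow_add]; congr 1; push_cast; ring
    have e4 : ((N + 1 : ℕ) : ℝ) = 1 + N := by push_cast; ring
    rw [e3, e4, e1, ih, ← hw, e2]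
    simp only [dotP_sub_right]
    ring

/-- Long orbits on a leaf close up with bounded excess. -/
lemma exists_excess_bound (h : FreeFlow n H φ) (c x : E n) :
    ∃ B, ∀ N : ℕ, 1 ≤ N → excess n H φ c (N + 1)
      (fun i => round (((φ N (x, leaf n H φ (x, c))).1 - x) i)) ≤ B := by
  obtain ⟨B, hB, hB'⟩ := h.exists_subsol_bound c
  obtain ⟨C, hC, hC'⟩ := h.pot_upper 1
  refine ⟨C + n * ‖c‖ + |mane n H φ c| + 2 * B, fun N hN => ?_⟩
  set z : E n × E n := (x, leaf n H φ (x, c)) with hz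
  set y := (φ N z).1 with hy
  set m : Fin n → ℤ := fun i => round ((y - x) i) with hm
  have hN0 : (0 : ℝ) < N := by exact_mod_cast hN
  have k0 : ‖y - x - intVec m‖ ≤ 1 := norm_sub_intVec_round (y - x)
  have k1 := h.pot_loop (T := (N : ℝ) + 1) (by linarith) m x
  have k2 := h.pot_add_le hN0 one_pos x y (x + intVec m)
  have k3 := hC' 1 le_rfl y (x + intVec m) (by
    rw [← norm_neg, show -(x + intVec m - y) = y - x - intVec m by abel]; simpa using k0)
  have k4 := h.pot_flow hN0 z
  have k5 := h.act_leaf c x N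
  rw [← hz, ← hy] at k5
  rw [← hy] at k4
  have k6 := (le_abs_self _).trans (abs_dotP_le n c (y - x - intVec m))
  have k7 : n * ‖c‖ * ‖y - x - intVec m‖ ≤ n * ‖c‖ * 1 := by gcongr
  have k8 := (abs_le.1 (hB' y)).2
  have k9 := (abs_le.1 (hB' x)).1
  rw [excess, ← k1]
  change pot n H φ N x y = _ at k4
  have k10 := le_abs_self (mane n H φ c)
  rw [dotP_sub_right] at k6
  linarith

/-- Distinct leaves are disjoint. -/
lemma leaf_injective (h : FreeFlow n H φ) {x c c' : E n}
    (hcc : leaf n H φ (x, c) = leaf n H φ (x, c')) : c = c' := by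
  obtain ⟨B, hB⟩ := h.exists_excess_bound c x
  obtain ⟨B', hB'⟩ := h.exists_excess_bound c' x
  set d : E n := (1 / 2 : ℝ) • (c + c') with hd
  set a := (mane n H φ c + mane n H φ c') / 2 with ha
  have hex : ∀ T m, excess n H φ d T m = (excess n H φ c T m + excess n H φ c' T m) / 2
      - (a - mane n H φ d) * T := fun T m => by
    simp only [excess, hd, ha, dotP_smul_left, dotP_add_left]
    ring
  have hma : a ≤ mane n H φ d := by
    by_contra! hlt
    obtain ⟨N, hN⟩ := exists_nat_gt (((B + B') / 2) / (a - mane n H φ d))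
    rw [div_lt_iff₀ (by linarith)] at hN
    have k0 := h.excess_nonneg d (T := ((N + 1 : ℕ) : ℝ) + 1) (by positivity)
      (fun i => round (((φ ((N + 1 : ℕ) : ℝ) (x, leaf n H φ (x, c))).1 - x) i))
    have k1 := hB (N + 1) (by omega)
    have k2 := hB' (N + 1) (by omega)
    rw [← hcc] at k2
    rw [hex] at k0
    push_cast at *
    nlinarith
  have hall : ∀ y, leaf n H φ (y, c) = leaf n H φ (y, c') := by
    intro y
    obtain ⟨C, hC, hC'⟩ := h.exists_leaf_bounds (max ‖c‖ ‖c'‖)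
    refine eq_of_forall_dist_le fun ε hε => ?_
    set η := min 1 ((ε / (2 * C)) ^ 2) with hη
    have hη0 : 0 < η := lt_min one_pos (by positivity)
    have hηC : C * √η ≤ ε / 2 := by
      have : √η ≤ ε / (2 * C) := Real.sqrt_le_iff.2 ⟨by positivity, min_le_right _ _⟩
      calc C * √η ≤ C * (ε / (2 * C)) := by gcongr
        _ = ε / 2 := by field_simp
    obtain ⟨T, hT, m, hm⟩ := h.exists_excess_lt d (half_pos hη0)
    have hT0 : 0 < T := by linarith
    rw [hex] at hm
    have k1 := h.excess_nonneg c hT0 m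
    have k2 := h.excess_nonneg c' hT0 m
    have k3 : (a - mane n H φ d) * T ≤ 0 := mul_nonpos_of_nonpos_of_nonneg (by linarith) hT0.le
    have k4 := (hC' c (le_max_left _ _) y).2.2 η hη0.le (min_le_left _ _) T hT m (by linarith)
    have k5 := (hC' c' (le_max_right _ _) y).2.2 η hη0.le (min_le_left _ _) T hT m (by linarith)
    rw [← dist_eq_norm] at k4 k5
    exact (dist_triangle_left _ _ _).trans (by linarith)
  obtain ⟨y, hy⟩ := exists_forall_le_of_periodic
    (g := fun y => subsol n H φ c y - subsol n H φ c' y)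
    ((h.contDiff_subsol c).continuous.sub (h.contDiff_subsol c').continuous) (fun y m => by
      rw [(h.isSubsol_subsol c).periodic, (h.isSubsol_subsol c').periodic])
  have h1 := (h.hasFDerivAt_subsol c y).fun_sub (h.hasFDerivAt_subsol c' y)
  have h2 := IsLocalExtr.hasFDerivAt_eq_zero (Or.inl (Eventually.of_forall hy)) h1
  rw [← map_sub, hall y, sub_sub_sub_cancel_left] at h2
  refine (dotP_left_injective fun v => ?_).symm
  have := congrArg (fun L => L v) h2
  simp only [dotB_apply, dotP_sub_left] at this
  exact sub_eq_zero.1 this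

lemma mane_superlinear (h : FreeFlow n H φ) (V : ℕ) :
    ∃ C, 0 < C ∧ ∀ c : E n, V * ‖c‖ - C ≤ mane n H φ c := by
  obtain ⟨C, hC, hC'⟩ := h.pot_upper V
  refine ⟨C, hC, fun c => ?_⟩
  set m : Fin n → ℤ := fun i => if 0 ≤ c i then V else -V with hm
  have hmi : ∀ i, c i * (m i : ℝ) = V * |c i| ∧ |(m i : ℝ)| ≤ V := fun i => by
    simp only [hm]
    split_ifs with hi
    · rw [abs_of_nonneg hi]; push_cast; constructor
      · ring
      · rw [abs_of_nonneg (by positivity)]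
    · rw [abs_of_neg (not_le.1 hi)]; push_cast; constructor
      · ring
      · rw [abs_neg, abs_of_nonneg (by positivity)]
  have h1 : V * ‖c‖ ≤ dotP n c (intVec m) := by
    have h2 : dotP n c (intVec m) = V * ∑ i, |c i| := by
      rw [dotP, Finset.mul_sum]
      exact Finset.sum_congr rfl fun i _ => (hmi i).1
    rw [h2]
    gcongr
    refine (pi_norm_le_iff_of_nonneg (by positivity)).2 fun i => ?_
    exact Finset.single_le_sum (f := fun i => |c i|) (fun i _ => abs_nonneg _) (Finset.mem_univ i)
  have h2 := hC' 1 le_rfl 0 (intVec m) (by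
    rw [sub_zero, mul_one]
    exact (pi_norm_le_iff_of_nonneg (by positivity)).2 fun i => (hmi i).2)
  have h3 := h.excess_nonneg c one_pos m
  rw [excess, loopAct] at h3
  linarith

/-- The cohomology class is controlled by the momentum. -/
lemma exists_class_bound (h : FreeFlow n H φ) (R : ℝ) :
    ∃ Q, ∀ x c : E n, ‖leaf n H φ (x, c)‖ ≤ R → ‖c‖ ≤ Q := by
  obtain ⟨E₀, hE₀, hE₀'⟩ := h.exists_H_bound R
  obtain ⟨-, K, -, -, -, -, -, -, hK⟩ := h.exists_flow_bounds E₀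
  obtain ⟨M, hM, hM'⟩ := h.pot_lower 0
  obtain ⟨V, hV⟩ := exists_nat_gt ((n : ℝ) * K + 1)
  obtain ⟨C, hC, hC'⟩ := h.mane_superlinear V
  refine ⟨M + C, fun x c hxc => ?_⟩
  obtain ⟨B, hB, hB'⟩ := h.exists_subsol_bound c
  have key : mane n H φ c ≤ n * ‖c‖ * K + M := by
    by_contra! hlt
    obtain ⟨N, hN⟩ := exists_nat_gt ((2 * B) / (mane n H φ c - (n * ‖c‖ * K + M)))
    rw [div_lt_iff₀ (by linarith)] at hN
    have hN0 : (0 : ℝ) < N := by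
      by_contra hcon
      nlinarith
    have k1 := h.act_leaf c x N
    set z : E n × E n := (x, leaf n H φ (x, c)) with hz
    have hEn : H z ≤ E₀ := (le_abs_self _).trans (hE₀' z hxc)
    have k2 : ‖(φ N z).1 - x‖ ≤ K * N := by
      have := (le_max_left _ _).trans (hK z hEn N 0)
      rw [h.flow_zero, dist_eq_norm, sub_zero, abs_of_pos hN0] at this
      exact this
    have k3 := h.pot_flow hN0 z
    have k4 := hM' 0 (by simp) N hN0 z.1 (φ N z).1
    rw [k3, dotP_zero_left] at k4
    have k5 := (le_abs_self _).trans (abs_dotP_le n c ((φ N z).1 - x))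
    have k6 : n * ‖c‖ * ‖(φ N z).1 - x‖ ≤ n * ‖c‖ * (K * N) := by gcongr
    have k8 := (abs_le.1 (hB' (φ N z).1)).2
    have k9 := (abs_le.1 (hB' x)).1
    nlinarith
  have := hC' c
  nlinarith [norm_nonneg c]

end FreeFlow

/-- A function squeezed between two functions tangent at `x` is differentiable at `x`. -/
lemma hasFDerivAt_of_le_of_le {F : Type*} [NormedAddCommGroup F] [NormedSpace ℝ F]
    {f g₁ g₂ : F → ℝ} {L : F →L[ℝ] ℝ} {x : F} (h₁ : HasFDerivAt g₁ L x) (h₂ : HasFDerivAt g₂ L x)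
    (hx₁ : g₁ x = f x) (hx₂ : g₂ x = f x) (hl : ∀ y, g₁ y ≤ f y) (hu : ∀ y, f y ≤ g₂ y) :
    HasFDerivAt f L x := by
  rw [hasFDerivAt_iff_isLittleO] at *
  rw [Asymptotics.isLittleO_iff] at *
  intro ε hε
  filter_upwards [h₁ hε, h₂ hε] with y h1 h2
  rw [Real.norm_eq_abs, abs_le] at *
  have := hl y
  have := hu y
  constructor <;> linarith [h1.1, h2.2]

/-- The Busemann function of the loops of period `T` and homology class `r`. -/
def busemann (n : ℕ) (H : E n × E n → ℝ) (φ : ℝ → E n × E n → E n × E n) (T : ℝ)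
    (r : Fin n → ℤ) (y : E n) : ℝ :=
  ⨅ N : ℕ, (pot n H φ ((N + 1 : ℕ) * T) 0 (y + intVec ((N + 1) • r))
    - (N + 1 : ℕ) * loopAct n H φ T r)

namespace FreeFlow

variable {n : ℕ} {H : E n × E n → ℝ} {φ : ℝ → E n × E n → E n × E n}

lemma busemann_lower (h : FreeFlow n H φ) {T : ℝ} (hT : 0 < T) (r : Fin n → ℤ) (y : E n) (N : ℕ) :
    loopAct n H φ T r - pot n H φ T y (intVec r) ≤
      pot n H φ ((N + 1 : ℕ) * T) 0 (y + intVec ((N + 1) • r))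
        - (N + 1 : ℕ) * loopAct n H φ T r := by
  have h1 := h.pot_add_le (t := (N + 1 : ℕ) * T) (by positivity) hT 0
    (y + intVec ((N + 1) • r)) (intVec r + intVec ((N + 1) • r))
  rw [h.pot_translate hT] at h1
  have h2 := h.loopAct_nsmul hT r (N := N + 2) (by omega)
  rw [loopAct] at h2
  have e1 : ((N + 2 : ℕ) : ℝ) * T = (N + 1 : ℕ) * T + T := by push_cast; ring
  have e2 : intVec ((N + 2) • r) = intVec r + intVec ((N + 1) • r) := by
    rw [← intVec_add, ← succ_nsmul']
  rw [e1, e2] at h2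
  push_cast at *
  linarith

lemma bddBelow_busemann (h : FreeFlow n H φ) {T : ℝ} (hT : 0 < T) (r : Fin n → ℤ) (y : E n) :
    BddBelow (Set.range fun N : ℕ => (pot n H φ ((N + 1 : ℕ) * T) 0 (y + intVec ((N + 1) • r))
      - (N + 1 : ℕ) * loopAct n H φ T r)) := by
  refine ⟨loopAct n H φ T r - pot n H φ T y (intVec r), ?_⟩
  rintro _ ⟨N, rfl⟩
  exact h.busemann_lower hT r y N

lemma busemann_sub_le (h : FreeFlow n H φ) {T : ℝ} (hT : 0 < T) (r : Fin n → ℤ) (y y' : E n) :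
    busemann n H φ T r y' - busemann n H φ T r y ≤
      pot n H φ T y (y' + intVec r) - loopAct n H φ T r := by
  rw [sub_le_comm]
  refine le_ciInf fun N => ?_
  rw [sub_le_comm]
  have h0 := ciInf_le (h.bddBelow_busemann hT r y') (N + 1)
  have h1 := h.pot_add_le (t := (N + 1 : ℕ) * T) (by positivity) hT 0
    (y + intVec ((N + 1) • r)) (y' + intVec r + intVec ((N + 1) • r))
  rw [h.pot_translate hT] at h1
  have e1 : ((N + 1 + 1 : ℕ) : ℝ) * T = (N + 1 : ℕ) * T + T := by push_cast; ring
  have e2 : y' + intVec ((N + 1 + 1) • r) = y' + intVec r + intVec ((N + 1) • r) := by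
    rw [succ_nsmul' r (N + 1), intVec_add, add_assoc]
  rw [e1, e2] at h0
  rw [busemann]
  push_cast at *
  linarith

lemma hasFDerivAt_busemann (h : FreeFlow n H φ) {T : ℝ} (hT : 0 < T) (r : Fin n → ℤ) (y : E n) :
    HasFDerivAt (busemann n H φ T r) (dotB n (loopMom n φ T r y)) y := by
  set b := busemann n H φ T r with hb
  set a := loopAct n H φ T r with ha
  have k1 : HasFDerivAt (fun y' => b y + (pot n H φ T y (y' + intVec r) - a))
      (dotB n (loopMom n φ T r y)) y := by
    have := h.hasFDerivAt_pot_right hT y (y + intVec r)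
    rw [h.momF_loop hT] at this
    exact (((hasFDerivAt_comp_add_right _).2 this).sub_const a).const_add (b y)
  have k2 : HasFDerivAt (fun y' => b y - (pot n H φ T y' (y + intVec r) - a))
      (dotB n (loopMom n φ T r y)) y := by
    have := ((h.hasFDerivAt_pot_left hT y (y + intVec r)).sub_const a).const_sub (b y)
    rw [neg_neg] at this
    exact this
  have k3 : pot n H φ T y (y + intVec r) = a := h.pot_loop hT r y
  refine hasFDerivAt_of_le_of_le k2 k1 ?_ ?_ (fun y' => ?_) (fun y' => ?_)
  · simp only [k3]; ring
  · simp only [k3]; ring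
  · have : b y - b y' ≤ pot n H φ T y' (y + intVec r) - a := h.busemann_sub_le hT r y' y
    linarith
  · have : b y' - b y ≤ pot n H φ T y (y' + intVec r) - a := h.busemann_sub_le hT r y y'
    linarith

/-- The Busemann function is linear up to a periodic function. -/
lemma exists_busemann_add (h : FreeFlow n H φ) {T : ℝ} (hT : 0 < T) (r : Fin n → ℤ) :
    ∃ c : E n, ∀ y (m : Fin n → ℤ), busemann n H φ T r (y + intVec m)
      = busemann n H φ T r y + dotP n c (intVec m) := by
  set b := busemann n H φ T r with hb
  have hconst : ∀ y (m : Fin n → ℤ), b (y + intVec m) - b y = b (intVec m) - b 0 := by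
    intro y m
    have hd : ∀ y, HasFDerivAt (fun y => b (y + intVec m) - b y) (0 : E n →L[ℝ] ℝ) y := fun y => by
      have h1 := ((hasFDerivAt_comp_add_right _).2
        (h.hasFDerivAt_busemann hT r (y + intVec m))).fun_sub
        (h.hasFDerivAt_busemann hT r y)
      rwa [h.loopMom_periodic hT, sub_self] at h1
    have := is_const_of_fderiv_eq_zero (𝕜 := ℝ) (fun y => (hd y).differentiableAt)
      (fun y => (hd y).fderiv) y 0
    simpa using this
  let κ : (Fin n → ℤ) →+ ℝ := AddMonoidHom.mk' (fun m => b (intVec m) - b 0) fun m m' => by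
    have := hconst (intVec m) m'
    rw [← intVec_add] at this
    linarith
  refine ⟨fun i => κ (Pi.single i 1), fun y m => ?_⟩
  have h1 : κ m = dotP n (fun i => κ (Pi.single i 1)) (intVec m) := by
    conv_lhs => rw [← Finset.univ_sum_single m]
    rw [map_sum, dotP]
    refine Finset.sum_congr rfl fun i _ => ?_
    have : (Pi.single i (m i) : Fin n → ℤ) = m i • Pi.single i 1 := by
      rw [← Pi.single_smul]; simp
    rw [this, map_zsmul, zsmul_eq_mul, mul_comm]
    rfl
  rw [← h1]
  have := hconst y m
  change _ = b y + (b (intVec m) - b 0)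
  linarith

lemma exists_class_of_loop (h : FreeFlow n H φ) {T : ℝ} (hT : 0 < T) (r : Fin n → ℤ) :
    ∃ c : E n, excess n H φ c T r ≤ 0 ∧ ∃ y, loopMom n φ T r y = c := by
  obtain ⟨c, hc⟩ := h.exists_busemann_add hT r
  set b := busemann n H φ T r with hb
  set a := loopAct n H φ T r with ha
  refine ⟨c, ?_, ?_⟩
  · have hit : ∀ (N : ℕ) (y y' : E n), b y' - b y ≤
        pot n H φ ((N + 1 : ℕ) * T) y y' + (N + 1 : ℕ) * (dotP n c (intVec r) - a) := by
      have h1 : ∀ y y', b y' - b y ≤ pot n H φ T y y' + (dotP n c (intVec r) - a) := fun y y' => by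
        have k1 : b (y' - intVec r) - b y ≤ pot n H φ T y (y' - intVec r + intVec r) - a :=
          h.busemann_sub_le hT r y (y' - intVec r)
        have k2 := hc (y' - intVec r) r
        rw [sub_add_cancel] at k1 k2
        linarith
      intro N
      induction N with
      | zero => simpa using h1
      | succ N ih =>
        intro y y'
        have hNT : 0 < ((N + 1 : ℕ) : ℝ) * T := by positivity
        have e1 : ((N + 1 + 1 : ℕ) : ℝ) * T = T + (N + 1 : ℕ) * T := by push_cast; ring
        have e2 : 0 < T + (N + 1 : ℕ) * T := by positivity
        set z : E n × E n := (y, mom n φ (T + (N + 1 : ℕ) * T) y y') with hz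
        have k1 := h.act_add T ((N + 1 : ℕ) * T) z
        have k2 := h.pot_flow hNT z
        have k3 := h.pot_flow hT (φ ((N + 1 : ℕ) * T) z)
        have k4 : (φ (T + (N + 1 : ℕ) * T) z).1 = y' := h.mom_spec e2 y y'
        have k5 : pot n H φ (T + (N + 1 : ℕ) * T) y y' = act n H φ (T + (N + 1 : ℕ) * T) z := rfl
        rw [← h.flow_add, k4] at k3
        have k6 := ih y (φ ((N + 1 : ℕ) * T) z).1
        have k7 := h1 (φ ((N + 1 : ℕ) * T) z).1 y'
        rw [e1, k5, k1, ← k2, ← k3]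
        have e3 : ((N + 1 + 1 : ℕ) : ℝ) = (N + 1 : ℕ) + 1 := by push_cast; ring
        rw [e3]
        linarith
    obtain ⟨C, hC, hC'⟩ := h.pot_upper 0
    set A := (dotP n c (intVec r) - a) / T with hA
    have hAT : A * T = dotP n c (intVec r) - a := by rw [hA]; field_simp
    have hm : mane n H φ c ≤ A := by
      refine mane_le_of_forall fun T' hT' m => ?_
      by_contra! hlt
      obtain ⟨M, hM⟩ := exists_nat_gt (((C + |A|) * (T + 1))
        / (dotP n c (intVec m) - loopAct n H φ T' m - A * T'))
      rw [div_lt_iff₀ (by linarith)] at hM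
      have hM0 : 0 < M := by
        by_contra! h0
        have : (M : ℝ) ≤ 0 := by exact_mod_cast h0
        have : 0 < (C + |A|) * (T + 1) := by positivity
        nlinarith
      have hM1 : (0 : ℝ) < M := by exact_mod_cast hM0
      obtain ⟨N, hN1, hN2⟩ : ∃ N : ℕ, M * T' + 1 ≤ (N + 1 : ℕ) * T ∧
          (N + 1 : ℕ) * T ≤ M * T' + 1 + T := by
        refine ⟨⌊(M * T' + 1) / T⌋₊, ?_, ?_⟩
        · rw [← div_le_iff₀ hT]
          push_cast
          exact (Nat.lt_floor_add_one _).le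
        · have : (⌊(M * T' + 1) / T⌋₊ : ℝ) * T ≤ M * T' + 1 := by
            rw [← le_div_iff₀ hT]
            exact Nat.floor_le (by positivity)
          push_cast
          linarith
      set s := (N + 1 : ℕ) * T - M * T' with hs
      have hs1 : 1 ≤ s := by linarith
      have hs2 : s ≤ T + 1 := by linarith
      have k1 := hit N 0 (intVec (M • m))
      have k2 := h.pot_add_le (t := M * T') (s := s) (by positivity) (by linarith) 0
        (intVec (M • m)) (intVec (M • m))
      have k3 := hC' s hs1 (intVec (M • m)) (intVec (M • m)) (by simp)
      have k4 := h.loopAct_nsmul hT' m hM0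
      have k5 := hc 0 (M • m)
      have e1 : (M : ℝ) * T' + s = (N + 1 : ℕ) * T := by rw [hs]; ring
      have e2 : intVec (M • m) = (M : ℝ) • intVec m := by
        funext i
        simp [intVec]
      rw [loopAct] at k4
      rw [e1, k4] at k2
      rw [zero_add] at k5
      have k6 : ((N + 1 : ℕ) : ℝ) * (dotP n c (intVec r) - a) = A * (M * T') + A * s := by
        rw [← hAT, ← mul_add, e1]; ring
      have k7 : A * s ≤ |A| * (T + 1) := by
        have : A * s ≤ |A| * s := by gcongr; exact le_abs_self A
        have : |A| * s ≤ |A| * (T + 1) := by gcongr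
        linarith
      have k8 : C * s ≤ C * (T + 1) := by gcongr
      have k9 : dotP n c (intVec (M • m)) = M * dotP n c (intVec m) := by
        rw [e2, dotP_smul_right]
      rw [k6] at k1
      nlinarith
    rw [excess]
    have := mul_le_mul_of_nonneg_right hm hT.le
    linarith
  · obtain ⟨y, hy⟩ := exists_forall_le_of_periodic (g := fun y => b y - dotP n c y) (by
      refine continuous_iff_continuousAt.2 fun y => ?_
      exact ((h.hasFDerivAt_busemann hT r y).fun_sub (dotB n c).hasFDerivAt).continuousAt)
      (fun y m => by rw [hc, dotP_add_right]; ring)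
    refine ⟨y, ?_⟩
    have h1 := (h.hasFDerivAt_busemann hT r y).fun_sub (dotB n c).hasFDerivAt
    have h2 := IsLocalExtr.hasFDerivAt_eq_zero (Or.inl (Eventually.of_forall hy)) h1
    rw [← map_sub] at h2
    refine dotP_left_injective fun v => ?_
    have := congrArg (fun L => L v) h2
    simp only [dotB_apply, dotP_sub_left] at this
    exact sub_eq_zero.1 this

/-- An orbit which almost closes up starts close to a leaf. -/
lemma exists_leaf_near_of_recurrent (h : FreeFlow n H φ) (R₀ : ℝ) :
    ∃ C, 0 < C ∧ ∀ x p : E n, ‖p‖ ≤ R₀ → ∀ T, 2 ≤ T → ∀ (r : Fin n → ℤ) (δ : ℝ), C * δ ≤ 1 →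
      ‖(φ T (x, p)).1 - x - intVec r‖ ≤ δ → ∃ c, ‖p - leaf n H φ (x, c)‖ ≤ C * √(C * δ) := by
  obtain ⟨E₀, hE₀, hE₀'⟩ := h.exists_H_bound R₀
  obtain ⟨-, K, -, -, -, -, -, -, hK⟩ := h.exists_flow_bounds E₀
  obtain ⟨A, hA, hA'⟩ := h.pot_upper (K + 1)
  obtain ⟨R, hR, hR'⟩ := h.act_coercive h.one_le A
  obtain ⟨E₁, hE₁, hE₁'⟩ := h.exists_H_bound R
  obtain ⟨-, K₁, -, -, -, -, -, -, hK₁⟩ := h.exists_flow_bounds E₁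
  obtain ⟨C₁, hC₁, hC₁'⟩ := h.exists_pot_taylor (max K K₁)
  obtain ⟨C₂, hC₂, hC₂'⟩ := h.exists_leaf_bounds R
  set G := n * R + C₁ + (n * (C₂ + R) + C₂) + n * R + 1 with hG
  have hG1 : 1 ≤ G := by
    have : 0 ≤ n * R + C₁ + (n * (C₂ + R) + C₂) + n * R := by positivity
    linarith
  refine ⟨max G (C₁ + C₂ + 1), by positivity, fun x p hp T hT r δ hδ hr => ?_⟩
  have hδ0 : 0 ≤ δ := (norm_nonneg _).trans hr
  have hδG : G * δ ≤ max G (C₁ + C₂ + 1) * δ := by gcongr; exact le_max_left _ _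
  have hδ1 : δ ≤ 1 := by nlinarith
  have hT0 : 0 < T := by linarith
  set z : E n × E n := (x, p) with hz
  set y := (φ T z).1 with hy
  have hEn : H z ≤ E₀ := (le_abs_self _).trans (hE₀' z hp)
  have hyx : ‖y - x‖ ≤ K * T := by
    have := (le_max_left _ _).trans (hK z hEn T 0)
    rw [h.flow_zero, dist_eq_norm, sub_zero, abs_of_pos hT0] at this
    exact this
  have hrT : ‖x + intVec r - x‖ ≤ (K + 1) * T := by
    have e : x + intVec r - x = (y - x) - (y - x - intVec r) := by abel
    rw [e]
    refine (norm_sub_le _ _).trans ?_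
    nlinarith
  have ha := hA' T (by linarith) x (x + intVec r) hrT
  rw [h.pot_loop hT0] at ha
  have hlm : ∀ y, ‖loopMom n φ T r y‖ ≤ R := fun y => by
    have := hR' T hT0 (y, loopMom n φ T r y) (by rwa [h.act_loop hT0]) 0
    rwa [h.flow_zero] at this
  obtain ⟨c, hc, y₀, hy₀⟩ := h.exists_class_of_loop hT0 r
  have hcR : ‖c‖ ≤ R := hy₀ ▸ hlm y₀
  refine ⟨c, ?_⟩
  obtain ⟨hl1, hl2, -⟩ := hC₂' c hcR x
  set u := subsol n H φ c with hu
  have hus : IsSubsol n H φ c u := h.isSubsol_subsol c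
  -- the action of the orbit is close to the one of the loop
  have hact : act n H φ T z ≤ loopAct n H φ T r + n * R * δ + C₁ * δ := by
    set l := loopMom n φ T r x with hl
    set w := φ (T - 1) (x, l) with hw
    have hw1 : φ 1 w = (x + intVec r, l) := by
      rw [hw, ← h.flow_add, add_sub_cancel, h.flow_loop hT0]
    have hEl : H (x, l) ≤ E₁ := (le_abs_self _).trans (hE₁' (x, l) (hlm x))
    have hwn : ‖x + intVec r - w.1‖ ≤ max K K₁ := by
      have := (le_max_left _ _).trans (hK₁ (x, l) hEl T (T - 1))
      rw [h.flow_loop hT0, ← hw, sub_sub_cancel, abs_one, mul_one, dist_eq_norm] at this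
      exact this.trans (le_max_right _ _)
    have e : y - (x + intVec r) = y - x - intVec r := by abel
    have k1 := (abs_le.1 ((hC₁' w.1 (x + intVec r) hwn).1 y (by
      rw [e]; exact hr.trans hδ1))).2
    have k2 := h.momF_flow one_pos w
    have k3 := h.pot_flow one_pos w
    have k4 := h.pot_flow (by linarith : 0 < T - 1) (x, l)
    have k5 := h.act_add 1 (T - 1) (x, l)
    rw [add_sub_cancel, h.act_loop hT0, ← hw] at k5
    have k6 := h.pot_add_le (by linarith : 0 < T - 1) one_pos x w.1 y
    have k7 := h.pot_flow hT0 z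
    rw [hw1] at k2 k3
    rw [← hw] at k4
    change pot n H φ T x y = _ at k7
    change pot n H φ (T - 1) x w.1 = _ at k4
    rw [k2, e] at k1
    rw [sub_add_cancel, k7] at k6
    have k8 := (le_abs_self _).trans (abs_dotP_le n l (y - x - intVec r))
    have k9 : n * ‖l‖ * ‖y - x - intVec r‖ ≤ n * R * δ := by
      gcongr
      exact hlm x
    have k10 : ‖y - x - intVec r‖ ^ 2 ≤ δ := by
      have := norm_nonneg (y - x - intVec r)
      nlinarith
    have k11 := mul_le_mul_of_nonneg_left k10 hC₁.le
    simp only at k3 k1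
    linarith
  have huy : u y - u x ≥ - (n * (C₂ + R) + C₂) * δ := by
    have e : y - intVec r - x = y - x - intVec r := by abel
    have k0 : u (y - intVec r) = u y := by
      have : u (y - intVec r + intVec r) = u (y - intVec r) := hus.periodic _ _
      rw [← this, sub_add_cancel]
    have k1 := (abs_le.1 (hl2 (y - intVec r) (by rw [e]; exact hr.trans hδ1))).1
    have k2 := (abs_le.1 (abs_dotP_le n (leaf n H φ (x, c) - c) (y - x - intVec r))).1
    have k3 : n * ‖leaf n H φ (x, c) - c‖ * ‖y - x - intVec r‖ ≤ n * (C₂ + R) * δ := by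
      gcongr
      exact (norm_sub_le _ _).trans (add_le_add hl1 hcR)
    have k10 : ‖y - x - intVec r‖ ^ 2 ≤ δ := by
      have := norm_nonneg (y - x - intVec r)
      nlinarith
    have k11 := mul_le_mul_of_nonneg_left k10 hC₂.le
    rw [k0, e] at k1
    linarith
  have key : ∀ v, ‖v‖ ≤ 1 → dotP n (p - leaf n H φ (x, c)) v ≤ (C₁ + C₂) * ‖v‖ ^ 2 + G * δ := by
    intro v hv
    have k1 := h.sub_le_of_orbit_start (fun x y hxy => (hC₁' x y hxy).2) hus
      (by linarith : 1 < T) z (by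
        have := (le_max_left _ _).trans (hK z hEn 1 0)
        rw [h.flow_zero, dist_eq_norm, sub_zero, abs_one, mul_one] at this
        exact this.trans (le_max_left _ _)) (x + v) (by simpa [hz] using hv)
    have k2 := (abs_le.1 (hl2 (x + v) (by simpa using hv))).2
    have k3 := (le_abs_self _).trans (abs_dotP_le n (-c) (y - x - intVec r))
    have k4 : n * ‖-c‖ * ‖y - x - intVec r‖ ≤ n * R * δ := by rw [norm_neg]; gcongr
    have e1 : z.1 = x := rfl
    have e2 : z.2 = p := rfl
    rw [e1, e2, ← hy, add_sub_cancel_left] at k1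
    rw [add_sub_cancel_left] at k2
    rw [excess] at hc
    have e3 : y - (x + v) = (y - x - intVec r) + intVec r - v := by abel
    rw [e3] at k1
    have e4 : dotP n (p - leaf n H φ (x, c)) v
        = dotP n p v - dotP n (leaf n H φ (x, c) - c) v - dotP n c v := by
      simp only [dotP_sub_left]; ring
    rw [dotP_neg_left] at k3
    rw [dotP_sub_right, dotP_add_right] at k1
    have e5 : G * δ = n * R * δ + C₁ * δ + (n * (C₂ + R) + C₂) * δ + n * R * δ + δ := by
      rw [hG]; ring
    rw [e4, e5]
    linarith
  have h1 := norm_le_of_quad h.one_le (ε := G * δ) (by positivity) (hδG.trans hδ) key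
  calc ‖p - leaf n H φ (x, c)‖ ≤ (C₁ + C₂ + 1) * √(G * δ) := h1
    _ ≤ _ := by
      gcongr
      exact le_max_right _ _

end FreeFlow

/-- The symplectic form as a bilinear form. -/
def omegaForm (n : ℕ) : LinearMap.BilinForm ℝ (E n × E n) :=
  LinearMap.mk₂ ℝ (omega0 n)
    (fun _ _ _ => by simp only [omega0, Prod.fst_add, Prod.snd_add, dotP_add_left]; ring)
    (fun _ _ _ => by
      simp only [omega0, Prod.smul_fst, Prod.smul_snd, dotP_smul_left, smul_eq_mul]; ring)
    (fun _ _ _ => by simp only [omega0, Prod.fst_add, Prod.snd_add, dotP_add_right]; ring)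
    (fun _ _ _ => by
      simp only [omega0, Prod.smul_fst, Prod.smul_snd, dotP_smul_right, smul_eq_mul]; ring)

lemma omegaForm_apply (n : ℕ) (w w' : E n × E n) : omegaForm n w w' = omega0 n w w' := rfl

lemma nondegenerate_omegaForm (n : ℕ) : (omegaForm n).Nondegenerate := by
  constructor
  · intro w hw
    refine Prod.ext (dotP_left_injective fun v => ?_) (dotP_left_injective fun v => ?_)
    · have := hw (0, v)
      rw [omegaForm_apply, omega0, dotP_zero_right] at this
      simp only [Prod.fst_zero, dotP_zero_left]
      linarith
    · have := hw (v, 0)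
      rw [omegaForm_apply, omega0, dotP_zero_right] at this
      simp only [Prod.snd_zero, dotP_zero_left]
      linarith
  · intro w hw
    refine Prod.ext (dotP_left_injective fun v => ?_) (dotP_left_injective fun v => ?_)
    · have := hw (0, v)
      rw [omegaForm_apply, omega0, dotP_zero_left, dotP_comm] at this
      simp only [Prod.fst_zero, dotP_zero_left]
      linarith
    · have := hw (v, 0)
      rw [omegaForm_apply, omega0, dotP_zero_left, dotP_comm] at this
      simp only [Prod.snd_zero, dotP_zero_left]
      linarith

/-- A linear map preserving a nondegenerate bilinear form has determinant `±1`. -/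
lemma abs_det_eq_one_of_isometry {V : Type*} [AddCommGroup V] [Module ℝ V] [FiniteDimensional ℝ V]
    {B : LinearMap.BilinForm ℝ V} (hB : B.Nondegenerate) {L : V →ₗ[ℝ] V}
    (hL : ∀ v w, B (L v) (L w) = B v w) : |LinearMap.det L| = 1 := by
  classical
  set b := Module.finBasis ℝ V with hb
  have h1 : B.comp L L = B := LinearMap.ext₂ hL
  have h2 := LinearMap.BilinForm.toMatrix_comp b b B L L
  rw [h1] at h2
  have h3 := (hB.toMatrix b).det_ne_zero
  have h4 := congrArg Matrix.det h2
  rw [Matrix.det_mul, Matrix.det_mul, Matrix.det_transpose, LinearMap.det_toMatrix] at h4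
  have h5 : LinearMap.det L * LinearMap.det L = 1 := by
    refine mul_left_cancel₀ h3 ?_
    rw [mul_one]
    nth_rewrite 2 [h4]
    ring
  rcases mul_self_eq_one_iff.1 h5 with h6 | h6 <;> simp [h6]

namespace TonelliFlow

variable {n : ℕ} {H : E n × E n → ℝ} {φ : ℝ → E n × E n → E n × E n}

lemma injective_flow (h : TonelliFlow n H φ) (t : ℝ) : Function.Injective (φ t) := by
  intro z z' hz
  have := congrArg (φ (-t)) hz
  rwa [h.flow_neg, h.flow_neg] at this

/-- Liouville's theorem: the flow preserves the volume. -/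
lemma volume_flow_image (h : TonelliFlow n H φ) (t : ℝ) {s : Set (E n × E n)}
    (hs : MeasurableSet s) : volume (φ t '' s) = volume s := by
  have : (volume : Measure (E n × E n)).IsAddHaarMeasure :=
    Measure.prod.instIsAddHaarMeasure (volume : Measure (E n)) (volume : Measure (E n))
  rw [← lintegral_abs_det_fderiv_eq_addHaar_image volume hs
    (fun z _ => (h.hasFDerivAt_flow t z).hasFDerivWithinAt) ((h.injective_flow t).injOn)]
  have hdet : ∀ z, |(fderiv ℝ (φ t) z).det| = 1 := fun z =>
    abs_det_eq_one_of_isometry (nondegenerate_omegaForm n) (h.omega0_fderiv_flow t z)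
  simp [hdet]

end TonelliFlow

lemma intVec_sub {n : ℕ} (m m' : Fin n → ℤ) : intVec (m - m') = intVec m - intVec m' := by
  ext i; simp [intVec]

lemma norm_intVec_le {n : ℕ} {N : ℕ} (m : Fin n → Fin N) :
    ‖intVec fun i => ((m i : ℕ) : ℤ)‖ ≤ N := by
  refine (pi_norm_le_iff_of_nonneg N.cast_nonneg).2 fun i => ?_
  simp only [intVec, Int.cast_natCast, Real.norm_natCast]
  exact_mod_cast (m i).2.le

lemma eq_of_norm_intVec_sub_lt_one {n : ℕ} {m m' : Fin n → ℤ}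
    (h : ‖intVec m - intVec m'‖ < 1) : m = m' := by
  ext i
  have := (norm_le_pi_norm (intVec m - intVec m') i).trans_lt h
  simp only [intVec, Pi.sub_apply, Real.norm_eq_abs] at this
  have h2 : |m i - m' i| < 1 := by exact_mod_cast this
  rw [Int.abs_lt_one_iff] at h2
  omega

namespace TonelliFlow

variable {n : ℕ} {H : E n × E n → ℝ} {φ : ℝ → E n × E n → E n × E n}

lemma volume_flow_preimage (h : TonelliFlow n H φ) (t : ℝ) {s : Set (E n × E n)}
    (hs : MeasurableSet s) : volume (φ t ⁻¹' s) = volume s := by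
  rw [← h.volume_flow_image (-t) hs]
  congr 1
  ext z
  constructor
  · intro hz
    exact ⟨φ t z, hz, h.flow_neg t z⟩
  · rintro ⟨w, hw, rfl⟩
    change φ t (φ (-t) w) ∈ s
    rwa [h.flow_neg']

/-- Among many translates of the images of a ball under the flow, two must meet. -/
lemma exists_flow_add_eq (h : TonelliFlow n H φ) (z₀ : E n × E n) {ρ : ℝ} (hρ : 0 < ρ)
    (hρ1 : ρ ≤ 1) :
    ∃ (i j : ℕ) (m m' : Fin n → ℤ) (a b : E n × E n), (i ≠ j ∨ m ≠ m') ∧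
      a ∈ Metric.ball z₀ ρ ∧ b ∈ Metric.ball z₀ ρ ∧
      φ (2 * i) a + (intVec m, 0) = φ (2 * j) b + (intVec m', 0) := by
  have hvol : (volume : Measure (E n × E n)).IsAddHaarMeasure :=
    Measure.prod.instIsAddHaarMeasure (volume : Measure (E n)) (volume : Measure (E n))
  obtain ⟨E₀, -, hE₀⟩ := h.exists_H_bound (‖z₀.2‖ + 1)
  have hball : ∀ z ∈ Metric.ball z₀ ρ, H z ≤ E₀ := fun z hz => by
    refine (le_abs_self _).trans (hE₀ z ?_)
    have h1 : ‖z.2 - z₀.2‖ ≤ ‖z - z₀‖ := _root_.norm_snd_le (z - z₀)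
    rw [mem_ball_iff_norm] at hz
    linarith [norm_le_norm_add_norm_sub' z.2 z₀.2]
  obtain ⟨R, K, hR0, hR, -, -, -, -, hK⟩ := h.exists_flow_bounds E₀
  obtain ⟨I, hI⟩ := ENNReal.exists_nat_mul_gt
    (Metric.measure_ball_pos volume z₀ hρ).ne'
    (ENNReal.ofReal_ne_top (r := 4 ^ n * (2 * R) ^ n))
  obtain ⟨N, hN⟩ := exists_nat_ge (1 + K * (2 * I) : ℝ)
  have hN0 : (0 : ℝ) < N := lt_of_lt_of_le (by positivity) hN
  set D : Set (E n × E n) := Metric.closedBall z₀.1 (2 * N) ×ˢ Metric.closedBall 0 R with hD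
  have hDvol : volume D ≤ ENNReal.ofReal ((N : ℝ) ^ n) * ENNReal.ofReal (4 ^ n * (2 * R) ^ n) := by
    rw [hD, Measure.volume_eq_prod, Measure.prod_prod, Real.volume_pi_closedBall _ (by positivity),
      Real.volume_pi_closedBall _ hR0.le, ← ENNReal.ofReal_mul (by positivity),
      ← ENNReal.ofReal_mul (by positivity), Fintype.card_fin]
    refine ENNReal.ofReal_le_ofReal (le_of_eq ?_)
    rw [show (2 * (2 * (N : ℝ))) = N * 4 by ring, mul_pow, mul_assoc]
  let v : (Fin n → Fin N) → E n × E n := fun m => (intVec fun i => ((m i : ℕ) : ℤ), 0)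
  let S : Fin I × (Fin n → Fin N) → Set (E n × E n) := fun q =>
    (fun z => z + -v q.2) ⁻¹' (φ (-(2 * (q.1 : ℕ))) ⁻¹' Metric.ball z₀ ρ)
  have hSm : ∀ q, MeasurableSet (S q) := fun q =>
    (measurable_add_const _) ((h.flow_smooth _).continuous.measurable measurableSet_ball)
  have hSvol : ∀ q, volume (S q) = volume (Metric.ball z₀ ρ) := fun q => by
    rw [measure_preimage_add_right, h.volume_flow_preimage _ measurableSet_ball]
  have hSeq : ∀ q, ∀ z ∈ S q, ∃ a ∈ Metric.ball z₀ ρ, φ (2 * (q.1 : ℕ)) a + v q.2 = z := by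
    intro q z hz
    refine ⟨_, hz, ?_⟩
    rw [h.flow_neg']
    exact neg_add_cancel_right z (v q.2)
  have hSD : ∀ q, S q ⊆ D := by
    intro q z hz
    obtain ⟨a, ha, rfl⟩ := hSeq q z hz
    have h1 := hK a (hball a ha) (2 * (q.1 : ℕ)) 0
    rw [h.flow_zero, sub_zero, dist_eq_norm, abs_of_nonneg (by positivity)] at h1
    have hq : ((q.1 : ℕ) : ℝ) ≤ I := by exact_mod_cast q.1.2.le
    have h2 : ‖(φ (2 * (q.1 : ℕ)) a).1 - a.1‖ ≤ K * (2 * I) :=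
      (norm_fst_le (φ (2 * (q.1 : ℕ)) a - a)).trans (h1.trans (by gcongr))
    have h3 : ‖a.1 - z₀.1‖ ≤ 1 :=
      (norm_fst_le (a - z₀)).trans ((mem_ball_iff_norm.1 ha).le.trans hρ1)
    refine ⟨?_, ?_⟩
    · rw [mem_closedBall_iff_norm]
      have h4 := norm_intVec_le q.2
      calc ‖(φ (2 * (q.1 : ℕ)) a + v q.2).1 - z₀.1‖
          = ‖((φ (2 * (q.1 : ℕ)) a).1 - a.1) + (a.1 - z₀.1) + (v q.2).1‖ := by
            congr 1; rw [Prod.fst_add]; abel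
        _ ≤ K * (2 * I) + 1 + N := (norm_add₃_le).trans (by gcongr)
        _ ≤ 2 * N := by linarith
    · rw [mem_closedBall_zero_iff, Prod.snd_add]
      simp only [v, add_zero]
      exact hR _ (by rw [h.energy]; exact hball a ha)
  have hlt : volume.restrict D Set.univ < ∑ q, volume.restrict D (S q) := by
    simp only [Measure.restrict_eq_self _ (hSD _), hSvol, Measure.restrict_apply_univ,
      Finset.sum_const, Finset.card_univ, Fintype.card_prod, Fintype.card_pi, Finset.prod_const,
      Fintype.card_fin, nsmul_eq_mul]
    refine hDvol.trans_lt ?_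
    rw [ENNReal.ofReal_pow hN0.le, ENNReal.ofReal_natCast]
    push_cast
    rw [mul_comm (I : ENNReal), mul_assoc]
    exact ENNReal.mul_lt_mul_right (by exact_mod_cast (pow_pos hN0 n).ne')
      (ENNReal.pow_ne_top (ENNReal.natCast_ne_top N)) hI
  obtain ⟨q, -, q', -, hqq, z, hz, hz'⟩ := exists_nonempty_inter_of_measure_univ_lt_sum_measure
    (volume.restrict D) (fun q _ => (hSm q).nullMeasurableSet) hlt
  obtain ⟨a, ha, hza⟩ := hSeq q z hz
  obtain ⟨b, hb, hzb⟩ := hSeq q' z hz'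
  refine ⟨q.1, q'.1, fun i => ((q.2 i : ℕ) : ℤ), fun i => ((q'.2 i : ℕ) : ℤ), a, b, ?_, ha, hb,
    hza.trans hzb.symm⟩
  by_contra hcon
  push Not at hcon
  refine hqq (Prod.ext (Fin.ext hcon.1) (funext fun i => Fin.ext ?_))
  exact_mod_cast congrFun hcon.2 i

/-- Poincaré recurrence on the torus, with explicit translation vector. -/
lemma exists_recurrent_mem_ball (h : TonelliFlow n H φ) (z₀ : E n × E n) {ρ : ℝ} (hρ : 0 < ρ)
    (hρ1 : ρ ≤ 1 / 2) :
    ∃ z ∈ Metric.ball z₀ ρ, ∃ T, 2 ≤ T ∧ ∃ r : Fin n → ℤ,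
      ‖(φ T z).1 - z.1 - intVec r‖ ≤ 2 * ρ := by
  have hdist : ∀ a ∈ Metric.ball z₀ ρ, ∀ b ∈ Metric.ball z₀ ρ, ‖a.1 - b.1‖ < 2 * ρ := by
    intro a ha b hb
    refine (norm_fst_le (a - b)).trans_lt ?_
    rw [← dist_eq_norm]
    linarith [dist_triangle_right a b z₀, Metric.mem_ball.1 ha, Metric.mem_ball.1 hb]
  have hinj : ∀ {i j : ℕ} {m m' : Fin n → ℤ} {a b : E n × E n},
      φ (2 * i) a + (intVec m, 0) = φ (2 * j) b + (intVec m', 0) →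
      a + (intVec m, 0) = φ (2 * (j - i)) b + (intVec m', 0) := by
    intro i j m m' a b he
    have htr : ∀ t (z : E n × E n) (m : Fin n → ℤ),
        φ t (z + (intVec m, 0)) = φ t z + (intVec m, 0) := fun t z m => by
      have e : ∀ w : E n × E n, w + (intVec m, 0) = (w.1 + intVec m, w.2) := fun w =>
        Prod.ext rfl (add_zero w.2)
      rw [e, e, h.flow_translate]
    refine h.injective_flow (2 * i) ?_
    rw [htr, htr, he, ← h.flow_add]
    congr 2
    ring
  have key : ∀ {i j : ℕ} {m m' : Fin n → ℤ} {a b : E n × E n}, i < j →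
      a ∈ Metric.ball z₀ ρ → b ∈ Metric.ball z₀ ρ →
      φ (2 * i) a + (intVec m, 0) = φ (2 * j) b + (intVec m', 0) →
      ∃ z ∈ Metric.ball z₀ ρ, ∃ T, 2 ≤ T ∧ ∃ r : Fin n → ℤ,
        ‖(φ T z).1 - z.1 - intVec r‖ ≤ 2 * ρ := by
    intro i j m m' a b hij ha hb he
    have hij' : (i : ℝ) + 1 ≤ j := by exact_mod_cast hij
    refine ⟨b, hb, 2 * (j - i), by linarith, m - m', ?_⟩
    have h1 := congrArg Prod.fst (hinj he)
    simp only [Prod.fst_add] at h1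
    rw [eq_sub_of_add_eq h1.symm, intVec_sub]
    rw [show a.1 + intVec m - intVec m' - b.1 - (intVec m - intVec m') = a.1 - b.1 by abel]
    exact (hdist a ha b hb).le
  obtain ⟨i, j, m, m', a, b, hne, ha, hb, he⟩ := h.exists_flow_add_eq z₀ hρ (by linarith)
  rcases lt_trichotomy i j with hij | rfl | hij
  · exact key hij ha hb he
  · exfalso
    refine hne.elim (fun h => h rfl) fun hm => hm (eq_of_norm_intVec_sub_lt_one ?_)
    have h1 := congrArg Prod.fst (hinj he)
    rw [sub_self, mul_zero, h.flow_zero] at h1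
    simp only [Prod.fst_add] at h1
    have h2 := hdist b hb a ha
    rw [show intVec m - intVec m' = b.1 - a.1 by
      rw [eq_sub_of_add_eq h1]; abel]
    linarith
  · exact key hij hb ha he.symm

end TonelliFlow

namespace FreeFlow

variable {n : ℕ} {H : E n × E n → ℝ} {φ : ℝ → E n × E n → E n × E n}

lemma leaf_surjective (h : FreeFlow n H φ) (x p : E n) : ∃ c, leaf n H φ (x, c) = p := by
  obtain ⟨C, hC0, hC⟩ := h.exists_leaf_near_of_recurrent (‖p‖ + 1)
  set ρ : ℕ → ℝ := fun k => 1 / (2 * (C + 1)) * (1 / ((k : ℝ) + 1)) with hρ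
  have hρ0 : ∀ k, 0 < ρ k := fun k => by positivity
  have hρC : ∀ k, 2 * ρ k * (C + 1) ≤ 1 := fun k => by
    have h1 : 1 / ((k : ℝ) + 1) ≤ 1 := by
      rw [div_le_one (by positivity)]; linarith [k.cast_nonneg (α := ℝ)]
    have h2 : 2 * ρ k * (C + 1) = 1 / ((k : ℝ) + 1) := by simp only [hρ]; field_simp
    linarith
  have hρ1 : ∀ k, ρ k ≤ 1 / 2 := fun k => by nlinarith [hρC k, hρ0 k, mul_pos (hρ0 k) hC0]
  have hρlim : Tendsto ρ atTop (𝓝 0) := by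
    have := (tendsto_one_div_add_atTop_nhds_zero_nat (𝕜 := ℝ)).const_mul (1 / (2 * (C + 1)))
    rwa [mul_zero] at this
  choose z hz T hT r hr using fun k => h.exists_recurrent_mem_ball (x, p) (hρ0 k) (hρ1 k)
  have hzdist : ∀ k, ‖z k - (x, p)‖ ≤ ρ k := fun k => (mem_ball_iff_norm.1 (hz k)).le
  have hz2 : ∀ k, ‖(z k).2‖ ≤ ‖p‖ + 1 := fun k => by
    have h1 : ‖(z k).2 - p‖ ≤ ‖z k - (x, p)‖ := _root_.norm_snd_le (z k - (x, p))
    linarith [norm_le_norm_add_norm_sub' (z k).2 p, hzdist k, hρ1 k]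
  choose c hc using fun k => hC (z k).1 (z k).2 (hz2 k) (T k) (hT k) (r k) (2 * ρ k)
    (by linarith [hρC k, hρ0 k]) (hr k)
  have hsqrt : Tendsto (fun k => C * √(C * (2 * ρ k))) atTop (𝓝 0) := by
    have : Tendsto (fun k => C * √(C * (2 * ρ k))) atTop (𝓝 (C * √(C * (2 * 0)))) :=
      ((hρlim.const_mul 2).const_mul C).sqrt.const_mul C
    simpa using this
  have hzlim : Tendsto z atTop (𝓝 (x, p)) := by
    rw [tendsto_iff_norm_sub_tendsto_zero]
    exact squeeze_zero (fun _ => norm_nonneg _) hzdist hρlim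
  have hleaf : Tendsto (fun k => leaf n H φ ((z k).1, c k)) atTop (𝓝 p) := by
    have h1 : Tendsto (fun k => (z k).2 - leaf n H φ ((z k).1, c k)) atTop (𝓝 0) :=
      squeeze_zero_norm hc hsqrt
    simpa using ((continuous_snd.tendsto (x, p)).comp hzlim).sub h1
  obtain ⟨Q, hQ⟩ := h.exists_class_bound (‖p‖ + 1)
  have hev : ∀ᶠ k in atTop, c k ∈ Metric.closedBall (0 : E n) Q := by
    filter_upwards [hleaf.norm.eventually_le_const (lt_add_one ‖p‖)] with k hk
    exact mem_closedBall_zero_iff.2 (hQ _ _ hk)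
  obtain ⟨c₀, -, ψ, hψ, hcψ⟩ :=
    (isCompact_closedBall (0 : E n) Q).tendsto_subseq' hev.frequently
  refine ⟨c₀, tendsto_nhds_unique ?_ (hleaf.comp hψ.tendsto_atTop)⟩
  have h1 : Tendsto (fun k => ((z (ψ k)).1, c (ψ k))) atTop (𝓝 (x, c₀)) :=
    (((continuous_fst.tendsto (x, p)).comp hzlim).comp hψ.tendsto_atTop).prodMk_nhds hcψ
  exact (h.continuous_leaf.tendsto _).comp h1

/-- Every cotangent fibre is parametrised homeomorphically by cohomology classes. -/
lemma exists_homeomorph_leaf (h : FreeFlow n H φ) (x : E n) :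
    ∃ e : E n ≃ₜ E n, ∀ c, e c = leaf n H φ (x, c) := by
  have hcont : Continuous fun c => leaf n H φ (x, c) :=
    h.continuous_leaf.comp (Continuous.prodMk_right x)
  have hproper : IsProperMap fun c => leaf n H φ (x, c) := by
    rw [isProperMap_iff_tendsto_cocompact]
    refine ⟨hcont, ?_⟩
    rw [← Metric.cobounded_eq_cocompact, ← comap_norm_atTop, tendsto_comap_iff, tendsto_atTop]
    intro R
    obtain ⟨Q, hQ⟩ := h.exists_class_bound R
    filter_upwards [tendsto_comap.eventually_gt_atTop Q] with c hc
    by_contra hcon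
    exact (hQ x c (not_le.1 hcon).le).not_gt hc
  exact ⟨(Equiv.ofBijective _ ⟨fun _ _ => h.leaf_injective, h.leaf_surjective x⟩
    ).toHomeomorphOfContinuousClosed hcont hproper.isClosedMap, fun _ => rfl⟩

end FreeFlow

end FoliationByGraphs

/-- A Tonelli Hamiltonian on `T*𝕋ⁿ` has no conjugate points if and only
if `T*𝕋ⁿ` admits a continuous foliation by Lipschitz, Lagrangian, flow-invariant graphs:
there is a continuous `F : ℝⁿ × ℝⁿ → ℝⁿ`, periodic in `x`, such that each
`𝒯_c = {(x, F(x,c))}` is a Lipschitz Lagrangian graph of cohomology class `c` invariant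
under the flow, and `c ↦ F (x, c)` is a homeomorphism of `ℝⁿ` for every `x`. -/
theorem no_conjugate_points_iff_foliation (n k : ℕ) (hn : 1 ≤ n) (hk : 2 ≤ k)
    (H : E n × E n → ℝ) (hH : IsTonelliHamiltonian n (k : ℕ∞) H)
    (φ : ℝ → E n × E n → E n × E n) (hφ : IsHamFlow n H φ)
    (hφsm : ∀ t : ℝ, ContDiff ℝ 1 (φ t)) :
    NoConjugatePoints n φ ↔
      ∃ F : E n × E n → E n,
        Continuous F ∧
        -- (i) periodicity in `x`
        (∀ (x c : E n) (m : Fin n → ℤ), F (x + intVec m, c) = F (x, c)) ∧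
        -- (ii) each graph is a Lipschitz Lagrangian graph of cohomology class `c`
        (∀ c : E n,
          (∃ K : ℝ≥0, LipschitzWith K fun x => F (x, c)) ∧
          ∃ u : E n → ℝ, ContDiff ℝ 1 u ∧
            (∀ (x : E n) (m : Fin n → ℤ), u (x + intVec m) = u x) ∧
            ∀ x : E n, F (x, c) = c + gradF n u x) ∧
        -- (iii) each graph is invariant under the Hamiltonian flow
        (∀ (c : E n) (t : ℝ) (x : E n),
          (φ t (x, F (x, c))).2 = F ((φ t (x, F (x, c))).1, c)) ∧
        -- (iv) for each `x`, `c ↦ F (x, c)` is a homeomorphism of `ℝⁿ`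
        (∀ x : E n, ∃ h : E n ≃ₜ E n, ∀ c : E n, h c = F (x, c)) := by
  have htf : TonelliFlow n H φ :=
    { smooth := hH.smooth.of_le (WithTop.coe_le_coe.2 (by exact_mod_cast hk : (2 : ℕ∞) ≤ k))
      periodic := hH.periodic
      superlinear := hH.superlinear
      posdef := hH.posdef
      flow := hφ
      flow_smooth := hφsm }
  constructor
  · intro hncp
    have h : FreeFlow n H φ := { toTonelliFlow := htf, one_le := hn, ncp := hncp }
    exact ⟨leaf n H φ, h.continuous_leaf, h.leaf_translate,
      fun c => ⟨h.lipschitz_leaf c, subsol n H φ c, h.contDiff_subsol c,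
        (h.isSubsol_subsol c).periodic, fun _ => rfl⟩,
      h.leaf_invariant, h.exists_homeomorph_leaf⟩
  · rintro ⟨F, -, -, hgr, hinv, hhom⟩
    refine htf.noConjugatePoints_of_graphs fun x p => ?_
    obtain ⟨e, he⟩ := hhom x
    obtain ⟨⟨K, hK⟩, u, hu, -, hFu⟩ := hgr (e.symm p)
    exact ⟨fun y => F (y, e.symm p), K, e.symm p, u,
      (he _).symm.trans (e.apply_symm_apply p), hK, hu, hFu, hinv (e.symm p)⟩

end
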